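/- Let s ∈ ℂ with Re(s) > −1/2, and let F_∞ be the Fredholm determinant associated with the limiting kernel K_∞ restricted to (0,∞)². Then F_∞ is C³ and nonvanishing on (0,∞), so that θ_∞(τ) := τ · (d/dτ) log F_∞(τ^{−1}) is well defined and C² on (0,∞), and θ_∞ is a solution on (0,∞) of the σ-form of the Painlevé-V equation: −τ²(θ″(τ))² = [2(τθ′(τ) − θ(τ)) + (θ′(τ))² + i(s̄ − s)θ′(τ)]² − (θ′(τ))²(θ′(τ) − 2is)(θ′(τ) + 2is̄), where the real-valued function θ_∞ and its derivatives are regarded as complex numbers and the identity holds in ℂ. -/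

import Mathlib

noncomputable section

open Complex MeasureTheory Filter Set

/-- Rising Pochhammer symbol `(x)_n = x(x+1)⋯(x+n−1)`. -/
def poch (x : ℂ) (n : ℕ) : ℂ := ∏ i ∈ Finset.range n, (x + i)

/-- Confluent hypergeometric series `₁F₁[r, q; z]`. -/
def oneF1 (r q z : ℂ) : ℂ := ∑' n : ℕ, poch r n / (poch q n * n.factorial) * z ^ n

/-- Terminating Gauss hypergeometric series `₂F₁[−m, b, c; z]`. -/
def twoF1neg (m : ℕ) (b c z : ℂ) : ℂ :=
  ∑ k ∈ Finset.range (m + 1),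
    poch (-(m : ℂ)) k * poch b k / (poch c k * (k.factorial : ℂ)) * z ^ k

/-- The common prefactor `|2/x|^{Re s} e^{−i/x + π Im(s) Sgn(x)/2}`. -/
def prefac (s : ℂ) (x : ℝ) : ℂ :=
  ((|2 / x| ^ s.re : ℝ) : ℂ) *
    Complex.exp (-Complex.I / (x : ℂ) + ((Real.pi * s.im * Real.sign x / 2 : ℝ) : ℂ))

/-- `P̃(x) = |2/x|^{Re s} e^{−i/x + π Im(s) Sgn(x)/2} ₁F₁[s, 2Re(s)+1; 2i/x]`. -/
def Ptilde (s : ℂ) (x : ℝ) : ℂ :=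
  prefac s x * oneF1 s ((2 * s.re + 1 : ℝ) : ℂ) (2 * Complex.I / (x : ℂ))

/-- `Q(x) = (2/x)|2/x|^{Re s} e^{−i/x + π Im(s) Sgn(x)/2} ₁F₁[s+1, 2Re(s)+2; 2i/x]`. -/
def Qfun (s : ℂ) (x : ℝ) : ℂ :=
  (2 / (x : ℂ)) * prefac s x * oneF1 (s + 1) ((2 * s.re + 2 : ℝ) : ℂ) (2 * Complex.I / (x : ℂ))

/-- The constant in front of the limiting kernel `K_∞`. -/
def cinf (s : ℂ) : ℂ :=
  (1 / (2 * (Real.pi : ℂ))) *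
    (Complex.Gamma (s + 1) * Complex.Gamma ((starRingEnd ℂ) s + 1) /
      (Complex.Gamma ((2 * s.re + 1 : ℝ) : ℂ) * Complex.Gamma ((2 * s.re + 2 : ℝ) : ℂ)))

/-- The limiting kernel `K_∞`, as a complex number (it is in fact real). -/
def KinfC (s : ℂ) (x y : ℝ) : ℂ :=
  if x = y then cinf s * (deriv (Ptilde s) x * Qfun s x - deriv (Qfun s) x * Ptilde s x)
  else cinf s * (Ptilde s x * Qfun s y - Qfun s x * Ptilde s y) / ((x : ℂ) - (y : ℂ))

/-- The limiting kernel `K_∞` (real-valued). -/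
def Kinf (s : ℂ) (x y : ℝ) : ℝ := (KinfC s x y).re

/-- The generalized Cauchy weight `w_H` on `ℝ`. -/
def wH (s : ℂ) (N : ℕ) (x : ℝ) : ℝ :=
  (1 + x ^ 2) ^ (-s.re - (N : ℝ)) * Real.exp (2 * s.im * Complex.arg (1 + Complex.I * x))

/-- The polynomial `p_{N−1}`. -/
def pPrev (s : ℂ) (N : ℕ) (x : ℝ) : ℂ :=
  ((x : ℂ) - Complex.I) ^ (N - 1) *
    twoF1neg (N - 1) (s + 1) ((2 * s.re + 2 : ℝ) : ℂ) (2 / (1 + Complex.I * (x : ℂ)))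

/-- The polynomial `p̃_N`. -/
def pTil (s : ℂ) (N : ℕ) (x : ℝ) : ℂ :=
  ((x : ℂ) - Complex.I) ^ N *
    twoF1neg N s ((2 * s.re + 1 : ℝ) : ℂ) (2 / (1 + Complex.I * (x : ℂ)))

/-- The constant `C_{N,s}`. -/
def CNs (s : ℂ) (N : ℕ) : ℂ :=
  (((2 : ℝ) ^ (2 * s.re) / Real.pi : ℝ) : ℂ) *
    (Complex.Gamma ((2 * s.re + N + 1 : ℝ) : ℂ) * Complex.Gamma (s + 1) *
        Complex.Gamma ((starRingEnd ℂ) s + 1) /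
      (Complex.Gamma (N : ℂ) * Complex.Gamma ((2 * s.re + 1 : ℝ) : ℂ) *
        Complex.Gamma ((2 * s.re + 2 : ℝ) : ℂ)))

def phiN (s : ℂ) (N : ℕ) (x : ℝ) : ℂ := pTil s N x * (Real.sqrt (wH s N x) : ℂ)

def psiN (s : ℂ) (N : ℕ) (x : ℝ) : ℂ := pPrev s N x * (Real.sqrt (wH s N x) : ℂ)

/-- The finite-`N` kernel `K_N` (complex form; extended to the diagonal by continuity,
i.e. by the Bernoulli–l'Hôpital expression). -/
def KNC (s : ℂ) (N : ℕ) (x y : ℝ) : ℂ :=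
  if x = y then CNs s N * (deriv (phiN s N) x * psiN s N x - deriv (psiN s N) x * phiN s N x)
  else CNs s N * (phiN s N x * psiN s N y - psiN s N x * phiN s N y) / ((x : ℂ) - (y : ℂ))

/-- The finite-`N` kernel `K_N` (real-valued). -/
def KN (s : ℂ) (N : ℕ) (x y : ℝ) : ℝ := (KNC s N x y).re

/-- The rescaled kernel `K_[N](x,y) = N · K_N(Nx, Ny)`. -/
def Kscaled (s : ℂ) (N : ℕ) (x y : ℝ) : ℝ := N * KN s N (N * x) (N * y)

/-- `P̃_N`. -/
def PtildeN (s : ℂ) (N : ℕ) (x : ℝ) : ℂ :=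
  (((2 : ℝ) ^ s.re : ℝ) : ℂ) *
    (Real.sqrt (Real.Gamma (2 * s.re + N + 1) / (N * Real.Gamma N)) : ℂ) *
    pTil s N (N * x) * (Real.sqrt (wH s N (N * x)) : ℂ)

/-- `Q_N`. -/
def QN (s : ℂ) (N : ℕ) (x : ℝ) : ℂ :=
  (((2 : ℝ) ^ (s.re + 1) : ℝ) : ℂ) *
    (Real.sqrt (N * Real.Gamma (2 * s.re + N + 1) / Real.Gamma N) : ℂ) *
    pPrev s N (N * x) * (Real.sqrt (wH s N (N * x)) : ℂ)

/-- `k`-point correlation function of a kernel. -/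
def rhoK (K : ℝ → ℝ → ℝ) (k : ℕ) (x : Fin k → ℝ) : ℝ :=
  Matrix.det (Matrix.of fun i j => K (x i) (x j))

/-- The Fredholm determinant of a kernel restricted to `(t,∞)²`. -/
def fredholmDet (K : ℝ → ℝ → ℝ) (t : ℝ) : ℝ :=
  1 + ∑' k : ℕ, ((-1 : ℝ) ^ (k + 1) / (k + 1).factorial) *
    ∫ x : Fin (k + 1) → ℝ in Set.univ.pi fun _ => Set.Ioi t, rhoK K (k + 1) x

/-- Mixed partial derivative `∂^{p+q}K/∂x^p∂y^q`. -/
def pderiv₂ (K : ℝ → ℝ → ℝ) (p q : ℕ) (x y : ℝ) : ℝ :=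
  iteratedDeriv p (fun x' => iteratedDeriv q (fun y' => K x' y') y) x

/-- `F_{n,h,a}(x) = ₂F₁[−n, h, a; 2/(1+ix)]` (a terminating series). -/
def Fnha (n : ℕ) (h : ℂ) (a : ℝ) (x : ℝ) : ℂ :=
  ∑' k : ℕ, poch (-(n : ℂ)) k * poch h k / (poch (a : ℂ) k * (k.factorial : ℂ)) *
    (2 / (1 + Complex.I * (x : ℂ))) ^ k

/-- `θ(τ) = τ (d/dτ) log F(τ⁻¹)`. -/
def thetaOf (F : ℝ → ℝ) (τ : ℝ) : ℝ := τ * deriv (fun u => Real.log (F u⁻¹)) τ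

/-- Squared Vandermonde determinant `∏_{j<k} (x_j − x_k)²`. -/
def vandSq (N : ℕ) (x : Fin N → ℝ) : ℝ :=
  ∏ p ∈ Finset.univ.filter fun p : Fin N × Fin N => p.1 < p.2, (x p.1 - x p.2) ^ 2

/-- `φ(x,y) = (f(x)g(y) − g(x)f(y))/(x−y)`, extended to the diagonal. -/
def phiFG (f g : ℝ → ℝ) (x y : ℝ) : ℝ :=
  if x = y then deriv f x * g x - deriv g x * f x else (f x * g y - g x * f y) / (x - y)

/-- `θ_∞(τ) = τ (d/dτ) log F_∞(τ⁻¹)` for the Fredholm determinant of `K_∞`. -/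
def thetaInf (s : ℂ) : ℝ → ℝ := thetaOf (fredholmDet (Kinf s))

lemma hasSum_of_eq {f g : ℕ → ℂ} {a : ℂ} (h : HasSum f a) (e : ∀ n, g n = f n) : HasSum g a := by
  rwa [funext e]

/-! ### Confluent hypergeometric series -/

lemma poch_zero (x : ℂ) : poch x 0 = 1 := by simp [poch]

lemma poch_succ (x : ℂ) (n : ℕ) : poch x (n + 1) = poch x n * (x + n) := by
  simp [poch, Finset.prod_range_succ]

lemma poch_succ' (x : ℂ) (n : ℕ) : poch x (n + 1) = x * poch (x + 1) n := by
  simp only [poch, Finset.prod_range_succ', Nat.cast_zero, add_zero, mul_comm x]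
  congr 1
  refine Finset.prod_congr rfl fun i _ => ?_
  push_cast; ring

lemma poch_ne_zero {q : ℂ} (hq : ∀ n : ℕ, q + n ≠ 0) (n : ℕ) : poch q n ≠ 0 :=
  Finset.prod_ne_zero_iff.2 fun i _ => hq i

lemma conj_poch (x : ℂ) (n : ℕ) : (starRingEnd ℂ) (poch x n) = poch ((starRingEnd ℂ) x) n := by
  simp [poch, map_prod]

lemma add_one_ne {q : ℂ} (hq : ∀ n : ℕ, q + n ≠ 0) (n : ℕ) : q + 1 + n ≠ 0 := by
  have := hq (n + 1)
  push_cast at this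
  rwa [add_right_comm, add_assoc]

/-- Coefficients of the confluent hypergeometric series. -/
def kcoef (r q : ℂ) (n : ℕ) : ℂ := poch r n / (poch q n * n.factorial)

lemma oneF1_eq (r q z : ℂ) : oneF1 r q z = ∑' n, kcoef r q n * z ^ n := rfl

lemma kcoef_succ {q : ℂ} (hq : ∀ n : ℕ, q + n ≠ 0) (r : ℂ) (n : ℕ) :
    kcoef r q (n + 1) = kcoef r q n * ((r + n) / ((q + n) * (n + 1))) := by
  have h1 := poch_ne_zero hq n
  have h2 := hq n
  have h3 : (n.factorial : ℂ) ≠ 0 := by exact_mod_cast n.factorial_ne_zero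
  have h4 : (n : ℂ) + 1 ≠ 0 := by exact_mod_cast n.succ_ne_zero
  simp only [kcoef, poch_succ, Nat.factorial_succ]
  push_cast
  field_simp

lemma summable_kcoef {q : ℂ} (hq : ∀ n : ℕ, q + n ≠ 0) (r z : ℂ) :
    Summable fun n => ‖kcoef r q n * z ^ n‖ := by
  have hlim : Tendsto (fun n : ℕ => ‖z * ((r + n) / ((q + n) * (n + 1)))‖) atTop (nhds 0) := by
    have h1 : Tendsto (fun n : ℕ => (r + 1 * (n : ℂ)) / (q + 1 * (n : ℂ))) atTop (nhds (1 / 1)) := by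
      have := tendsto_add_mul_div_add_mul_atTop_nhds r q (1 : ℂ) (d := (1 : ℂ)) one_ne_zero
      exact this
    have h2 : Tendsto (fun n : ℕ => (1 : ℂ) / ((n : ℂ) + 1)) atTop (nhds 0) :=
      tendsto_one_div_add_atTop_nhds_zero_nat (𝕜 := ℂ)
    have := (tendsto_const_nhds (x := z)).mul (h1.mul h2)
    simp only [mul_zero] at this
    have := this.norm
    rw [norm_zero] at this
    refine this.congr fun n => ?_
    congr 2
    rw [one_mul, div_mul_div_comm, mul_one]
  have hev := hlim.eventually (ge_mem_nhds (show (0 : ℝ) < 1 / 2 by norm_num))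
  refine summable_of_ratio_norm_eventually_le (r := 1 / 2) (by norm_num) ?_
  filter_upwards [hev] with n hn
  rw [kcoef_succ hq, pow_succ, norm_norm, norm_norm]
  calc _ = ‖z * ((r + n) / ((q + n) * (n + 1)))‖ * ‖kcoef r q n * z ^ n‖ := by
        rw [← norm_mul]; congr 1; ring
    _ ≤ _ := mul_le_mul_of_nonneg_right hn (norm_nonneg _)

lemma hasSum_oneF1 {q : ℂ} (hq : ∀ n : ℕ, q + n ≠ 0) (r z : ℂ) :
    HasSum (fun n => kcoef r q n * z ^ n) (oneF1 r q z) :=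
  (summable_kcoef hq r z).of_norm.hasSum

lemma oneF1_zero {q : ℂ} (hq : ∀ n : ℕ, q + n ≠ 0) (r : ℂ) : oneF1 r q 0 = 1 := by
  have h := hasSum_oneF1 hq r 0
  have h' := hasSum_single (f := fun n => kcoef r q n * (0 : ℂ) ^ n) 0 (fun n hn => by simp [hn])
  rw [h.unique h']
  simp [kcoef, poch_zero]

lemma kcoef_bound (q r : ℂ) (R : ℝ) (n : ℕ) (w : ℂ)
    (hw : w ∈ Metric.ball (0 : ℂ) R) :
    ‖kcoef r q n * w ^ n‖ ≤ ‖kcoef r q n * (R : ℂ) ^ n‖ := by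
  have h1 : ‖w‖ < R := by simpa using hw
  have h2 : ‖(R : ℂ)‖ = R := by simpa using (norm_nonneg w).trans h1.le
  rw [norm_mul, norm_mul, norm_pow, norm_pow, h2]
  gcongr

lemma differentiable_oneF1 {q : ℂ} (hq : ∀ n : ℕ, q + n ≠ 0) (r : ℂ) :
    Differentiable ℂ (oneF1 r q) := by
  intro z
  have hd := differentiableOn_tsum_of_summable_norm (F := fun n w => kcoef r q n * w ^ n)
    (summable_kcoef hq r ((‖z‖ + 1 : ℝ) : ℂ)) (U := Metric.ball (0 : ℂ) (‖z‖ + 1))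
    (fun i => by fun_prop) Metric.isOpen_ball (kcoef_bound q r _)
  exact hd.differentiableAt (Metric.isOpen_ball.mem_nhds (by simp))

lemma continuous_oneF1 {q : ℂ} (hq : ∀ n : ℕ, q + n ≠ 0) (r : ℂ) : Continuous (oneF1 r q) :=
  (differentiable_oneF1 hq r).continuous

lemma hasSum_mul_deriv_oneF1 {q : ℂ} (hq : ∀ n : ℕ, q + n ≠ 0) (r z : ℂ) :
    HasSum (fun n => kcoef r q n * n * z ^ n) (z * deriv (oneF1 r q) z) := by
  have h := hasSum_deriv_of_summable_norm (F := fun n w => kcoef r q n * w ^ n)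
    (summable_kcoef hq r ((‖z‖ + 1 : ℝ) : ℂ)) (U := Metric.ball (0 : ℂ) (‖z‖ + 1))
    (fun i => by fun_prop) Metric.isOpen_ball (kcoef_bound q r _) (z := z) (by simp)
  refine hasSum_of_eq (h.mul_left z) fun n => ?_
  have h1 : deriv (fun w : ℂ => kcoef r q n * w ^ n) z = kcoef r q n * (n * z ^ (n - 1)) := by
    simp
  rw [h1]
  rcases n with _ | n
  · simp
  · simp only [Nat.add_sub_cancel, pow_succ]
    ring

lemma mul_deriv_oneF1 {q : ℂ} (hq : ∀ n : ℕ, q + n ≠ 0) (r z : ℂ) :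
    z * deriv (oneF1 r q) z = r * (oneF1 (r + 1) q z - oneF1 r q z) := by
  refine (hasSum_mul_deriv_oneF1 hq r z).unique ?_
  refine hasSum_of_eq (((hasSum_oneF1 hq (r + 1) z).sub (hasSum_oneF1 hq r z)).mul_left r) fun n => ?_
  have h := (poch_succ' r n).symm.trans (poch_succ r n)
  have h1 := poch_ne_zero hq n
  have h3 : (n.factorial : ℂ) ≠ 0 := by exact_mod_cast n.factorial_ne_zero
  simp only [kcoef]
  field_simp
  linear_combination (-z ^ n) * h

lemma oneF1_succ_sub {q : ℂ} (hq : ∀ n : ℕ, q + n ≠ 0) (r z : ℂ) :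
    oneF1 (r + 1) q z - oneF1 r q z = z / q * oneF1 (r + 1) (q + 1) z := by
  have hq0 : q ≠ 0 := by simpa using hq 0
  have h := (hasSum_oneF1 hq (r + 1) z).sub (hasSum_oneF1 hq r z)
  refine h.unique ?_
  rw [← hasSum_nat_add_iff' 1]
  simp only [Finset.range_one, Finset.sum_singleton, kcoef, poch_zero, sub_self, sub_zero]
  refine hasSum_of_eq ((hasSum_oneF1 (add_one_ne hq) (r + 1) z).mul_left (z / q)) fun n => ?_
  have h1 := poch_ne_zero (add_one_ne hq) n
  have h3 : (n.factorial : ℂ) ≠ 0 := by exact_mod_cast n.factorial_ne_zero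
  have h4 : (n : ℂ) + 1 ≠ 0 := by exact_mod_cast n.succ_ne_zero
  rw [kcoef, poch_succ' q, poch_succ' r, poch_succ (r + 1), Nat.factorial_succ]
  push_cast
  field_simp
  ring

lemma conj_oneF1 (r q z : ℂ) : (starRingEnd ℂ) (oneF1 r q z) =
    oneF1 ((starRingEnd ℂ) r) ((starRingEnd ℂ) q) ((starRingEnd ℂ) z) := by
  simp only [oneF1, Complex.conj_tsum, map_mul, map_div₀, conj_poch, map_pow, map_natCast]

lemma sum_choose_poch (n : ℕ) : ∀ {q : ℂ} (_ : ∀ n : ℕ, q + n ≠ 0) (r : ℂ),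
    ∑ k ∈ Finset.range (n + 1), (-1 : ℂ) ^ k * (n.choose k) * (poch r k / poch q k) =
      poch (q - r) n / poch q n := by
  induction n with
  | zero => intro q hq r; simp [poch_zero]
  | succ n ih =>
    intro q hq r
    have hq0 : q ≠ 0 := by simpa using hq 0
    have e1 : ∑ k ∈ Finset.range (n + 2), (-1 : ℂ) ^ k * ((n + 1).choose k) * (poch r k / poch q k)
        = ∑ k ∈ Finset.range (n + 1), (-1 : ℂ) ^ k * (n.choose k) * (poch r k / poch q k) -
          r / q * ∑ k ∈ Finset.range (n + 1), (-1 : ℂ) ^ k * (n.choose k) *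
            (poch (r + 1) k / poch (q + 1) k) := by
      rw [Finset.sum_range_succ' _ (n + 1),
        Finset.sum_range_succ' (fun k => (-1 : ℂ) ^ k * (n.choose k) * (poch r k / poch q k)) n]
      have e2 : ∑ k ∈ Finset.range (n + 1), (-1 : ℂ) ^ (k + 1) * ((n + 1).choose (k + 1)) *
          (poch r (k + 1) / poch q (k + 1)) =
          ∑ k ∈ Finset.range (n + 1), (-1 : ℂ) ^ (k + 1) * (n.choose (k + 1)) *
            (poch r (k + 1) / poch q (k + 1)) - r / q * ∑ k ∈ Finset.range (n + 1),
            (-1 : ℂ) ^ k * (n.choose k) * (poch (r + 1) k / poch (q + 1) k) := by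
        rw [Finset.mul_sum, ← Finset.sum_sub_distrib]
        refine Finset.sum_congr rfl fun k _ => ?_
        have h1 := poch_ne_zero (add_one_ne hq) k
        rw [Nat.choose_succ_succ, poch_succ', poch_succ']
        push_cast
        field_simp
        ring
      rw [e2, Finset.sum_range_succ _ n]
      simp
      ring
    rw [e1, ih hq, ih (add_one_ne hq)]
    have h1 := poch_ne_zero (add_one_ne hq) n
    have h2 := poch_ne_zero hq n
    have h3 := hq n
    have h4 := poch_ne_zero hq (n + 1)
    have h5 := (poch_succ' q n).symm.trans (poch_succ q n)
    have h6 : q * poch (q + 1) n ≠ 0 := mul_ne_zero hq0 h1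
    have : q + 1 - (r + 1) = q - r := by ring
    rw [this, div_mul_div_comm, h5, poch_succ, poch_succ]
    field_simp
    ring

/-- Kummer's transformation. -/
lemma kummer {q : ℂ} (hq : ∀ n : ℕ, q + n ≠ 0) (r z : ℂ) :
    Complex.exp (-z) * oneF1 r q z = oneF1 (q - r) q (-z) := by
  have h1 : Complex.exp (-z) = ∑' n : ℕ, (-z) ^ n / n.factorial := by
    rw [Complex.exp_eq_exp_ℂ, NormedSpace.exp_eq_tsum_div]
  have h2 : Summable fun n : ℕ => ‖(-z) ^ n / n.factorial‖ := NormedSpace.norm_expSeries_div_summable (-z)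
  rw [mul_comm, h1, oneF1_eq,
    tsum_mul_tsum_eq_tsum_sum_antidiagonal_of_summable_norm (summable_kcoef hq r z) h2, oneF1_eq]
  congr 1
  ext n
  rw [Finset.Nat.sum_antidiagonal_eq_sum_range_succ_mk]
  have h3 : kcoef (q - r) q n = (poch (q - r) n / poch q n) / n.factorial := by
    rw [kcoef, div_div]
  rw [h3, ← sum_choose_poch n hq r, Finset.sum_div, Finset.sum_mul]
  refine Finset.sum_congr rfl fun k hk => ?_
  have hk' : k ≤ n := Nat.lt_succ_iff.1 (Finset.mem_range.1 hk)
  have hc : (n.choose k : ℂ) = n.factorial / (k.factorial * (n - k).factorial) := by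
    rw [Nat.cast_choose ℂ hk']
  have f1 : (n.factorial : ℂ) ≠ 0 := by exact_mod_cast n.factorial_ne_zero
  have f2 : (k.factorial : ℂ) ≠ 0 := by exact_mod_cast k.factorial_ne_zero
  have f3 : ((n - k).factorial : ℂ) ≠ 0 := by exact_mod_cast (n - k).factorial_ne_zero
  have h4 := poch_ne_zero hq k
  rw [hc, kcoef]
  have hz : (-z) ^ n = (-1) ^ k * z ^ k * (-z) ^ (n - k) := by
    rw [← mul_pow, neg_one_mul, ← pow_add, Nat.add_sub_cancel' hk']
  have hs : ((-1 : ℂ) ^ k) * (-1) ^ k = 1 := by rw [← mul_pow]; simp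
  rw [hz]
  field_simp
  linear_combination (-poch r k * z ^ k * (-z) ^ (n - k)) * hs

/-! ### The power measure on the unit interval -/

/-- The coordinate `y ↦ y^{1/B}` on the unit interval. -/
def powI (B : ℝ) (y : ℝ) : unitInterval := projIcc 0 1 zero_le_one (y ^ (1 / B))

/-- The probability measure with density `B u^{B-1}` on the unit interval. -/
def muI (B : ℝ) : Measure unitInterval := (volume.restrict (Ioo (0 : ℝ) 1)).map (powI B)

lemma continuous_powI {B : ℝ} (hB : 0 < B) : Continuous (powI B) :=
  continuous_projIcc.comp (Real.continuous_rpow_const (by positivity))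

lemma coe_powI {B : ℝ} (hB : 0 < B) {y : ℝ} (h0 : 0 ≤ y) (h1 : y ≤ 1) :
    (powI B y : ℝ) = y ^ (1 / B) := by
  rw [powI, projIcc_of_mem zero_le_one
    ⟨Real.rpow_nonneg h0 _, Real.rpow_le_one h0 h1 (by positivity)⟩]

lemma isProbabilityMeasure_muI {B : ℝ} (hB : 0 < B) : IsProbabilityMeasure (muI B) := by
  have : IsProbabilityMeasure (volume.restrict (Ioo (0 : ℝ) 1)) := ⟨by simp⟩
  exact Measure.isProbabilityMeasure_map (continuous_powI hB).aemeasurable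

section
variable {E : Type*} [NormedAddCommGroup E] [NormedSpace ℝ E]

lemma integral_muI {B : ℝ} (hB : 0 < B) {f : unitInterval → E} (hf : Continuous f) :
    ∫ u, f u ∂(muI B) = ∫ y in (0 : ℝ)..1, f (powI B y) := by
  rw [muI, integral_map (continuous_powI hB).aemeasurable hf.aestronglyMeasurable,
    intervalIntegral.integral_of_le zero_le_one, integral_Ioc_eq_integral_Ioo]

lemma integral_muI_coe {B : ℝ} (hB : 0 < B) {f : ℝ → E} (hf : Continuous f) :
    ∫ u : unitInterval, f u ∂(muI B) = ∫ y in (0 : ℝ)..1, f (y ^ (1 / B)) := by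
  rw [integral_muI hB (f := fun u : unitInterval => f u) (hf.comp continuous_subtype_val)]
  refine intervalIntegral.integral_congr fun y hy => ?_
  rw [uIcc_of_le zero_le_one] at hy
  simp only [coe_powI hB hy.1 hy.2]

lemma rpow_smul_integral_muI {B : ℝ} (hB : 0 < B) {f : ℝ → E} (hf : Continuous f) {t : ℝ}
    (ht : 0 < t) :
    t ^ B • ∫ u : unitInterval, f (t * u) ∂(muI B) = ∫ w in (0 : ℝ)..(t ^ B), f (w ^ (1 / B)) := by
  have h1 := integral_muI_coe hB (f := fun x => f (t * x)) (by fun_prop)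
  have hc : 0 < t ^ B := Real.rpow_pos_of_pos ht B
  have h2 := intervalIntegral.smul_integral_comp_mul_left (a := 0) (b := 1)
    (fun w : ℝ => f (w ^ (1 / B))) (t ^ B)
  rw [mul_zero, mul_one] at h2
  rw [h1, ← h2]
  congr 1
  refine intervalIntegral.integral_congr fun y hy => ?_
  rw [uIcc_of_le zero_le_one] at hy
  rw [Real.mul_rpow hc.le hy.1, ← Real.rpow_mul ht.le, mul_one_div_cancel hB.ne', Real.rpow_one]

lemma hasDerivAt_rpow_smul_integral_muI [CompleteSpace E] {B : ℝ} (hB : 0 < B) {f : ℝ → E}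
    (hf : Continuous f) {t : ℝ} (ht : 0 < t) :
    HasDerivAt (fun t : ℝ => t ^ B • ∫ u : unitInterval, f (t * u) ∂(muI B))
      ((B * t ^ (B - 1)) • f t) t := by
  have hg : Continuous fun w : ℝ => f (w ^ (1 / B)) :=
    hf.comp (Real.continuous_rpow_const (by positivity))
  have h1 := intervalIntegral.integral_hasDerivAt_right (hg.intervalIntegrable 0 (t ^ B))
    (hg.stronglyMeasurableAtFilter _ _) hg.continuousAt
  have h2 := Real.hasDerivAt_rpow_const (x := t) (p := B) (Or.inl ht.ne')
  have h3 := h1.scomp t h2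
  rw [← Real.rpow_mul ht.le, mul_one_div_cancel hB.ne', Real.rpow_one] at h3
  refine h3.congr_of_eventuallyEq ?_
  filter_upwards [lt_mem_nhds ht] with x hx
  exact rpow_smul_integral_muI hB hf hx
end

/-! ### The two entire functions and the kernel -/

/-- The exponent `2 Re s + 1`. -/
def Bs (s : ℂ) : ℝ := 2 * s.re + 1

lemma Bs_pos {s : ℂ} (hs : -(1 / 2 : ℝ) < s.re) : 0 < Bs s := by unfold Bs; linarith

lemma Bs_ne {s : ℂ} (hs : -(1 / 2 : ℝ) < s.re) (n : ℕ) : ((Bs s : ℝ) : ℂ) + n ≠ 0 := by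
  have := Bs_pos hs
  have h : (0 : ℝ) < Bs s + n := by positivity
  exact_mod_cast h.ne'

lemma Bs_coe (s : ℂ) : ((Bs s : ℝ) : ℂ) = s + (starRingEnd ℂ) s + 1 := by
  rw [Complex.add_conj, Bs]; push_cast; ring

/-- `e^{-iz} ₁F₁[s, 2 Re s + 1; 2iz]`. -/
def pf (s z : ℂ) : ℂ := Complex.exp (-(I * z)) * oneF1 s (Bs s : ℝ) (2 * I * z)

/-- `e^{-iz} ₁F₁[s + 1, 2 Re s + 1; 2iz]`. -/
def pg (s z : ℂ) : ℂ := Complex.exp (-(I * z)) * oneF1 (s + 1) (Bs s : ℝ) (2 * I * z)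

section
variable {s : ℂ} (hs : -(1 / 2 : ℝ) < s.re)
include hs

lemma pf_zero : pf s 0 = 1 := by simp [pf, oneF1_zero (Bs_ne hs)]

lemma pg_zero : pg s 0 = 1 := by simp [pg, oneF1_zero (Bs_ne hs)]

lemma differentiable_pf : Differentiable ℂ (pf s) := by
  have := differentiable_oneF1 (Bs_ne hs) s
  unfold pf
  fun_prop

lemma differentiable_pg : Differentiable ℂ (pg s) := by
  have := differentiable_oneF1 (Bs_ne hs) (s + 1)
  unfold pg
  fun_prop

lemma continuous_pf : Continuous (pf s) := (differentiable_pf hs).continuous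

lemma continuous_pg : Continuous (pg s) := (differentiable_pg hs).continuous

lemma pg_eq (z : ℂ) : pg s z =
    Complex.exp (I * z) * oneF1 ((starRingEnd ℂ) s) (Bs s : ℝ) (-(2 * I * z)) := by
  have h := kummer (Bs_ne hs) (s + 1) (2 * I * z)
  have e : ((Bs s : ℝ) : ℂ) - (s + 1) = (starRingEnd ℂ) s := by rw [Bs_coe]; ring
  rw [e] at h
  rw [← h, pg, ← mul_assoc, ← Complex.exp_add]
  congr 2
  ring

lemma conj_pf (z : ℂ) : (starRingEnd ℂ) (pf s z) = pg s ((starRingEnd ℂ) z) := by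
  rw [pg_eq hs, pf, map_mul, conj_oneF1, ← Complex.exp_conj]
  have h2 : (starRingEnd ℂ) 2 = 2 := Complex.conj_ofNat 2
  simp [Complex.conj_ofReal, h2]

lemma conj_pg (z : ℂ) : (starRingEnd ℂ) (pg s z) = pf s ((starRingEnd ℂ) z) := by
  have := conj_pf hs ((starRingEnd ℂ) z)
  rw [Complex.conj_conj] at this
  rw [← this, Complex.conj_conj]

lemma mul_deriv_pf (z : ℂ) : z * deriv (pf s) z = -(s + I * z) * pf s z + s * pg s z := by
  have h1 : HasDerivAt (fun z : ℂ => oneF1 s (Bs s : ℝ) (2 * I * z))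
      (deriv (oneF1 s (Bs s : ℝ)) (2 * I * z) * (2 * I * 1)) z :=
    ((differentiable_oneF1 (Bs_ne hs) s) _).hasDerivAt.comp z ((hasDerivAt_id z).const_mul (2 * I))
  have h2 : HasDerivAt (fun z : ℂ => Complex.exp (-(I * z))) (Complex.exp (-(I * z)) * (-(I * 1))) z :=
    ((hasDerivAt_id z).const_mul I).neg.cexp
  have h3 : HasDerivAt (pf s) _ z := h2.mul h1
  have h4 := mul_deriv_oneF1 (Bs_ne hs) s (2 * I * z)
  rw [h3.deriv, pf, pg]
  linear_combination (Complex.exp (-(I * z))) * h4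

lemma mul_deriv_pg (z : ℂ) :
    z * deriv (pg s) z = -((starRingEnd ℂ) s - I * z) * pg s z + (starRingEnd ℂ) s * pf s z := by
  have h := mul_deriv_pf hs ((starRingEnd ℂ) z)
  have h1 : HasDerivAt (pg s) ((starRingEnd ℂ) (deriv (pf s) ((starRingEnd ℂ) z))) z := by
    have h2 := ((differentiable_pf hs) ((starRingEnd ℂ) z)).hasDerivAt.conj_conj
    rw [Complex.conj_conj] at h2
    refine h2.congr_of_eventuallyEq (Eventually.of_forall fun w => ?_)
    simp [conj_pf hs]
  have h3 := congrArg (starRingEnd ℂ) h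
  simp only [map_mul, map_add, map_neg, Complex.conj_conj, conj_pf hs, conj_pg hs, Complex.conj_I]
    at h3
  rw [h1.deriv, h3]
  ring

lemma hasDerivAt_pf_mul (z : ℂ) {r : ℝ} (hr : r ≠ 0) :
    HasDerivAt (fun r : ℝ => pf s (r * z))
      ((-(s + I * (r * z)) * pf s (r * z) + s * pg s (r * z)) / r) r := by
  have h1 : HasDerivAt (fun r : ℝ => (r : ℂ) * z) (1 * z) r := (hasDerivAt_id r).ofReal_comp.mul_const z
  have h2 := ((differentiable_pf hs) (r * z)).hasDerivAt.comp r h1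
  refine h2.congr_deriv ?_
  have hr' : (r : ℂ) ≠ 0 := by exact_mod_cast hr
  rw [← mul_deriv_pf hs]
  field_simp

lemma hasDerivAt_pg_mul (z : ℂ) {r : ℝ} (hr : r ≠ 0) :
    HasDerivAt (fun r : ℝ => pg s (r * z))
      ((-((starRingEnd ℂ) s - I * (r * z)) * pg s (r * z) + (starRingEnd ℂ) s * pf s (r * z)) / r)
      r := by
  have h1 : HasDerivAt (fun r : ℝ => (r : ℂ) * z) (1 * z) r := (hasDerivAt_id r).ofReal_comp.mul_const z
  have h2 := ((differentiable_pg hs) (r * z)).hasDerivAt.comp r h1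
  refine h2.congr_deriv ?_
  have hr' : (r : ℂ) ≠ 0 := by exact_mod_cast hr
  rw [← mul_deriv_pg hs]
  field_simp

end

/-- The kernel `½ ∫ (pf(rz) pg(rw) + pg(rz) pf(rw)) dμ(r)`. -/
def hker (s z w : ℂ) : ℂ := (1 / 2) * ∫ r : unitInterval,
  (pf s ((r : ℝ) * z) * pg s ((r : ℝ) * w) + pg s ((r : ℝ) * z) * pf s ((r : ℝ) * w)) ∂(muI (Bs s))

lemma hker_symm (s z w : ℂ) : hker s z w = hker s w z := by
  unfold hker
  congr 2
  ext r
  ring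

section
variable {s : ℂ} (hs : -(1 / 2 : ℝ) < s.re)
include hs

lemma conj_hker (z w : ℂ) :
    (starRingEnd ℂ) (hker s z w) = hker s ((starRingEnd ℂ) z) ((starRingEnd ℂ) w) := by
  unfold hker
  rw [map_mul, ← integral_conj]
  congr 1
  · have h2 : (starRingEnd ℂ) 2 = 2 := Complex.conj_ofNat 2
    simp [h2]
  · congr 1
    ext r
    simp only [map_add, map_mul, conj_pf hs, conj_pg hs, Complex.conj_ofReal]
    ring

lemma continuous_hker : Continuous fun p : ℂ × ℂ => hker s p.1 p.2 := by
  have := isProbabilityMeasure_muI (Bs_pos hs)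
  have h1 := continuous_pf hs
  have h2 := continuous_pg hs
  refine continuous_const.mul (continuous_parametric_integral_of_continuous (μ := muI (Bs s)) (s := univ)
    (f := fun (p : ℂ × ℂ) (r : unitInterval) => (pf s ((r : ℝ) * p.1) * pg s ((r : ℝ) * p.2) +
      pg s ((r : ℝ) * p.1) * pf s ((r : ℝ) * p.2))) ?_ isCompact_univ |>.congr fun p => ?_)
  · fun_prop
  · simp

/-- The Christoffel–Darboux form of the kernel. -/
lemma sub_mul_hker (z w : ℂ) : (z - w) * hker s z w =
    (Bs s : ℝ) * (I / 2) * (pf s z * pg s w - pg s z * pf s w) := by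
  have hB := Bs_pos hs
  have hc1 := continuous_pf hs
  have hc2 := continuous_pg hs
  set φ : ℝ → ℂ := fun r => pf s (r * z) * pg s (r * w) - pg s (r * z) * pf s (r * w) with hφ
  set σ : ℝ → ℂ := fun r => pf s (r * z) * pg s (r * w) + pg s (r * z) * pf s (r * w) with hσ
  have hφ0 : φ 0 = 0 := by simp [hφ, pf_zero hs, pg_zero hs]
  have hφd : Differentiable ℝ φ := by
    have e1 : Differentiable ℝ (pf s) := (differentiable_pf hs).restrictScalars ℝ
    have e2 : Differentiable ℝ (pg s) := (differentiable_pg hs).restrictScalars ℝ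
    have e3 : Differentiable ℝ (fun r : ℝ => (r : ℂ)) := Complex.ofRealCLM.differentiable
    simp only [hφ]
    fun_prop
  have hσc : Continuous σ := by simp only [hσ]; fun_prop
  have hχc : Continuous (dslope φ 0) := by
    rw [continuous_iff_continuousAt]
    intro x
    rcases eq_or_ne x 0 with rfl | hx
    · exact continuousAt_dslope_same.2 (hφd 0)
    · exact (continuousAt_dslope_of_ne hx).2 (hφd x).continuousAt
  have hχ : ∀ r : ℝ, (r : ℂ) * dslope φ 0 r = φ r := fun r => by
    have := sub_smul_dslope φ 0 r
    rwa [sub_zero, hφ0, sub_zero, Complex.real_smul] at this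
  have hφ' : ∀ r : ℝ, r ≠ 0 → HasDerivAt φ ((-(2 * s.re : ℝ) * φ r - I * r * (z - w) * σ r) / r) r := by
    intro r hr
    have := ((hasDerivAt_pf_mul hs z hr).mul (hasDerivAt_pg_mul hs w hr)).sub
      ((hasDerivAt_pg_mul hs z hr).mul (hasDerivAt_pf_mul hs w hr))
    refine this.congr_deriv ?_
    have h2 : ((2 * s.re : ℝ) : ℂ) = s + (starRingEnd ℂ) s := by rw [Complex.add_conj]
    have hr' : (r : ℂ) ≠ 0 := by exact_mod_cast hr
    rw [h2]
    simp only [hφ, hσ]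
    field_simp
    ring
  have hcont : Continuous fun y : ℝ => (y : ℂ) * dslope φ 0 (y ^ (1 / Bs s)) :=
    Complex.continuous_ofReal.mul (hχc.comp (Real.continuous_rpow_const (by positivity)))
  have hder : ∀ y ∈ Ioo (0 : ℝ) 1, HasDerivAt (fun y : ℝ => (y : ℂ) * dslope φ 0 (y ^ (1 / Bs s)))
      (-I * (z - w) / (Bs s : ℝ) * σ (y ^ (1 / Bs s))) y := by
    intro y hy
    have hy0 := hy.1
    have hr := Real.rpow_pos_of_pos hy0 (1 / Bs s)
    have e0 := Real.hasDerivAt_rpow_const (x := y) (p := 1 / Bs s) (Or.inl hy0.ne')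
    have e1 := (hφ' _ hr.ne').scomp y e0
    have e2 := (Real.hasDerivAt_rpow_const (x := y) (p := 2 * s.re / Bs s) (Or.inl hy0.ne')).ofReal_comp
    have e3 := e2.mul e1
    have hpow : y ^ (2 * s.re / Bs s) * y ^ (1 / Bs s) = y := by
      rw [← Real.rpow_add hy0]
      have : 2 * s.re / Bs s + 1 / Bs s = 1 := by
        rw [← add_div]; exact div_self hB.ne'
      rw [this, Real.rpow_one]
    refine (e3.congr_of_eventuallyEq ?_).congr_deriv ?_
    · filter_upwards [lt_mem_nhds hy0] with x hx
      have hr := Real.rpow_pos_of_pos hx (1 / Bs s)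
      have hpow : x ^ (2 * s.re / Bs s) * x ^ (1 / Bs s) = x := by
        rw [← Real.rpow_add hx]
        have : 2 * s.re / Bs s + 1 / Bs s = 1 := by
          rw [← add_div]; exact div_self hB.ne'
        rw [this, Real.rpow_one]
      simp only [Pi.mul_apply, Function.comp]
      rw [← hχ, ← mul_assoc, ← Complex.ofReal_mul, hpow]
    · rw [Real.rpow_sub_one hy0.ne', Real.rpow_sub_one hy0.ne', Complex.real_smul]
      set r := y ^ (1 / Bs s)
      set q := y ^ (2 * s.re / Bs s)
      have hr' : (r : ℂ) ≠ 0 := by exact_mod_cast hr.ne'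
      have hB' : ((Bs s : ℝ) : ℂ) ≠ 0 := by exact_mod_cast hB.ne'
      have hq' : (q : ℂ) * r = y := by exact_mod_cast hpow
      have hy' : (y : ℂ) ≠ 0 := by exact_mod_cast hy0.ne'
      have hq0 : (q : ℂ) ≠ 0 := fun h => hy' (by rw [← hq', h, zero_mul])
      simp only [Function.comp]
      push_cast
      rw [← hq']
      field_simp
      ring
  have hii : IntervalIntegrable (fun y : ℝ => -I * (z - w) / (Bs s : ℝ) * σ (y ^ (1 / Bs s)))
      volume 0 1 :=
    (continuous_const.mul (hσc.comp (Real.continuous_rpow_const (by positivity)))).intervalIntegrable _ _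
  have hftc := intervalIntegral.integral_eq_sub_of_hasDerivAt_of_le zero_le_one hcont.continuousOn
    hder hii
  rw [intervalIntegral.integral_const_mul, ← integral_muI_coe hB hσc] at hftc
  have h1 : ((1 : ℝ) : ℂ) * dslope φ 0 1 = φ 1 := hχ 1
  simp only [Real.one_rpow, Complex.ofReal_zero, zero_mul, sub_zero, h1] at hftc
  have hφ1 : φ 1 = pf s z * pg s w - pg s z * pf s w := by simp [hφ]
  have hB' : ((Bs s : ℝ) : ℂ) ≠ 0 := by exact_mod_cast hB.ne'
  have hh : hker s z w = (1 / 2) * ∫ r : unitInterval, σ r ∂(muI (Bs s)) := rfl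
  rw [← hφ1, ← hftc, hh]
  field_simp
  linear_combination ((z - w) * ∫ r : unitInterval, σ r ∂(muI (Bs s))) * Complex.I_sq
end

/-! ### Hadamard's inequality and summability -/

open scoped ComplexOrder in
lemma norm_det_le {n : ℕ} (A : Matrix (Fin n) (Fin n) ℂ) {M : ℝ} (hM : 0 ≤ M)
    (hA : ∀ i j, ‖A i j‖ ≤ M) : ‖A.det‖ ≤ (Real.sqrt n * M) ^ n := by
  rcases Nat.eq_zero_or_pos n with rfl | hn
  · simp
  have hn' : (0 : ℝ) < n := by exact_mod_cast hn
  have hps : (A * A.conjTranspose).PosSemidef := Matrix.posSemidef_self_mul_conjTranspose A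
  set hH := hps.isHermitian
  have hdet : (A * A.conjTranspose).det = ((‖A.det‖ ^ 2 : ℝ) : ℂ) := by
    rw [Matrix.det_mul, Matrix.det_conjTranspose]
    simpa using Complex.mul_conj' A.det
  have htr : (A * A.conjTranspose).trace = ((∑ i, ∑ j, ‖A i j‖ ^ 2 : ℝ) : ℂ) := by
    simp only [Matrix.trace, Matrix.diag_apply, Matrix.mul_apply, Matrix.conjTranspose_apply]
    push_cast
    refine Finset.sum_congr rfl fun i _ => Finset.sum_congr rfl fun j _ => ?_
    simpa using Complex.mul_conj' (A i j)
  have h1 : ‖A.det‖ ^ 2 = ∏ i, hH.eigenvalues i := by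
    apply Complex.ofReal_injective
    rw [← hdet, hH.det_eq_prod_eigenvalues]
    simp
  have h2 : ∑ i, ∑ j, ‖A i j‖ ^ 2 = ∑ i, hH.eigenvalues i := by
    apply Complex.ofReal_injective
    rw [← htr, hH.trace_eq_sum_eigenvalues]
    simp
  have h3 : ∑ i, ∑ j, ‖A i j‖ ^ 2 ≤ n * (n * M ^ 2) := by
    calc _ ≤ ∑ _i : Fin n, ∑ _j : Fin n, M ^ 2 := by
          gcongr with i _ j _
          exact hA i j
      _ = _ := by simp
  have hev : ∀ i ∈ Finset.univ, 0 ≤ hH.eigenvalues i := fun i _ => hps.eigenvalues_nonneg i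
  have h4 := Real.geom_mean_le_arith_mean_weighted Finset.univ (fun _ : Fin n => (1 / n : ℝ))
    hH.eigenvalues (fun _ _ => by positivity) (by simp [hn'.ne']) hev
  rw [← Finset.mul_sum, ← h2, Real.finsetProd_rpow _ _ hev, ← h1] at h4
  have h5 : (‖A.det‖ ^ 2) ^ (1 / n : ℝ) ≤ n * M ^ 2 := by
    refine h4.trans ?_
    calc _ ≤ 1 / (n : ℝ) * (n * (n * M ^ 2)) := by gcongr
      _ = _ := by field_simp
  have h6 : ‖A.det‖ ^ 2 ≤ (n * M ^ 2) ^ n := by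
    calc ‖A.det‖ ^ 2 = ((‖A.det‖ ^ 2) ^ (1 / n : ℝ)) ^ n := by
          rw [← Real.rpow_natCast (_ ^ _) n, ← Real.rpow_mul (by positivity),
            one_div_mul_cancel hn'.ne', Real.rpow_one]
      _ ≤ _ := by gcongr
  refine (pow_le_pow_iff_left₀ (by positivity) (by positivity) two_ne_zero).1 ?_
  rw [← pow_mul, mul_comm n 2, pow_mul, mul_pow, Real.sq_sqrt hn'.le]
  exact h6

/-- Summable majorant for the terms of a Fredholm series. -/
def gB (M : ℝ) (n : ℕ) : ℝ := (M * Real.sqrt (Real.exp 1)) ^ n / Real.sqrt n.factorial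

lemma gB_nonneg {M : ℝ} (hM : 0 ≤ M) (n : ℕ) : 0 ≤ gB M n := by unfold gB; positivity

lemma summable_gB {M : ℝ} (hM : 0 ≤ M) : Summable (gB M) := by
  set x := M * Real.sqrt (Real.exp 1) with hx
  have hx0 : 0 ≤ x := by positivity
  have hlim : Tendsto (fun n : ℕ => x / Real.sqrt ((n : ℝ) + 1)) atTop (nhds 0) :=
    Tendsto.div_atTop tendsto_const_nhds (Real.tendsto_sqrt_atTop.comp
      (tendsto_atTop_add_const_right _ _ tendsto_natCast_atTop_atTop))
  refine summable_of_ratio_norm_eventually_le (r := 1 / 2) (by norm_num) ?_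
  filter_upwards [hlim.eventually (ge_mem_nhds (show (0 : ℝ) < 1 / 2 by norm_num))] with n hn
  rw [Real.norm_of_nonneg (gB_nonneg hM _), Real.norm_of_nonneg (gB_nonneg hM _)]
  have : gB M (n + 1) = x / Real.sqrt ((n : ℝ) + 1) * gB M n := by
    simp only [gB, ← hx]
    rw [Nat.factorial_succ, pow_succ]
    push_cast
    rw [Real.sqrt_mul (by positivity)]
    field_simp
  rw [this]
  exact mul_le_mul_of_nonneg_right hn (gB_nonneg hM _)

lemma hadamard_le_gB {M : ℝ} (hM : 0 ≤ M) (n : ℕ) :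
    (Real.sqrt n * M) ^ n / n.factorial ≤ gB M n := by
  have h1 := Real.pow_div_factorial_le_exp (n : ℝ) (by positivity) n
  have hf : (0 : ℝ) < n.factorial := by exact_mod_cast n.factorial_pos
  have h2 : Real.sqrt n ^ n ≤ Real.sqrt (Real.exp 1) ^ n * Real.sqrt n.factorial := by
    refine (pow_le_pow_iff_left₀ (by positivity) (by positivity) two_ne_zero).1 ?_
    rw [← pow_mul, mul_comm n 2, pow_mul, Real.sq_sqrt (by positivity), mul_pow, ← pow_mul,
      mul_comm n 2, pow_mul, Real.sq_sqrt (by positivity), Real.sq_sqrt hf.le, ← Real.exp_nat_mul,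
      mul_one]
    rwa [div_le_iff₀ hf] at h1
  have h3 : Real.sqrt n.factorial * Real.sqrt n.factorial = n.factorial := Real.mul_self_sqrt hf.le
  have h4 : 0 < Real.sqrt n.factorial := Real.sqrt_pos.2 hf
  rw [gB, div_le_div_iff₀ hf h4, mul_pow, mul_pow]
  conv_rhs => rw [← h3]
  calc _ ≤ Real.sqrt (Real.exp 1) ^ n * Real.sqrt n.factorial * M ^ n * Real.sqrt n.factorial := by
        gcongr
    _ = _ := by ring

lemma nat_mul_gB_le {M : ℝ} (hM : 0 ≤ M) (n : ℕ) : n * gB M n ≤ gB (2 * M) n := by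
  have h : (n : ℝ) ≤ 2 ^ n := by exact_mod_cast (Nat.lt_two_pow_self (n := n)).le
  have h0 := gB_nonneg hM n
  calc n * gB M n ≤ 2 ^ n * gB M n := by gcongr
    _ = _ := by simp only [gB]; rw [mul_assoc 2 M, mul_pow 2]; ring

/-! ### Holomorphic curves of continuous functions -/

lemma differentiableOn_continuousMap {Y : Type*} [TopologicalSpace Y] [CompactSpace Y] {U : Set ℂ}
    (hU : IsOpen U) {F : ℂ → C(Y, ℂ)} (hF : ContinuousOn F U)
    (hd : ∀ y, DifferentiableOn ℂ (fun z => F z y) U) : DifferentiableOn ℂ F U := by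
  intro z hz
  obtain ⟨R, hR, hRU⟩ := Metric.nhds_basis_closedBall.mem_iff.1 (hU.mem_nhds hz)
  lift R to NNReal using hR.le
  have hcs : ContinuousOn F (Metric.sphere z R) :=
    hF.mono (Metric.sphere_subset_closedBall.trans hRU)
  have hci : CircleIntegrable F z R := hcs.circleIntegrable R.2
  have hps := hasFPowerSeriesOn_cauchy_integral hci hR
  have hda := hps.differentiableOn.differentiableAt
    (Metric.isOpen_eball.mem_nhds (Metric.mem_eball_self (by exact_mod_cast hR)))
  refine (hda.congr_of_eventuallyEq ?_).differentiableWithinAt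
  filter_upwards [Metric.ball_mem_nhds z hR] with w hw
  ext y
  have hdc : DiffContOnCl ℂ (fun z => F z y) (Metric.ball z R) :=
    ((hd y).mono hRU).diffContOnCl_ball subset_rfl
  have h1 := hdc.circleIntegral_sub_inv_smul hw
  have hne : ∀ ζ ∈ Metric.sphere z (R : ℝ), ζ - w ≠ 0 := fun ζ hζ h => by
    rw [sub_eq_zero.1 h] at hζ
    exact (Metric.mem_ball.1 hw).ne (Metric.mem_sphere.1 hζ)
  have hci2 : CircleIntegrable (fun ζ => (ζ - w)⁻¹ • F ζ) z R := by
    refine ContinuousOn.circleIntegrable R.2 ?_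
    exact ((continuousOn_id.sub continuousOn_const).inv₀ hne).smul hcs
  have h2 : (∮ ζ in C(z, R), (ζ - w)⁻¹ • F ζ) y = ∮ ζ in C(z, R), (ζ - w)⁻¹ • F ζ y := by
    simp only [circleIntegral]
    have := (ContinuousMap.evalCLM ℂ y : C(Y, ℂ) →L[ℂ] ℂ).intervalIntegral_comp_comm hci2.out
    simpa using this.symm
  have h3 : (2 * Real.pi * I : ℂ) ≠ 0 := Complex.two_pi_I_ne_zero
  rw [ContinuousMap.smul_apply, h2, h1]
  simp only [smul_eq_mul]
  field_simp

lemma deriv_continuousMap_apply {Y : Type*} [TopologicalSpace Y] [CompactSpace Y]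
    {F : ℂ → C(Y, ℂ)} {z : ℂ} (hF : DifferentiableAt ℂ F z) (y : Y) :
    deriv F z y = deriv (fun w => F w y) z :=
  (((ContinuousMap.evalCLM ℂ y : C(Y, ℂ) →L[ℂ] ℂ).hasFDerivAt.comp_hasDerivAt z
    hF.hasDerivAt).deriv).symm

section

set_option linter.unusedSectionVars false

/-! ### Fredholm determinants and minors of continuous kernels -/

lemma integrable_of_continuous_compact {Y E : Type*} [TopologicalSpace Y] [CompactSpace Y]
    [SecondCountableTopology Y] [MeasurableSpace Y] [OpensMeasurableSpace Y]
    [NormedAddCommGroup E] {ν : Measure Y}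
    [IsFiniteMeasure ν] {f : Y → E} (hf : Continuous f) : Integrable f ν := by
  obtain ⟨C, hC⟩ := (isCompact_range hf).isBounded.exists_norm_le
  exact Integrable.of_bound hf.aestronglyMeasurable C
    (Eventually.of_forall fun y => hC _ (mem_range_self y))

variable {X : Type*} [TopologicalSpace X] [CompactSpace X] [T2Space X] [SecondCountableTopology X]
  [MeasurableSpace X] [BorelSpace X]

/-- The `n`-th term of the Fredholm determinant. -/
def frd (μ : Measure X) (κ : C(X × X, ℂ)) (n : ℕ) : ℂ :=
  ∫ x : Fin n → X, (Matrix.of fun i j => κ (x i, x j)).det ∂(Measure.pi fun _ => μ)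

/-- The `n`-th term of the first Fredholm minor. -/
def frDn (μ : Measure X) (κ : C(X × X, ℂ)) (n : ℕ) (u v : X) : ℂ :=
  ∫ x : Fin n → X, (Matrix.of fun i j : Fin (n + 1) =>
    κ ((Fin.cons u x : Fin (n + 1) → X) i, (Fin.cons v x : Fin (n + 1) → X) j)).det
      ∂(Measure.pi fun _ => μ)

/-- The Fredholm determinant `det(1 - κ)`. -/
def frF (μ : Measure X) (κ : C(X × X, ℂ)) : ℂ := ∑' n : ℕ, (-1) ^ n / (n.factorial : ℂ) * frd μ κ n

/-- The first Fredholm minor. -/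
def frD (μ : Measure X) (κ : C(X × X, ℂ)) (u v : X) : ℂ :=
  ∑' n : ℕ, (-1) ^ n / (n.factorial : ℂ) * frDn μ κ n u v

variable (μ : Measure X) [IsProbabilityMeasure μ] (κ : C(X × X, ℂ))

lemma continuous_cons_apply {n : ℕ} (i : Fin (n + 1)) :
    Continuous fun p : X × (Fin n → X) => (Fin.cons p.1 p.2 : Fin (n + 1) → X) i := by
  refine Fin.cases ?_ (fun i => ?_) i
  · simpa using continuous_fst
  · simp only [Fin.cons_succ]
    fun_prop

lemma integral_insertNth {m : ℕ} (k : Fin (m + 1)) {f : (Fin (m + 1) → X) → ℂ} (hf : Continuous f) :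
    ∫ x, f x ∂(Measure.pi fun _ => μ) =
      ∫ w, ∫ y, f (k.insertNth w y) ∂(Measure.pi fun _ : Fin m => μ) ∂μ := by
  have hmp := (measurePreserving_piFinSuccAbove (fun _ : Fin (m + 1) => μ) k).symm
  rw [← hmp.integral_comp' f]
  have hc : Continuous fun p : X × (Fin m → X) => f (k.insertNth p.1 p.2) := by
    refine hf.comp ?_
    exact Continuous.finInsertNth k continuous_fst continuous_snd
  exact integral_prod _ (integrable_of_continuous_compact hc)

lemma det_insertNth {m : ℕ} (k : Fin (m + 1)) (v w : X) (y : Fin m → X) :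
    (Matrix.of fun i j : Fin (m + 1) => κ ((k.insertNth w y : Fin (m + 1) → X) i,
      (Fin.cons v (k.insertNth w y : Fin (m + 1) → X) : Fin (m + 2) → X)
        ((Fin.succ k).succAbove j))).det =
    (-1) ^ (k : ℕ) * (Matrix.of fun i j : Fin (m + 1) =>
      κ ((Fin.cons w y : Fin (m + 1) → X) i, (Fin.cons v y : Fin (m + 1) → X) j)).det := by
  have hcol : ∀ j : Fin (m + 1), (Fin.cons v (k.insertNth w y : Fin (m + 1) → X) : Fin (m + 2) → X)
        ((Fin.succ k).succAbove j) = (Fin.cons v y : Fin (m + 1) → X) j := by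
    intro j
    refine Fin.cases ?_ (fun j => ?_) j
    · simp
    · cases m with
      | zero => exact j.elim0
      | succ m => rw [Fin.succ_succAbove_succ, Fin.cons_succ, Fin.cons_succ, Fin.insertNth_apply_succAbove]
  have h1 := Matrix.det_permute k.cycleRange (Matrix.of fun i j : Fin (m + 1) =>
      κ ((Fin.cons w y : Fin (m + 1) → X) i, (Fin.cons v y : Fin (m + 1) → X) j))
  rw [Fin.sign_cycleRange] at h1
  push_cast at h1
  rw [← h1]
  congr 1
  ext i j
  simp only [Matrix.of_apply, Matrix.submatrix_apply, hcol, id]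
  rw [← Fin.cons_comp_cycleRange]
  rfl

lemma integral_det_row (g : C(X, ℂ)) (v : X) (m : ℕ) :
    ∫ x : Fin (m + 1) → X, (Matrix.of (Fin.cons
      (fun j : Fin (m + 2) => g ((Fin.cons v x : Fin (m + 2) → X) j))
      (fun (i : Fin (m + 1)) (j : Fin (m + 2)) => κ (x i, (Fin.cons v x : Fin (m + 2) → X) j)) :
        Fin (m + 2) → Fin (m + 2) → ℂ)).det ∂(Measure.pi fun _ => μ) =
    g v * frd μ κ (m + 1) - (m + 1) * ∫ w, g w * frDn μ κ m w v ∂μ := by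
  have hexp : ∀ x : Fin (m + 1) → X, (Matrix.of (Fin.cons
      (fun j : Fin (m + 2) => g ((Fin.cons v x : Fin (m + 2) → X) j))
      (fun (i : Fin (m + 1)) (j : Fin (m + 2)) => κ (x i, (Fin.cons v x : Fin (m + 2) → X) j)) :
        Fin (m + 2) → Fin (m + 2) → ℂ)).det =
      g v * (Matrix.of fun i j => κ (x i, x j)).det + ∑ k : Fin (m + 1), (-1) ^ ((k : ℕ) + 1) * g (x k) *
        (Matrix.of fun i j : Fin (m + 1) => κ (x i, (Fin.cons v x : Fin (m + 2) → X)
        ((Fin.succ k).succAbove j))).det := by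
    intro x
    rw [Matrix.det_succ_row_zero, Fin.sum_univ_succ]
    congr 1
    · simp only [Fin.val_zero, pow_zero, one_mul, Matrix.of_apply, Fin.cons_zero]
      rfl
  have hc0 : Continuous fun x : Fin (m + 1) → X => (Matrix.of fun i j => κ (x i, x j)).det := by
    refine Continuous.matrix_det (continuous_matrix fun i j => ?_)
    simp only [Matrix.of_apply]
    fun_prop
  have hck : ∀ k : Fin (m + 1), Continuous fun x : Fin (m + 1) → X => (-1) ^ ((k : ℕ) + 1) * g (x k) *
        (Matrix.of fun i j : Fin (m + 1) => κ (x i, (Fin.cons v x : Fin (m + 2) → X)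
        ((Fin.succ k).succAbove j))).det := by
    intro k
    refine (continuous_const.mul (by fun_prop)).mul
      (Continuous.matrix_det (continuous_matrix fun i j => ?_))
    simp only [Matrix.of_apply]
    exact κ.continuous.comp ((continuous_apply i).prodMk
      ((continuous_cons_apply _).comp (continuous_const.prodMk continuous_id)))
  simp only [hexp]
  have hc0' : Continuous fun x : Fin (m + 1) → X =>
      g v * (Matrix.of fun i j => κ (x i, x j)).det := continuous_const.mul hc0
  rw [integral_add (integrable_of_continuous_compact hc0')
    (integrable_of_continuous_compact (continuous_finsetSum _ fun k _ => hck k)),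
    integral_finsetSum _ fun k _ => integrable_of_continuous_compact (hck k), integral_const_mul]
  have hk : ∀ k : Fin (m + 1), ∫ x : Fin (m + 1) → X, (-1) ^ ((k : ℕ) + 1) * g (x k) *
        (Matrix.of fun i j : Fin (m + 1) => κ (x i, (Fin.cons v x : Fin (m + 2) → X)
        ((Fin.succ k).succAbove j))).det ∂(Measure.pi fun _ => μ) =
        -∫ w, g w * frDn μ κ m w v ∂μ := by
    intro k
    rw [integral_insertNth μ k (hck k), ← integral_neg]
    congr 1
    ext w
    rw [frDn, ← integral_const_mul, ← integral_neg]
    congr 1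
    ext y
    rw [det_insertNth]
    have : (-1 : ℂ) ^ (k : ℕ) * (-1) ^ (k : ℕ) = 1 := by rw [← mul_pow]; simp
    simp only [Fin.insertNth_apply_same]
    linear_combination (-(g w * (Matrix.of fun i j : Fin (m + 1) =>
      κ ((Fin.cons w y : Fin (m + 1) → X) i, (Fin.cons v y : Fin (m + 1) → X) j)).det)) * this
  simp only [hk]
  rw [frd]
  simp
  ring

lemma continuous_det_kernel {n : ℕ} {Y : Type*} [TopologicalSpace Y] {p q : Fin n → Y → X}
    (hp : ∀ i, Continuous (p i)) (hq : ∀ i, Continuous (q i)) :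
    Continuous fun y => (Matrix.of fun i j => κ (p i y, q j y)).det := by
  refine Continuous.matrix_det (continuous_matrix fun i j => ?_)
  simp only [Matrix.of_apply]
  exact κ.continuous.comp ((hp i).prodMk (hq j))

lemma norm_integral_det_le {n : ℕ} {Y : Type*} [MeasurableSpace Y] {ν : Measure Y}
    [IsProbabilityMeasure ν] {M : ℝ} (hM : ‖κ‖ ≤ M) (p q : Fin n → Y → X) :
    ‖∫ y, (Matrix.of fun i j => κ (p i y, q j y)).det ∂ν‖ ≤ (Real.sqrt n * M) ^ n := by
  have hM0 := (norm_nonneg κ).trans hM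
  have := norm_integral_le_of_norm_le_const (μ := ν) (f := fun y =>
    (Matrix.of fun i j => κ (p i y, q j y)).det) (C := (Real.sqrt n * M) ^ n)
    (Eventually.of_forall fun y => norm_det_le _ hM0 fun i j => (κ.norm_coe_le_norm _).trans hM)
  simpa using this

lemma norm_frd_term_le {M : ℝ} (hM : ‖κ‖ ≤ M) (n : ℕ) :
    ‖(-1) ^ n / (n.factorial : ℂ) * frd μ κ n‖ ≤ gB M n := by
  have hM0 := (norm_nonneg κ).trans hM
  refine le_trans ?_ (hadamard_le_gB hM0 n)
  have := norm_integral_det_le κ hM (ν := Measure.pi fun _ : Fin n => μ)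
    (fun i x => x i) (fun i x => x i)
  simp only [norm_mul, norm_div, norm_pow, norm_neg, norm_one, one_pow, Complex.norm_natCast]
  rw [one_div_mul_eq_div]
  gcongr
  exact this

lemma norm_frDn_term_le {M : ℝ} (hM : ‖κ‖ ≤ M) (n : ℕ) (u v : X) :
    ‖(-1) ^ n / (n.factorial : ℂ) * frDn μ κ n u v‖ ≤ gB (2 * M) (n + 1) := by
  have hM0 := (norm_nonneg κ).trans hM
  refine le_trans ?_ (nat_mul_gB_le hM0 (n + 1))
  refine le_trans ?_ (mul_le_mul_of_nonneg_left (hadamard_le_gB hM0 (n + 1)) (by positivity))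
  have := norm_integral_det_le κ hM (ν := Measure.pi fun _ : Fin n => μ)
    (fun i x => (Fin.cons u x : Fin (n + 1) → X) i) (fun i x => (Fin.cons v x : Fin (n + 1) → X) i)
  simp only [norm_mul, norm_div, norm_pow, norm_neg, norm_one, one_pow, Complex.norm_natCast]
  rw [one_div_mul_eq_div, Nat.factorial_succ]
  push_cast at this ⊢
  have hf : (0 : ℝ) < n.factorial := by exact_mod_cast n.factorial_pos
  calc _ ≤ (Real.sqrt (n + 1) * M) ^ (n + 1) / n.factorial := by gcongr; exact this
    _ = _ := by field_simp

lemma summable_frF_terms : Summable fun n : ℕ => (-1) ^ n / (n.factorial : ℂ) * frd μ κ n :=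
  Summable.of_norm_bounded (summable_gB (norm_nonneg κ)) (norm_frd_term_le μ κ le_rfl)

lemma summable_gB_succ {M : ℝ} (hM : 0 ≤ M) : Summable fun n => gB M (n + 1) :=
  (summable_nat_add_iff 1).2 (summable_gB hM)

lemma summable_frD_terms (u v : X) :
    Summable fun n : ℕ => (-1) ^ n / (n.factorial : ℂ) * frDn μ κ n u v :=
  Summable.of_norm_bounded (summable_gB_succ (M := 2 * ‖κ‖) (by positivity))
    (fun n => norm_frDn_term_le μ κ le_rfl n u v)

lemma frd_zero : frd μ κ 0 = 1 := by simp [frd]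

lemma frDn_zero (u v : X) : frDn μ κ 0 u v = κ (u, v) := by simp [frDn]

lemma frDn_succ (m : ℕ) (u v : X) : frDn μ κ (m + 1) u v =
    κ (u, v) * frd μ κ (m + 1) - (m + 1) * ∫ w, κ (u, w) * frDn μ κ m w v ∂μ := by
  have := integral_det_row μ κ (κ.comp ⟨fun w => (u, w), by fun_prop⟩) v m
  simp only [ContinuousMap.comp_apply, ContinuousMap.coe_mk] at this
  rw [← this, frDn]
  congr 1
  ext x
  congr 1
  ext i j
  refine Fin.cases ?_ (fun i => ?_) i <;> simp

lemma continuous_frDn (n : ℕ) : Continuous fun p : X × X => frDn μ κ n p.1 p.2 := by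
  have := continuous_parametric_integral_of_continuous (μ := Measure.pi fun _ : Fin n => μ)
    (s := univ) (f := fun (p : X × X) (x : Fin n → X) => (Matrix.of fun i j : Fin (n + 1) =>
    κ ((Fin.cons p.1 x : Fin (n + 1) → X) i, (Fin.cons p.2 x : Fin (n + 1) → X) j)).det)
    (continuous_det_kernel κ
      (p := fun i (q : (X × X) × (Fin n → X)) => (Fin.cons q.1.1 q.2 : Fin (n + 1) → X) i)
      (q := fun i (q : (X × X) × (Fin n → X)) => (Fin.cons q.1.2 q.2 : Fin (n + 1) → X) i)
      (fun i => (continuous_cons_apply i).comp (by fun_prop :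
        Continuous fun q : (X × X) × (Fin n → X) => (q.1.1, q.2)))
      (fun i => (continuous_cons_apply i).comp (by fun_prop :
        Continuous fun q : (X × X) × (Fin n → X) => (q.1.2, q.2)))) isCompact_univ
  simpa [frDn] using this

lemma continuous_frD : Continuous fun p : X × X => frD μ κ p.1 p.2 :=
  continuous_tsum (fun n => continuous_const.mul (continuous_frDn μ κ n))
    (summable_gB_succ (M := 2 * ‖κ‖) (by positivity))
    (fun n p => norm_frDn_term_le μ κ le_rfl n p.1 p.2)

lemma frDn_symm (hκ : ∀ u v, κ (u, v) = κ (v, u)) (n : ℕ) (u v : X) :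
    frDn μ κ n u v = frDn μ κ n v u := by
  unfold frDn
  congr 1
  ext x
  rw [← Matrix.det_transpose]
  congr 1
  ext i j
  exact hκ _ _

lemma frD_symm (hκ : ∀ u v, κ (u, v) = κ (v, u)) (u v : X) : frD μ κ u v = frD μ κ v u := by
  simp only [frD, frDn_symm μ κ hκ _ u v]

/-- The integral against a first minor, computed termwise. -/
lemma hasSum_integral_mul_frDn (g : C(X, ℂ)) (v : X) :
    HasSum (fun n : ℕ => (-1) ^ n / (n.factorial : ℂ) * ∫ w, g w * frDn μ κ n w v ∂μ)
      (∫ w, g w * frD μ κ w v ∂μ) := by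
  have hc : ∀ n : ℕ, Continuous fun w => g w * ((-1) ^ n / (n.factorial : ℂ) * frDn μ κ n w v) :=
    fun n => g.continuous.mul (continuous_const.mul
      ((continuous_frDn μ κ n).comp (by fun_prop : Continuous fun w : X => (w, v))))
  have hb : ∀ n w, ‖g w * ((-1) ^ n / (n.factorial : ℂ) * frDn μ κ n w v)‖ ≤
      ‖g‖ * gB (2 * ‖κ‖) (n + 1) := fun n w => by
    rw [norm_mul]
    exact mul_le_mul (g.norm_coe_le_norm w) (norm_frDn_term_le μ κ le_rfl n w v) (norm_nonneg _)
      (norm_nonneg _)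
  have := hasSum_integral_of_summable_integral_norm (μ := μ)
    (fun n => integrable_of_continuous_compact (hc n)) (Summable.of_nonneg_of_le
      (fun n => integral_nonneg fun _ => norm_nonneg _) (fun n => ?_)
      ((summable_gB_succ (M := 2 * ‖κ‖) (by positivity)).mul_left ‖g‖))
  · have e : ∀ n : ℕ, (-1) ^ n / (n.factorial : ℂ) * ∫ w, g w * frDn μ κ n w v ∂μ =
        ∫ w, g w * ((-1) ^ n / (n.factorial : ℂ) * frDn μ κ n w v) ∂μ := fun n => by
      rw [← integral_const_mul]
      congr 1
      ext w
      ring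
    simp only [e]
    have e2 : ∀ w, g w * frD μ κ w v =
        ∑' n : ℕ, g w * ((-1) ^ n / (n.factorial : ℂ) * frDn μ κ n w v) :=
      fun w => tsum_mul_left.symm
    simp only [e2]
    exact this
  · calc _ ≤ ∫ _w : X, ‖g‖ * gB (2 * ‖κ‖) (n + 1) ∂μ :=
          integral_mono (integrable_of_continuous_compact (hc n).norm) (integrable_const _) (hb n)
      _ = _ := by simp

/-- The integral equation for the first minor. -/
lemma frD_eq (u v : X) :
    frD μ κ u v = κ (u, v) * frF μ κ + ∫ w, κ (u, w) * frD μ κ w v ∂μ := by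
  have h1 := hasSum_integral_mul_frDn μ κ (κ.comp ⟨fun w => (u, w), by fun_prop⟩) v
  simp only [ContinuousMap.comp_apply, ContinuousMap.coe_mk] at h1
  have h2 := (summable_frF_terms μ κ).hasSum.mul_left (κ (u, v))
  have h3 := (summable_frD_terms μ κ u v).hasSum
  rw [← hasSum_nat_add_iff' 1] at h2 h3
  have h4 := h2.add h1
  have h5 := h3.unique (hasSum_of_eq h4 fun n => ?_)
  · simp only [Finset.range_one, Finset.sum_singleton, pow_zero, Nat.factorial_zero, Nat.cast_one,
      div_one, one_mul, frDn_zero, frd_zero, mul_one] at h5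
    change frD μ κ u v - _ = κ (u, v) * frF μ κ - _ + _ at h5
    linear_combination h5
  · rw [frDn_succ, Nat.factorial_succ]
    have hf : (n.factorial : ℂ) ≠ 0 := by exact_mod_cast n.factorial_ne_zero
    have h4 : (n : ℂ) + 1 ≠ 0 := by exact_mod_cast n.succ_ne_zero
    push_cast
    field_simp
    ring

lemma norm_frF_sub_one_le {M : ℝ} (hM : ‖κ‖ ≤ M) (hM1 : M ≤ 1) :
    ‖frF μ κ - 1‖ ≤ M * ∑' n, gB 1 (n + 1) := by
  have hM0 := (norm_nonneg κ).trans hM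
  have h2 := (summable_frF_terms μ κ).hasSum
  rw [← hasSum_nat_add_iff' 1] at h2
  simp only [Finset.range_one, Finset.sum_singleton, pow_zero, Nat.factorial_zero, Nat.cast_one,
      div_one, one_mul, frd_zero] at h2
  have h3 : frF μ κ - 1 = ∑' n : ℕ, (-1) ^ (n + 1) / ((n + 1).factorial : ℂ) * frd μ κ (n + 1) :=
    h2.tsum_eq.symm
  rw [h3, ← tsum_mul_left]
  refine tsum_of_norm_bounded ((summable_gB_succ zero_le_one).mul_left M).hasSum fun n => ?_
  refine (norm_frd_term_le μ κ hM (n + 1)).trans ?_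
  have : M ^ (n + 1) ≤ M := by
    rw [pow_succ]
    exact mul_le_of_le_one_left hM0 (pow_le_one₀ hM0 hM1)
  simp only [gB]
  rw [mul_pow, one_mul, mul_div_assoc]
  gcongr

end

section

set_option linter.unusedSectionVars false

variable {X : Type*} [TopologicalSpace X] [CompactSpace X] [T2Space X] [SecondCountableTopology X]
  [MeasurableSpace X] [BorelSpace X] (μ : Measure X) [IsProbabilityMeasure μ]

/-- The row of values of a kernel, as a linear function of the kernel. -/
def kerRow {n : ℕ} (x : Fin n → X) (i : Fin n) : C(X × X, ℂ) →ₗ[ℂ] (Fin n → ℂ) where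
  toFun κ j := κ (x i, x j)
  map_add' _ _ := rfl
  map_smul' _ _ := rfl

lemma continuous_kerDet {n : ℕ} (κ : Fin n → C(X × X, ℂ)) :
    Continuous fun x : Fin n → X => (Matrix.of fun i j => κ i (x i, x j)).det := by
  refine Continuous.matrix_det (continuous_matrix fun i j => ?_)
  simp only [Matrix.of_apply]
  fun_prop

lemma kerDet_eq {n : ℕ} (κ : Fin n → C(X × X, ℂ)) (x : Fin n → X) :
    (Matrix.of fun i j => κ i (x i, x j)).det = (Matrix.detRowAlternating (R := ℂ)
      (n := Fin n)).toMultilinearMap.compLinearMap (kerRow x) κ := rfl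

lemma norm_kerDet_le {n : ℕ} (κ : Fin n → C(X × X, ℂ)) (x : Fin n → X) :
    ‖(Matrix.of fun i j => κ i (x i, x j)).det‖ ≤ (n.factorial : ℝ) * ∏ i, ‖κ i‖ := by
  rw [← Matrix.det_transpose, Matrix.det_apply]
  refine (norm_sum_le _ _).trans ?_
  have : ∀ σ ∈ (Finset.univ : Finset (Equiv.Perm (Fin n))),
      ‖Equiv.Perm.sign σ • ∏ i, (Matrix.of fun i j => κ i (x i, x j)).transpose (σ i) i‖ ≤
        ∏ i, ‖κ i‖ := fun σ _ => by
    rw [Units.smul_def, ← Int.cast_smul_eq_zsmul ℂ, norm_smul]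
    rw [show ‖((Equiv.Perm.sign σ : ℤ) : ℂ)‖ = 1 by
      rcases Int.units_eq_one_or (Equiv.Perm.sign σ) with h | h <;> simp [h], one_mul, norm_prod]
    exact Finset.prod_le_prod (fun _ _ => norm_nonneg _) fun i _ => (κ i).norm_coe_le_norm _
  refine (Finset.sum_le_sum this).trans ?_
  simp [Fintype.card_perm]

/-- The `n`-th term of the Fredholm determinant as a multilinear function of the rows. -/
def frdM (n : ℕ) : ContinuousMultilinearMap ℂ (fun _ : Fin n => C(X × X, ℂ)) ℂ :=
  MultilinearMap.mkContinuous
    { toFun := fun κ => ∫ x : Fin n → X, (Matrix.of fun i j => κ i (x i, x j)).det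
        ∂(Measure.pi fun _ => μ)
      map_update_add' := fun {d} κ i a b => by
        have h := fun κ : Fin n → C(X × X, ℂ) => integrable_of_continuous_compact
          (ν := Measure.pi fun _ => μ) (continuous_kerDet κ)
        rw [← integral_add (h _) (h _)]
        congr 1
        ext x
        rw [Subsingleton.elim d (instDecidableEqFin n)]
        simp only [kerDet_eq, MultilinearMap.map_update_add]
      map_update_smul' := fun {d} κ i c a => by
        rw [smul_eq_mul, ← integral_const_mul]
        congr 1
        ext x
        rw [Subsingleton.elim d (instDecidableEqFin n)]
        simp only [kerDet_eq, MultilinearMap.map_update_smul, smul_eq_mul] }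
    (n.factorial : ℝ) fun κ => by
      refine (norm_integral_le_of_norm_le_const
        (Eventually.of_forall (norm_kerDet_le κ))).trans ?_
      simp

lemma frdM_apply (n : ℕ) (κ : Fin n → C(X × X, ℂ)) :
    frdM μ n κ = ∫ x : Fin n → X, (Matrix.of fun i j => κ i (x i, x j)).det
      ∂(Measure.pi fun _ => μ) := rfl

lemma frdM_update (m : ℕ) (i : Fin (m + 1)) (κ κ' : C(X × X, ℂ)) :
    frdM μ (m + 1) (Function.update (fun _ => κ) i κ') =
      ∫ w, ∫ y : Fin m → X, (Matrix.of (Fin.cons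
        (fun j : Fin (m + 1) => κ' (w, (Fin.cons w y : Fin (m + 1) → X) j))
        (fun (a : Fin m) (j : Fin (m + 1)) => κ (y a, (Fin.cons w y : Fin (m + 1) → X) j)) :
          Fin (m + 1) → Fin (m + 1) → ℂ)).det ∂(Measure.pi fun _ => μ) ∂μ := by
  rw [frdM_apply, integral_insertNth μ i (continuous_kerDet _)]
  congr 1
  ext w
  congr 1
  ext y
  symm
  rw [← Matrix.det_submatrix_equiv_self i.cycleRange]
  congr 1
  ext a b
  have hx : ∀ c, (i.insertNth w y : Fin (m + 1) → X) c = (Fin.cons w y : Fin (m + 1) → X)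
      (i.cycleRange c) := fun c => by
    rw [← Fin.cons_comp_cycleRange]; rfl
  simp only [Matrix.submatrix_apply, Matrix.of_apply, hx]
  by_cases h : a = i
  · subst h
    simp
  · rw [Function.update_of_ne h]
    obtain ⟨k, rfl⟩ := Fin.exists_succAbove_eq h
    rw [Fin.cycleRange_succAbove]
    simp

lemma hasDerivAt_frd_succ (m : ℕ) {κ : ℂ → C(X × X, ℂ)} {κ' : C(X × X, ℂ)} {z : ℂ}
    (h : HasDerivAt κ κ' z) :
    HasDerivAt (fun z => frd μ (κ z) (m + 1)) ((m + 1) *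
      ∫ w, ∫ y : Fin m → X, (Matrix.of (Fin.cons
        (fun j : Fin (m + 1) => κ' (w, (Fin.cons w y : Fin (m + 1) → X) j))
        (fun (a : Fin m) (j : Fin (m + 1)) => κ z (y a, (Fin.cons w y : Fin (m + 1) → X) j)) :
          Fin (m + 1) → Fin (m + 1) → ℂ)).det ∂(Measure.pi fun _ => μ) ∂μ) z := by
  have h1 := (HasFDerivAt.multilinear_comp (f := frdM μ (m + 1)) (g := fun _ z => κ z)
    (fun _ => h.hasFDerivAt)).hasDerivAt
  refine HasDerivAt.congr_deriv (f := fun z => frd μ (κ z) (m + 1)) h1 ?_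
  simp [frdM_update]

lemma differentiableAt_frd (n : ℕ) {κ : ℂ → C(X × X, ℂ)} {z : ℂ}
    (h : DifferentiableAt ℂ κ z) : DifferentiableAt ℂ (fun z => frd μ (κ z) n) z := by
  cases n with
  | zero => simp [frd_zero]
  | succ m => exact (hasDerivAt_frd_succ μ m h.hasDerivAt).differentiableAt

/-- Two-variable pairing of kernels along the product. -/
lemma hasSum_integral_kernel_mul_frDn (κ κ' : C(X × X, ℂ)) :
    HasSum (fun n : ℕ => (-1) ^ n / (n.factorial : ℂ) *
      ∫ w, ∫ v, κ' (w, v) * frDn μ κ n v w ∂μ ∂μ)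
      (∫ w, ∫ v, κ' (w, v) * frD μ κ v w ∂μ ∂μ) := by
  have hc : ∀ n : ℕ, Continuous fun p : X × X => κ' p * frDn μ κ n p.2 p.1 := fun n =>
    κ'.continuous.mul ((continuous_frDn μ κ n).comp
      (by fun_prop : Continuous fun p : X × X => (p.2, p.1)))
  have hcD : Continuous fun p : X × X => κ' p * frD μ κ p.2 p.1 :=
    κ'.continuous.mul ((continuous_frD μ κ).comp
      (by fun_prop : Continuous fun p : X × X => (p.2, p.1)))
  have e1 : ∀ n, ∫ w, ∫ v, κ' (w, v) * frDn μ κ n v w ∂μ ∂μ =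
      ∫ p, κ' p * frDn μ κ n p.2 p.1 ∂(μ.prod μ) := fun n =>
    (integral_prod _ (integrable_of_continuous_compact (hc n))).symm
  have e2 : ∫ w, ∫ v, κ' (w, v) * frD μ κ v w ∂μ ∂μ =
      ∫ p, κ' p * frD μ κ p.2 p.1 ∂(μ.prod μ) :=
    (integral_prod _ (integrable_of_continuous_compact hcD)).symm
  simp only [e1, e2]
  have hc' : ∀ n : ℕ, Continuous fun p : X × X =>
      κ' p * ((-1) ^ n / (n.factorial : ℂ) * frDn μ κ n p.2 p.1) := fun n => by
    have := (hc n).const_mul ((-1) ^ n / (n.factorial : ℂ))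
    refine this.congr fun p => by ring
  have hb : ∀ n (p : X × X), ‖κ' p * ((-1) ^ n / (n.factorial : ℂ) * frDn μ κ n p.2 p.1)‖ ≤
      ‖κ'‖ * gB (2 * ‖κ‖) (n + 1) := fun n p => by
    rw [norm_mul]
    exact mul_le_mul (κ'.norm_coe_le_norm p) (norm_frDn_term_le μ κ le_rfl n p.2 p.1)
      (norm_nonneg _) (norm_nonneg _)
  have := hasSum_integral_of_summable_integral_norm (μ := μ.prod μ)
    (fun n => integrable_of_continuous_compact (hc' n)) (Summable.of_nonneg_of_le
      (fun n => integral_nonneg fun _ => norm_nonneg _) (fun n => ?_)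
      ((summable_gB_succ (M := 2 * ‖κ‖) (by positivity)).mul_left ‖κ'‖))
  · have e : ∀ n : ℕ, (-1) ^ n / (n.factorial : ℂ) * ∫ p, κ' p * frDn μ κ n p.2 p.1 ∂(μ.prod μ) =
        ∫ p, κ' p * ((-1) ^ n / (n.factorial : ℂ) * frDn μ κ n p.2 p.1) ∂(μ.prod μ) := fun n => by
      rw [← integral_const_mul]
      congr 1
      ext w
      ring
    simp only [e]
    have e2 : ∀ p : X × X, κ' p * frD μ κ p.2 p.1 =
        ∑' n : ℕ, κ' p * ((-1) ^ n / (n.factorial : ℂ) * frDn μ κ n p.2 p.1) :=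
      fun w => tsum_mul_left.symm
    simp only [e2]
    exact this
  · calc _ ≤ ∫ _p : X × X, ‖κ'‖ * gB (2 * ‖κ‖) (n + 1) ∂(μ.prod μ) :=
          integral_mono (integrable_of_continuous_compact (hc' n).norm) (integrable_const _) (hb n)
      _ = _ := by simp

lemma deriv_frd_add_two (m : ℕ) {κ : ℂ → C(X × X, ℂ)} {κ' : C(X × X, ℂ)} {z : ℂ}
    (h : HasDerivAt κ κ' z) :
    deriv (fun z => frd μ (κ z) (m + 2)) z = (m + 2) *
      ((∫ w, κ' (w, w) ∂μ) * frd μ (κ z) (m + 1) -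
        (m + 1) * ∫ w, ∫ v, κ' (w, v) * frDn μ (κ z) m v w ∂μ ∂μ) := by
  rw [(hasDerivAt_frd_succ μ (m + 1) h).deriv]
  have hrow := fun w => integral_det_row μ (κ z) (κ'.comp ⟨fun v => (w, v), by fun_prop⟩) w m
  simp only [ContinuousMap.comp_apply, ContinuousMap.coe_mk] at hrow
  simp only [hrow]
  have hc1 : Continuous fun w : X => κ' (w, w) * frd μ (κ z) (m + 1) := by fun_prop
  have hc2 : Continuous fun w : X => (m + 1 : ℂ) * ∫ v, κ' (w, v) * frDn μ (κ z) m v w ∂μ := by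
    refine continuous_const.mul ?_
    have hc : Continuous fun p : X × X => κ' p * frDn μ (κ z) m p.2 p.1 :=
      κ'.continuous.mul ((continuous_frDn μ (κ z) m).comp
        (by fun_prop : Continuous fun p : X × X => (p.2, p.1)))
    have := continuous_parametric_integral_of_continuous (μ := μ) (s := univ)
      (f := fun w v => κ' (w, v) * frDn μ (κ z) m v w) hc isCompact_univ
    simpa using this
  rw [integral_sub (integrable_of_continuous_compact hc1) (integrable_of_continuous_compact hc2),
    integral_mul_const, integral_const_mul]
  push_cast
  ring

lemma deriv_frd_one {κ : ℂ → C(X × X, ℂ)} {κ' : C(X × X, ℂ)} {z : ℂ}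
    (h : HasDerivAt κ κ' z) :
    deriv (fun z => frd μ (κ z) 1) z = ∫ w, κ' (w, w) ∂μ := by
  have := (hasDerivAt_frd_succ μ 0 h).deriv
  simpa using this

/-- Differentiability and derivative of the Fredholm determinant along a holomorphic family of
kernels. -/
theorem hasDerivAt_frF {κ : ℂ → C(X × X, ℂ)} {U : Set ℂ} (hU : IsOpen U)
    (hκ : DifferentiableOn ℂ κ U) {z : ℂ} (hz : z ∈ U) :
    HasDerivAt (fun z => frF μ (κ z)) (-((∫ w, deriv κ z (w, w) ∂μ) * frF μ (κ z) +
      ∫ w, ∫ v, deriv κ z (w, v) * frD μ (κ z) v w ∂μ ∂μ)) z := by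
  set M := ‖κ z‖ + 1 with hM
  have hM0 : 0 ≤ M := by positivity
  set V := U ∩ κ ⁻¹' (Metric.ball 0 M) with hV
  have hVo : IsOpen V := hκ.continuousOn.isOpen_inter_preimage hU Metric.isOpen_ball
  have hzV : z ∈ V := ⟨hz, by simp [hM]⟩
  have hdiff : ∀ n : ℕ, DifferentiableOn ℂ
      (fun z => (-1) ^ n / (n.factorial : ℂ) * frd μ (κ z) n) V := fun n w hw =>
    ((differentiableAt_frd μ n (hκ.differentiableAt (hU.mem_nhds hw.1))).const_mul
      _).differentiableWithinAt
  have hbd : ∀ (n : ℕ) (w : ℂ), w ∈ V → ‖(-1) ^ n / (n.factorial : ℂ) * frd μ (κ w) n‖ ≤ gB M n :=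
    fun n w hw => norm_frd_term_le μ (κ w) (by
      have := hw.2; simp only [mem_preimage, Metric.mem_ball, dist_zero_right] at this
      exact this.le) n
  have hd := (Complex.differentiableOn_tsum_of_summable_norm (summable_gB hM0) hdiff hVo
    hbd).differentiableAt (hVo.mem_nhds hzV)
  have hs := Complex.hasSum_deriv_of_summable_norm (summable_gB hM0) hdiff hVo hbd hzV
  have hκz := (hκ.differentiableAt (hU.mem_nhds hz)).hasDerivAt
  have hder := hd.hasDerivAt
  change HasDerivAt (fun z => frF μ (κ z)) _ z at hder
  convert hder using 1
  refine HasSum.unique ?_ hs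
  rw [← hasSum_nat_add_iff' 2]
  have t1 := (summable_frF_terms μ (κ z)).hasSum
  rw [← hasSum_nat_add_iff' 1] at t1
  have t2 := hasSum_integral_kernel_mul_frDn μ (κ z) (deriv κ z)
  have t3 := ((t1.mul_left (∫ w, deriv κ z (w, w) ∂μ)).add t2).neg
  have t4 : HasSum (fun n => deriv (fun z => (-1) ^ (n + 2) / ((n + 2).factorial : ℂ) *
      frd μ (κ z) (n + 2)) z) _ := hasSum_of_eq t3 (fun n => ?_)
  · refine (congrArg (HasSum _ · _) ?_).mpr t4
    simp only [Finset.sum_range_succ, Finset.range_zero, Finset.sum_empty, zero_add, pow_zero,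
      Nat.factorial_zero, Nat.cast_one, div_one, one_mul, frd_zero, deriv_const, pow_one,
      Nat.factorial_one, neg_mul, deriv.fun_neg, deriv_frd_one μ hκz]
    change _ = -(_ * (frF μ (κ z) - 1) + _)
    ring
  · rw [deriv_const_mul _ (differentiableAt_frd μ _ hκz.differentiableAt),
      deriv_frd_add_two μ n hκz, Nat.factorial_succ, Nat.factorial_succ]
    have hf : (n.factorial : ℂ) ≠ 0 := by exact_mod_cast n.factorial_ne_zero
    have h4 : (n : ℂ) + 1 ≠ 0 := by exact_mod_cast n.succ_ne_zero
    have h5 : (n : ℂ) + 2 ≠ 0 := by exact_mod_cast (n + 1).succ_ne_zero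
    have h6 : (n : ℂ) + 1 + 1 ≠ 0 := by exact_mod_cast (n + 1).succ_ne_zero
    push_cast
    field_simp
    ring

end

section

set_option linter.unusedSectionVars false

lemma hasDerivAt_clm_comp {E F : Type*} [NormedAddCommGroup E] [NormedSpace ℂ E]
    [NormedAddCommGroup F] [NormedSpace ℂ F] (L : E →L[ℂ] F) {f : ℂ → E} {f' : E} {z : ℂ}
    (h : HasDerivAt f f' z) : HasDerivAt (fun z => L (f z)) (L f') z :=
  L.hasFDerivAt.comp_hasDerivAt z h

lemma hasDerivAt_const_sub {E : Type*} [NormedAddCommGroup E] [NormedSpace ℂ E] (c : E)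
    {f : ℂ → E} {f' : E} {z : ℂ} (h : HasDerivAt f f' z) :
    HasDerivAt (fun z => c - f z) (-f') z := h.const_sub c

section
variable {X : Type*} [TopologicalSpace X] [CompactSpace X] [T2Space X] [SecondCountableTopology X]
  [MeasurableSpace X] [BorelSpace X] (μ : Measure X) [IsProbabilityMeasure μ]

/-- Integration as a continuous linear functional on continuous functions. -/
def intC : C(X, ℂ) →L[ℂ] ℂ :=
  LinearMap.mkContinuous
    { toFun := fun f => ∫ x, f x ∂μ
      map_add' := fun f g => integral_add (integrable_of_continuous_compact f.continuous)
        (integrable_of_continuous_compact g.continuous)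
      map_smul' := fun c f => by
        simp only [ContinuousMap.smul_apply, smul_eq_mul, RingHom.id_apply]
        exact integral_const_mul _ _ }
    1 fun f => by
      refine (norm_integral_le_of_norm_le_const
        (Eventually.of_forall fun x => f.norm_coe_le_norm x)).trans ?_
      simp

lemma intC_apply (f : C(X, ℂ)) : intC μ f = ∫ x, f x ∂μ := rfl

lemma continuous_integral_kernel {κ : X → X → ℂ} (h : Continuous fun p : X × X => κ p.1 p.2) :
    Continuous fun u => ∫ v, κ u v ∂μ := by
  have := continuous_parametric_integral_of_continuous (μ := μ) (s := univ) (f := κ) h isCompact_univ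
  simpa using this

/-- The integral operator with a continuous kernel. -/
def opK : C(X × X, ℂ) →L[ℂ] C(X, ℂ) →L[ℂ] C(X, ℂ) :=
  LinearMap.mkContinuous₂
    (LinearMap.mk₂ ℂ (fun κ f => ⟨fun u => ∫ v, κ (u, v) * f v ∂μ,
      continuous_integral_kernel μ (by fun_prop)⟩)
      (fun κ κ' f => by
        ext u
        simp only [ContinuousMap.coe_mk, ContinuousMap.add_apply, add_mul]
        exact integral_add (integrable_of_continuous_compact (by fun_prop))
          (integrable_of_continuous_compact (by fun_prop)))
      (fun c κ f => by
        ext u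
        simp only [ContinuousMap.coe_mk, ContinuousMap.smul_apply, smul_eq_mul, mul_assoc]
        exact integral_const_mul _ _)
      (fun κ f g => by
        ext u
        simp only [ContinuousMap.coe_mk, ContinuousMap.add_apply, mul_add]
        exact integral_add (integrable_of_continuous_compact (by fun_prop))
          (integrable_of_continuous_compact (by fun_prop)))
      (fun c κ f => by
        ext u
        simp only [ContinuousMap.coe_mk, ContinuousMap.smul_apply, smul_eq_mul]
        rw [← integral_const_mul]
        congr 1
        ext v
        ring))
    1 fun κ f => by
      rw [ContinuousMap.norm_le _ (by positivity)]
      intro u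
      have h : ∀ v, ‖κ (u, v) * f v‖ ≤ 1 * ‖κ‖ * ‖f‖ := fun v => by
        rw [norm_mul, one_mul]
        exact mul_le_mul (κ.norm_coe_le_norm _) (f.norm_coe_le_norm _) (norm_nonneg _)
          (norm_nonneg _)
      refine (norm_integral_le_of_norm_le_const (μ := μ) (Eventually.of_forall h)).trans ?_
      simp

lemma opK_apply (κ : C(X × X, ℂ)) (f : C(X, ℂ)) (u : X) :
    opK μ κ f u = ∫ v, κ (u, v) * f v ∂μ := rfl

lemma integral_integral_comm {f : X → X → ℂ} (h : Continuous fun p : X × X => f p.1 p.2) :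
    ∫ u, ∫ v, f u v ∂μ ∂μ = ∫ v, ∫ u, f u v ∂μ ∂μ :=
  integral_integral_swap (integrable_of_continuous_compact h)

lemma opK_opK (κ κ' : C(X × X, ℂ)) (f : C(X, ℂ)) (u : X) :
    opK μ κ (opK μ κ' f) u = ∫ v, (∫ w, κ (u, w) * κ' (w, v) ∂μ) * f v ∂μ := by
  simp only [opK_apply]
  have h1 : ∀ w, κ (u, w) * ∫ v, κ' (w, v) * f v ∂μ = ∫ v, κ (u, w) * (κ' (w, v) * f v) ∂μ :=
    fun w => (integral_const_mul _ _).symm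
  have h2 : ∀ v, (∫ w, κ (u, w) * κ' (w, v) ∂μ) * f v = ∫ w, κ (u, w) * (κ' (w, v) * f v) ∂μ :=
    fun v => by
    rw [← integral_mul_const]
    simp only [mul_assoc]
  simp only [h1, h2]
  exact integral_integral_comm μ (by fun_prop)

/-- The first Fredholm minor as a continuous kernel. -/
def frDC (κ : C(X × X, ℂ)) : C(X × X, ℂ) := ⟨fun p => frD μ κ p.1 p.2, continuous_frD μ κ⟩

lemma frDC_apply (κ : C(X × X, ℂ)) (u v : X) : frDC μ κ (u, v) = frD μ κ u v := rfl

section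
variable {κ : C(X × X, ℂ)} (hκ : ∀ u v, κ (u, v) = κ (v, u))

lemma opK_frDC_left (f : C(X, ℂ)) :
    opK μ (frDC μ κ) f = frF μ κ • opK μ κ f + opK μ κ (opK μ (frDC μ κ) f) := by
  ext u
  rw [ContinuousMap.add_apply, ContinuousMap.smul_apply, opK_opK, opK_apply, opK_apply,
    smul_eq_mul, ← integral_const_mul, ← integral_add]
  · congr 1
    ext v
    simp only [frDC_apply]
    rw [frD_eq]
    ring
  · exact integrable_of_continuous_compact (by fun_prop)
  · refine integrable_of_continuous_compact ?_
    refine Continuous.mul ?_ f.continuous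
    exact continuous_integral_kernel μ (κ := fun v w => κ (u, w) * frDC μ κ (w, v)) (by fun_prop)

include hκ

lemma integral_frD_mul (u v : X) :
    ∫ w, frD μ κ u w * κ (w, v) ∂μ = ∫ w, κ (u, w) * frD μ κ w v ∂μ := by
  have h1 := frD_eq μ κ u v
  have h2 := frD_eq μ κ v u
  rw [frD_symm μ κ hκ v u, hκ v u] at h2
  have h3 : ∫ w, frD μ κ u w * κ (w, v) ∂μ = ∫ w, κ (v, w) * frD μ κ w u ∂μ := by
    congr 1
    ext w
    rw [frD_symm μ κ hκ u w, hκ w v, mul_comm]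
  rw [h3]
  linear_combination h1 - h2

lemma opK_frDC_right (f : C(X, ℂ)) :
    opK μ (frDC μ κ) (opK μ κ f) = opK μ κ (opK μ (frDC μ κ) f) := by
  ext u
  rw [opK_opK, opK_opK]
  simp only [frDC_apply, integral_frD_mul μ hκ]

/-- The resolvent is given by the Fredholm minors. -/
lemma isUnit_one_sub_opK (hF : frF μ κ ≠ 0) : IsUnit (1 - opK μ κ) := by
  refine ⟨⟨1 - opK μ κ, 1 + (frF μ κ)⁻¹ • opK μ (frDC μ κ), ?_, ?_⟩, rfl⟩
  · ext f u
    have h := congrArg (fun g : C(X, ℂ) => g u) (opK_frDC_left (κ := κ) μ f)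
    simp only [ContinuousMap.add_apply, ContinuousMap.smul_apply, smul_eq_mul] at h
    simp only [mul_apply_eq_comp, sub_apply, add_apply, smul_apply,
      one_apply_eq_self, map_add, map_smul, ContinuousMap.add_apply, ContinuousMap.sub_apply,
      ContinuousMap.smul_apply, smul_eq_mul]
    rw [h]
    field_simp
    ring
  · ext f u
    have h := congrArg (fun g : C(X, ℂ) => g u) (opK_frDC_left (κ := κ) μ f)
    simp only [ContinuousMap.add_apply, ContinuousMap.smul_apply, smul_eq_mul] at h
    simp only [mul_apply_eq_comp, sub_apply, add_apply, smul_apply,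
      one_apply_eq_self, map_sub, ContinuousMap.add_apply, ContinuousMap.sub_apply,
      ContinuousMap.smul_apply, smul_eq_mul, opK_frDC_right μ hκ]
    rw [h]
    field_simp
    ring

end

/-- The resolvent operator. -/
def res (κ : C(X × X, ℂ)) : C(X, ℂ) →L[ℂ] C(X, ℂ) := Ring.inverse (1 - opK μ κ)

section
variable {κ : C(X × X, ℂ)} (hu : IsUnit (1 - opK μ κ))
include hu

lemma res_eq (f : C(X, ℂ)) : res μ κ f = f + opK μ κ (res μ κ f) := by
  have h := Ring.mul_inverse_cancel _ hu
  have h2 := congrArg (fun T : C(X, ℂ) →L[ℂ] C(X, ℂ) => T f) h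
  simp only [mul_apply_eq_comp, sub_apply, one_apply_eq_self] at h2
  exact sub_eq_iff_eq_add.1 h2

lemma eq_res {f y : C(X, ℂ)} (h : y = f + opK μ κ y) : y = res μ κ f := by
  have h1 := Ring.inverse_mul_cancel _ hu
  have h2 := congrArg (fun T : C(X, ℂ) →L[ℂ] C(X, ℂ) => T y) h1
  simp only [mul_apply_eq_comp, sub_apply, one_apply_eq_self] at h2
  rw [← sub_eq_iff_eq_add.2 h] 
  exact h2.symm

end

lemma intC_mul_opK {κ : C(X × X, ℂ)} (hκ : ∀ u v, κ (u, v) = κ (v, u)) (f g : C(X, ℂ)) :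
    intC μ (f * opK μ κ g) = intC μ (opK μ κ f * g) := by
  simp only [intC_apply, ContinuousMap.mul_apply, opK_apply]
  have h1 : ∀ u, f u * ∫ v, κ (u, v) * g v ∂μ = ∫ v, f u * (κ (u, v) * g v) ∂μ :=
    fun w => (integral_const_mul _ _).symm
  have h2 : ∀ v, (∫ u, κ (v, u) * f u ∂μ) * g v = ∫ u, f u * (κ (u, v) * g v) ∂μ := fun v => by
    rw [← integral_mul_const]
    congr 1
    ext u
    rw [hκ v u]
    ring
  simp only [h1, h2]
  exact integral_integral_comm μ (by fun_prop)

lemma hasDerivAt_inverse_apply {E : Type*} [NormedAddCommGroup E] [NormedSpace ℂ E]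
    [CompleteSpace E] {T : ℂ → E →L[ℂ] E} {T' : E →L[ℂ] E} {f : ℂ → E} {f' : E} {z : ℂ}
    (hT : HasDerivAt T T' z) (hf : HasDerivAt f f' z) (hu : IsUnit (T z)) :
    HasDerivAt (fun z => Ring.inverse (T z) (f z))
      (Ring.inverse (T z) (f' - T' (Ring.inverse (T z) (f z)))) z := by
  have hd : DifferentiableAt ℂ (fun z => Ring.inverse (T z) (f z)) z :=
    (hT.differentiableAt.inverse hu).clm_apply hf.differentiableAt
  have hev : ∀ᶠ w in nhds z, IsUnit (T w) :=
    hT.continuousAt.eventually (Units.isOpen.mem_nhds hu)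
  have h1 := hT.clm_apply hd.hasDerivAt
  have h2 : (fun w => (T w) (Ring.inverse (T w) (f w))) =ᶠ[nhds z] f :=
    hev.mono fun w hw => by
      have := congrArg (fun S : E →L[ℂ] E => S (f w)) (Ring.mul_inverse_cancel _ hw)
      simpa using this
  have h3 := (h2.hasDerivAt_iff.1 h1).unique hf
  refine hd.hasDerivAt.congr_deriv ?_
  rw [← h3, add_sub_cancel_left]
  have := congrArg (fun S : E →L[ℂ] E => S (deriv (fun z => Ring.inverse (T z) (f z)) z))
    (Ring.inverse_mul_cancel _ hu)
  simpa using this.symm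

/-- Derivative of the solution of the integral equation. -/
lemma hasDerivAt_res {κ : ℂ → C(X × X, ℂ)} {κ' : C(X × X, ℂ)} {f : ℂ → C(X, ℂ)} {f' : C(X, ℂ)} {z : ℂ}
    (hκ : HasDerivAt κ κ' z) (hf : HasDerivAt f f' z) (hu : IsUnit (1 - opK μ (κ z))) :
    HasDerivAt (fun z => res μ (κ z) (f z))
      (res μ (κ z) (f' + opK μ κ' (res μ (κ z) (f z)))) z := by
  have hop : HasDerivAt (fun z => 1 - opK μ (κ z)) (-opK μ κ') z :=
    hasDerivAt_const_sub (E := C(X, ℂ) →L[ℂ] C(X, ℂ)) (f := fun z => opK μ (κ z))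
      (f' := opK μ κ') 1
      (hasDerivAt_clm_comp (E := C(X × X, ℂ)) (F := C(X, ℂ) →L[ℂ] C(X, ℂ)) (opK μ) hκ)
  have h := hasDerivAt_inverse_apply (E := C(X, ℂ)) (T := fun z => 1 - opK μ (κ z))
    (T' := -opK μ κ') hop hf hu
  rw [neg_apply, sub_neg_eq_add] at h
  exact h

lemma frF_smul_res {κ : C(X × X, ℂ)} (hκ : ∀ u v, κ (u, v) = κ (v, u)) (hF : frF μ κ ≠ 0)
    (f : C(X, ℂ)) : frF μ κ • res μ κ f = frF μ κ • f + opK μ (frDC μ κ) f := by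
  have h : f + (frF μ κ)⁻¹ • opK μ (frDC μ κ) f = res μ κ f := by
    refine eq_res μ (isUnit_one_sub_opK μ hκ hF) ?_
    have h := opK_frDC_left (κ := κ) μ f
    nth_rewrite 1 [h]
    simp only [map_add, map_smul, smul_add, inv_smul_smul₀ hF]
  rw [← h, smul_add, smul_inv_smul₀ hF]

end

end

local notation "I01" => unitInterval

lemma differentiable_continuousMap {Y : Type*} [TopologicalSpace Y] [CompactSpace Y]
    {F : ℂ → C(Y, ℂ)} (hF : Continuous F) (hd : ∀ y, Differentiable ℂ fun z => F z y) :
    Differentiable ℂ F :=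
  differentiableOn_univ.1 (differentiableOn_continuousMap isOpen_univ hF.continuousOn
    fun y => (hd y).differentiableOn)

section
variable {s : ℂ} (hs : -(1 / 2 : ℝ) < s.re)

/-- The function `u ↦ pf s (z u)` on the unit interval. -/
def pC (z : ℂ) : C(I01, ℂ) :=
  ⟨fun u => pf s (z * ((u : ℝ) : ℂ)), (continuous_pf hs).comp (by fun_prop)⟩

/-- The function `u ↦ pg s (z u)` on the unit interval. -/
def qC (z : ℂ) : C(I01, ℂ) :=
  ⟨fun u => pg s (z * ((u : ℝ) : ℂ)), (continuous_pg hs).comp (by fun_prop)⟩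

/-- The kernel `(u, v) ↦ hker s (z u) (z v)` on the unit square. -/
def hC (z : ℂ) : C(I01 × I01, ℂ) :=
  ⟨fun p => hker s (z * ((p.1 : ℝ) : ℂ)) (z * ((p.2 : ℝ) : ℂ)),
    (continuous_hker hs).comp (f := fun p : I01 × I01 =>
      (z * ((p.1 : ℝ) : ℂ), z * ((p.2 : ℝ) : ℂ))) (by fun_prop)⟩

/-- Multiplication by the coordinate. -/
def mC : C(I01, ℂ) := ⟨fun u => ((u : ℝ) : ℂ), by fun_prop⟩

lemma continuous_pC : Continuous (pC hs) :=
  ContinuousMap.continuous_of_continuous_uncurry _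
    ((continuous_pf hs).comp (f := fun p : ℂ × I01 => p.1 * ((p.2 : ℝ) : ℂ)) (by fun_prop))

lemma continuous_qC : Continuous (qC hs) :=
  ContinuousMap.continuous_of_continuous_uncurry _
    ((continuous_pg hs).comp (f := fun p : ℂ × I01 => p.1 * ((p.2 : ℝ) : ℂ)) (by fun_prop))

lemma continuous_hC : Continuous (hC hs) :=
  ContinuousMap.continuous_of_continuous_uncurry _
    ((continuous_hker hs).comp (f := fun p : ℂ × (I01 × I01) =>
      (p.1 * ((p.2.1 : ℝ) : ℂ), p.1 * ((p.2.2 : ℝ) : ℂ))) (by fun_prop))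

lemma differentiable_pC : Differentiable ℂ (pC hs) :=
  differentiable_continuousMap (continuous_pC hs) fun u =>
    (differentiable_pf hs).comp (f := fun z : ℂ => z * ((u : ℝ) : ℂ)) (by fun_prop)

lemma differentiable_qC : Differentiable ℂ (qC hs) :=
  differentiable_continuousMap (continuous_qC hs) fun u =>
    (differentiable_pg hs).comp (f := fun z : ℂ => z * ((u : ℝ) : ℂ)) (by fun_prop)

include hs in
lemma differentiable_hker_mul (α β : ℂ) : Differentiable ℂ fun z => hker s (z * α) (z * β) := by
  have := isProbabilityMeasure_muI (Bs_pos hs)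
  have h1 := continuous_pf hs
  have h2 := continuous_pg hs
  have d1 := differentiable_pf hs
  have d2 := differentiable_pg hs
  let F : ℂ → C(I01, ℂ) := fun z =>
    ⟨fun r => pf s ((r : ℝ) * (z * α)) * pg s ((r : ℝ) * (z * β)) +
      pg s ((r : ℝ) * (z * α)) * pf s ((r : ℝ) * (z * β)), by fun_prop⟩
  have hF : Differentiable ℂ F := by
    refine differentiable_continuousMap ?_ fun r => ?_
    · refine ContinuousMap.continuous_of_continuous_uncurry _ ?_
      change Continuous fun p : ℂ × I01 => pf s ((p.2 : ℝ) * (p.1 * α)) * pg s ((p.2 : ℝ) * (p.1 * β)) +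
        pg s ((p.2 : ℝ) * (p.1 * α)) * pf s ((p.2 : ℝ) * (p.1 * β))
      fun_prop
    · change Differentiable ℂ fun z => pf s ((r : ℝ) * (z * α)) * pg s ((r : ℝ) * (z * β)) +
        pg s ((r : ℝ) * (z * α)) * pf s ((r : ℝ) * (z * β))
      fun_prop
  exact ((intC (muI (Bs s))).differentiable.comp hF).const_mul (1 / 2)

lemma differentiable_hC : Differentiable ℂ (hC hs) :=
  differentiable_continuousMap (continuous_hC hs) fun _ => differentiable_hker_mul hs _ _

/-- The rescaled kernel on the unit square. -/
def kC (c : ℝ) (z : ℂ) : C(I01 × I01, ℂ) := (((c / Bs s : ℝ) : ℂ) * z ^ ((Bs s : ℝ) : ℂ)) • hC hs z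

lemma kC_apply (c : ℝ) (z : ℂ) (u v : I01) : kC hs c z (u, v) =
    ((c / Bs s : ℝ) : ℂ) * z ^ ((Bs s : ℝ) : ℂ) *
      hker s (z * ((u : ℝ) : ℂ)) (z * ((v : ℝ) : ℂ)) := rfl

lemma kC_symm (c : ℝ) (z : ℂ) (u v : I01) : kC hs c z (u, v) = kC hs c z (v, u) := by
  rw [kC_apply, kC_apply, hker_symm]

lemma conj_kC (c : ℝ) {τ : ℝ} (hτ : 0 < τ) (u v : I01) :
    (starRingEnd ℂ) (kC hs c τ (u, v)) = kC hs c τ (u, v) := by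
  simp only [kC_apply, map_mul, conj_ofReal, conj_hker hs, ← ofReal_cpow hτ.le]

lemma differentiableAt_kC (c : ℝ) {z : ℂ} (hz : 0 < z.re) : DifferentiableAt ℂ (kC hs c) z := by
  have h1 : DifferentiableAt ℂ (fun z : ℂ => ((c / Bs s : ℝ) : ℂ) * z ^ ((Bs s : ℝ) : ℂ)) z :=
    (differentiableAt_id.cpow_const (Or.inl hz)).const_mul _
  exact h1.smul (differentiable_hC hs z)

/-- The kernel `f ⊗ g`. -/
def tens {X : Type*} [TopologicalSpace X] (f g : C(X, ℂ)) : C(X × X, ℂ) :=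
  ⟨fun p => f p.1 * g p.2, by fun_prop⟩

lemma tens_apply {X : Type*} [TopologicalSpace X] (f g : C(X, ℂ)) (u v : X) :
    tens f g (u, v) = f u * g v := rfl

/-- The derivative of `kC`. -/
def kC' (c : ℝ) (z : ℂ) : C(I01 × I01, ℂ) :=
  ((c : ℂ) * z ^ (2 * s.re : ℂ) / 2) • (tens (pC hs z) (qC hs z) + tens (qC hs z) (pC hs z))

include hs in
lemma hasDerivAt_rpow_mul_hker {τ : ℝ} (hτ : 0 < τ) (α β : ℂ) :
    HasDerivAt (fun t : ℝ => ((t ^ Bs s : ℝ) : ℂ) * hker s (t * α) (t * β))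
      (((Bs s * τ ^ (2 * s.re) : ℝ) : ℂ) * ((1 / 2) *
        (pf s (τ * α) * pg s (τ * β) + pg s (τ * α) * pf s (τ * β)))) τ := by
  have h1 := continuous_pf hs
  have h2 := continuous_pg hs
  have h := (hasDerivAt_rpow_smul_integral_muI (Bs_pos hs) (f := fun x : ℝ =>
    pf s (x * α) * pg s (x * β) + pg s (x * α) * pf s (x * β)) (by fun_prop) hτ).const_mul (1 / 2 : ℂ)
  have e : Bs s - 1 = 2 * s.re := by unfold Bs; ring
  rw [e] at h
  refine (h.congr_of_eventuallyEq (Eventually.of_forall fun t => ?_)).congr_deriv ?_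
  · simp only [hker, real_smul, ofReal_mul]
    rw [mul_left_comm]
    congr 3
    ext r
    rw [show (t : ℂ) * ((r : ℝ) : ℂ) * α = ((r : ℝ) : ℂ) * (t * α) by ring,
      show (t : ℂ) * ((r : ℝ) : ℂ) * β = ((r : ℝ) : ℂ) * (t * β) by ring]
  · rw [real_smul]
    ring

lemma hasDerivAt_kC (c : ℝ) {τ : ℝ} (hτ : 0 < τ) : HasDerivAt (kC hs c) (kC' hs c τ) τ := by
  have hd := (differentiableAt_kC hs c (z := τ) (by simpa using hτ))
  refine hd.hasDerivAt.congr_deriv ?_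
  ext ⟨u, v⟩
  rw [deriv_continuousMap_apply hd]
  have hp : DifferentiableAt ℂ (fun z => kC hs c z (u, v)) τ :=
    (hasDerivAt_clm_comp (E := C(I01 × I01, ℂ)) (F := ℂ) (ContinuousMap.evalCLM ℂ (u, v))
      hd.hasDerivAt).differentiableAt
  have h1 := hp.hasDerivAt.comp_ofReal
  have h2 := (hasDerivAt_rpow_mul_hker hs hτ ((u : ℝ) : ℂ) ((v : ℝ) : ℂ)).const_mul
    ((c / Bs s : ℝ) : ℂ)
  refine (h1.congr_of_eventuallyEq ?_).unique (h2.congr_deriv ?_)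
  · filter_upwards [Ioi_mem_nhds hτ] with t ht
    rw [kC_apply, ofReal_cpow (le_of_lt ht)]
    ring
  · have hB : ((Bs s : ℝ) : ℂ) ≠ 0 := ofReal_ne_zero.2 (Bs_pos hs).ne'
    simp only [kC', ContinuousMap.smul_apply, ContinuousMap.add_apply, tens_apply, pC, qC,
      ContinuousMap.coe_mk, smul_eq_mul, ofReal_mul, ofReal_div, ofReal_cpow hτ.le, ofReal_ofNat]
    field_simp

lemma hasDerivAt_pC {τ : ℝ} (hτ : 0 < τ) : HasDerivAt (pC hs)
    ((τ : ℂ)⁻¹ • (-(s • pC hs τ) - (I * τ) • (mC * pC hs τ) + s • qC hs τ)) τ := by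
  have hd := differentiable_pC hs τ
  refine hd.hasDerivAt.congr_deriv ?_
  ext u
  rw [deriv_continuousMap_apply hd]
  have hτ' : (τ : ℂ) ≠ 0 := ofReal_ne_zero.2 hτ.ne'
  have h1 := mul_deriv_pf hs (τ * ((u : ℝ) : ℂ))
  have h2 : HasDerivAt (fun z => pC hs z u) (deriv (pf s) (τ * ((u : ℝ) : ℂ)) * ((u : ℝ) : ℂ)) τ := by
    have h3 := ((differentiable_pf hs) (τ * ((u : ℝ) : ℂ))).hasDerivAt
    exact h3.comp (τ : ℂ) (hasDerivAt_mul_const _)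
  rw [h2.deriv]
  simp only [pC, qC, mC, ContinuousMap.smul_apply, ContinuousMap.add_apply, ContinuousMap.sub_apply,
    ContinuousMap.neg_apply, ContinuousMap.mul_apply, ContinuousMap.coe_mk, smul_eq_mul]
  field_simp
  linear_combination h1

lemma hasDerivAt_qC {τ : ℝ} (hτ : 0 < τ) : HasDerivAt (qC hs)
    ((τ : ℂ)⁻¹ • (-((starRingEnd ℂ) s • qC hs τ) + (I * τ) • (mC * qC hs τ) +
      (starRingEnd ℂ) s • pC hs τ)) τ := by
  have hd := differentiable_qC hs τ
  refine hd.hasDerivAt.congr_deriv ?_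
  ext u
  rw [deriv_continuousMap_apply hd]
  have hτ' : (τ : ℂ) ≠ 0 := ofReal_ne_zero.2 hτ.ne'
  have h1 := mul_deriv_pg hs (τ * ((u : ℝ) : ℂ))
  have h2 : HasDerivAt (fun z => qC hs z u) (deriv (pg s) (τ * ((u : ℝ) : ℂ)) * ((u : ℝ) : ℂ)) τ := by
    have h3 := ((differentiable_pg hs) (τ * ((u : ℝ) : ℂ))).hasDerivAt
    exact h3.comp (τ : ℂ) (hasDerivAt_mul_const _)
  rw [h2.deriv]
  simp only [pC, qC, mC, ContinuousMap.smul_apply, ContinuousMap.add_apply,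
    ContinuousMap.neg_apply, ContinuousMap.mul_apply, ContinuousMap.coe_mk, smul_eq_mul]
  field_simp
  linear_combination h1

lemma opK_tens {X : Type*} [TopologicalSpace X] [CompactSpace X] [T2Space X]
    [SecondCountableTopology X] [MeasurableSpace X] [BorelSpace X] (μ : Measure X)
    [IsProbabilityMeasure μ] (f g h : C(X, ℂ)) :
    opK μ (tens f g) h = intC μ (g * h) • f := by
  ext u
  rw [opK_apply, ContinuousMap.smul_apply, smul_eq_mul, intC_apply, mul_comm, ← integral_const_mul]
  simp only [tens_apply, mul_assoc, ContinuousMap.mul_apply]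

end

section
variable {s : ℂ} (hs : -(1 / 2 : ℝ) < s.re) (c : ℝ)

/-- The reference probability measure on the unit interval. -/
def mu (_ : -(1 / 2 : ℝ) < s.re) : Measure I01 := muI (Bs s)

instance : IsProbabilityMeasure (mu hs) := isProbabilityMeasure_muI (Bs_pos hs)

/-- The resolvent applied to `pC`. -/
def yC (z : ℂ) : C(I01, ℂ) := res (mu hs) (kC hs c z) (pC hs z)

/-- The resolvent applied to `qC`. -/
def zC (z : ℂ) : C(I01, ℂ) := res (mu hs) (kC hs c z) (qC hs z)

lemma res_pC (z : ℂ) : res (mu hs) (kC hs c z) (pC hs z) = yC hs c z := rfl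

lemma res_qC (z : ℂ) : res (mu hs) (kC hs c z) (qC hs z) = zC hs c z := rfl

def uF (τ : ℝ) : ℂ := c * (τ ^ Bs s : ℝ) * intC (mu hs) (pC hs τ * yC hs c τ)

def vF (τ : ℝ) : ℂ := c * (τ ^ Bs s : ℝ) * intC (mu hs) (pC hs τ * zC hs c τ)

def wF (τ : ℝ) : ℂ := c * (τ ^ Bs s : ℝ) * intC (mu hs) (qC hs τ * zC hs c τ)

lemma mC_mul_opK {τ : ℝ} (hτ : 0 < τ) (f : C(I01, ℂ)) :
    mC * opK (mu hs) (kC hs c τ) f = opK (mu hs) (kC hs c τ) (mC * f) +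
      ((c : ℂ) * (τ : ℂ) ^ (2 * s.re : ℂ) * (I / 2)) •
        (intC (mu hs) (qC hs τ * f) • pC hs τ - intC (mu hs) (pC hs τ * f) • qC hs τ) := by
  have hB : ((Bs s : ℝ) : ℂ) ≠ 0 := ofReal_ne_zero.2 (Bs_pos hs).ne'
  have hτ' : (τ : ℂ) ≠ 0 := ofReal_ne_zero.2 hτ.ne'
  have hpow : (τ : ℂ) ^ ((Bs s : ℝ) : ℂ) = (τ : ℂ) ^ (2 * s.re : ℂ) * τ := by
    rw [Bs, ofReal_add, cpow_add _ _ hτ', ofReal_one, cpow_one, ofReal_mul, ofReal_ofNat]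
  ext u
  simp only [ContinuousMap.mul_apply, ContinuousMap.add_apply, ContinuousMap.smul_apply,
    ContinuousMap.sub_apply, smul_eq_mul, opK_apply, intC_apply]
  have key : ∀ v : I01, mC u * (kC hs c τ (u, v) * f v) - kC hs c τ (u, v) * (mC v * f v) =
      (c : ℂ) * (τ : ℂ) ^ (2 * s.re : ℂ) * (I / 2) * (pC hs τ u * (qC hs τ v * f v) -
        qC hs τ u * (pC hs τ v * f v)) := fun v => by
    have h := sub_mul_hker hs (τ * ((u : ℝ) : ℂ)) (τ * ((v : ℝ) : ℂ))
    rw [kC_apply, hpow]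
    simp only [pC, qC, mC, ContinuousMap.coe_mk, ofReal_div]
    generalize hker s (τ * ((u : ℝ) : ℂ)) (τ * ((v : ℝ) : ℂ)) = H at h ⊢
    generalize pf s (τ * ((u : ℝ) : ℂ)) = p1 at h ⊢
    generalize pf s (τ * ((v : ℝ) : ℂ)) = p2 at h ⊢
    generalize pg s (τ * ((u : ℝ) : ℂ)) = q1 at h ⊢
    generalize pg s (τ * ((v : ℝ) : ℂ)) = q2 at h ⊢
    field_simp
    linear_combination (c : ℂ) * (τ : ℂ) ^ (2 * s.re : ℂ) * f v * 2 * h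
  have i1 : ∀ g : C(I01, ℂ), Integrable (fun v => g v) (mu hs) := fun g =>
    integrable_of_continuous_compact g.continuous
  have e1 : mC u * ∫ v, kC hs c τ (u, v) * f v ∂mu hs =
      ∫ v, mC u * (kC hs c τ (u, v) * f v) ∂mu hs := (integral_const_mul _ _).symm
  rw [e1, ← sub_eq_iff_eq_add', ← integral_sub]
  · simp only [key]
    rw [integral_const_mul, integral_sub, integral_const_mul, integral_const_mul]
    · ring
    · exact integrable_of_continuous_compact (by fun_prop)
    · exact integrable_of_continuous_compact (by fun_prop)
  · exact integrable_of_continuous_compact (by fun_prop)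
  · exact integrable_of_continuous_compact (by fun_prop)

variable {τ : ℝ} (hτ : 0 < τ) (hu : IsUnit (1 - opK (mu hs) (kC hs c τ)))

lemma cpow_two_re (hτ : 0 < τ) : (τ : ℂ) * (τ : ℂ) ^ (2 * s.re : ℂ) = ((τ ^ Bs s : ℝ) : ℂ) := by
  have hτ' : (τ : ℂ) ≠ 0 := ofReal_ne_zero.2 hτ.ne'
  rw [ofReal_cpow hτ.le, Bs, ofReal_add, cpow_add _ _ hτ', ofReal_one, cpow_one, ofReal_mul,
    ofReal_ofNat, mul_comm]

include hτ hu

lemma res_mC_mul (f : C(I01, ℂ)) : res (mu hs) (kC hs c τ) (mC * f) =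
    mC * res (mu hs) (kC hs c τ) f - ((c : ℂ) * (τ : ℂ) ^ (2 * s.re : ℂ) * (I / 2)) •
      (intC (mu hs) (qC hs τ * res (mu hs) (kC hs c τ) f) • yC hs c τ -
        intC (mu hs) (pC hs τ * res (mu hs) (kC hs c τ) f) • zC hs c τ) := by
  set y := res (mu hs) (kC hs c τ) f with hy
  have h1 : y = f + opK (mu hs) (kC hs c τ) y := res_eq _ hu f
  have h2 := mC_mul_opK hs c hτ y
  have h3 : mC * y = (mC * f + ((c : ℂ) * (τ : ℂ) ^ (2 * s.re : ℂ) * (I / 2)) •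
        (intC (mu hs) (qC hs τ * y) • pC hs τ - intC (mu hs) (pC hs τ * y) • qC hs τ)) +
        opK (mu hs) (kC hs c τ) (mC * y) := by
    nth_rewrite 1 [h1]
    rw [mul_add, h2]
    abel
  have h4 := eq_res _ hu h3
  rw [map_add, map_smul, map_sub, map_smul, map_smul] at h4
  rw [h4]
  exact (add_sub_cancel_right _ _).symm

lemma hasDerivAt_yC : HasDerivAt (yC hs c) ((τ : ℂ)⁻¹ • (-(s • yC hs c τ) - (I * τ) • (mC * yC hs c τ) +
    (s + uF hs c τ) • zC hs c τ)) τ := by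
  have hτ' : (τ : ℂ) ≠ 0 := ofReal_ne_zero.2 hτ.ne'
  refine (hasDerivAt_res _ (hasDerivAt_kC hs c hτ) (hasDerivAt_pC hs hτ) hu).congr_deriv ?_
  have hK : opK (mu hs) (kC' hs c τ) (yC hs c τ) =
      ((c : ℂ) * (τ : ℂ) ^ (2 * s.re : ℂ) / 2) •
        (intC (mu hs) (qC hs τ * yC hs c τ) • pC hs τ +
          intC (mu hs) (pC hs τ * yC hs c τ) • qC hs τ) := by
    rw [kC', map_smul, smul_apply, map_add, add_apply, opK_tens, opK_tens]
  have hM := res_mC_mul hs c hτ hu (pC hs τ)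
  change res _ _ (_ + opK _ _ (yC hs c τ)) = _
  rw [hK]
  simp only [map_add, map_smul, map_sub, map_neg, hM]
  simp only [res_pC, res_qC]
  ext u
  simp only [ContinuousMap.mul_apply, ContinuousMap.add_apply, ContinuousMap.smul_apply,
    ContinuousMap.sub_apply, ContinuousMap.neg_apply, smul_eq_mul, uF, ← cpow_two_re hτ]
  field_simp
  linear_combination (-(τ : ℂ) * c * (τ : ℂ) ^ (2 * s.re : ℂ) *
    ((intC (mu hs)) (pC hs τ * yC hs c τ) * (zC hs c τ) u -
      intC (mu hs) (qC hs τ * yC hs c τ) * yC hs c τ u)) * I_sq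

lemma hasDerivAt_zC : HasDerivAt (zC hs c) ((τ : ℂ)⁻¹ • (-((starRingEnd ℂ) s • zC hs c τ) +
    (I * τ) • (mC * zC hs c τ) + ((starRingEnd ℂ) s + wF hs c τ) • yC hs c τ)) τ := by
  have hτ' : (τ : ℂ) ≠ 0 := ofReal_ne_zero.2 hτ.ne'
  refine (hasDerivAt_res _ (hasDerivAt_kC hs c hτ) (hasDerivAt_qC hs hτ) hu).congr_deriv ?_
  have hK : opK (mu hs) (kC' hs c τ) (zC hs c τ) =
      ((c : ℂ) * (τ : ℂ) ^ (2 * s.re : ℂ) / 2) •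
        (intC (mu hs) (qC hs τ * zC hs c τ) • pC hs τ +
          intC (mu hs) (pC hs τ * zC hs c τ) • qC hs τ) := by
    rw [kC', map_smul, smul_apply, map_add, add_apply, opK_tens, opK_tens]
  have hM := res_mC_mul hs c hτ hu (qC hs τ)
  change res _ _ (_ + opK _ _ (zC hs c τ)) = _
  rw [hK]
  simp only [map_add, map_smul, map_neg, hM]
  simp only [res_pC, res_qC]
  ext u
  simp only [ContinuousMap.mul_apply, ContinuousMap.add_apply, ContinuousMap.smul_apply,
    ContinuousMap.sub_apply, ContinuousMap.neg_apply, smul_eq_mul, wF, ← cpow_two_re hτ]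
  field_simp
  linear_combination (-(τ : ℂ) * c * (τ : ℂ) ^ (2 * s.re : ℂ) *
    ((intC (mu hs)) (qC hs τ * zC hs c τ) * (yC hs c τ) u -
      intC (mu hs) (pC hs τ * zC hs c τ) * zC hs c τ u)) * I_sq

lemma hasDerivAt_yC_one : HasDerivAt (fun t : ℝ => yC hs c t 1) ((τ : ℂ)⁻¹ * (-(s * yC hs c τ 1) -
    I * τ * yC hs c τ 1 + (s + uF hs c τ) * zC hs c τ 1)) τ := by
  have h := hasDerivAt_clm_comp (E := C(I01, ℂ)) (F := ℂ) (ContinuousMap.evalCLM ℂ 1)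
    (hasDerivAt_yC hs c hτ hu)
  refine h.comp_ofReal.congr_deriv ?_
  simp [mC]

lemma hasDerivAt_zC_one : HasDerivAt (fun t : ℝ => zC hs c t 1) ((τ : ℂ)⁻¹ *
    (-((starRingEnd ℂ) s * zC hs c τ 1) +
    I * τ * zC hs c τ 1 + ((starRingEnd ℂ) s + wF hs c τ) * yC hs c τ 1)) τ := by
  have h := hasDerivAt_clm_comp (E := C(I01, ℂ)) (F := ℂ) (ContinuousMap.evalCLM ℂ 1)
    (hasDerivAt_zC hs c hτ hu)
  refine h.comp_ofReal.congr_deriv ?_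
  simp [mC]

end

section
variable {s : ℂ} (hs : -(1 / 2 : ℝ) < s.re) (c : ℝ)

/-- The Fredholm determinant of the rescaled kernel, for complex scale. -/
def fC (z : ℂ) : ℂ := frF (mu hs) (kC hs c z)

lemma hasDerivAt_fC_aux {z : ℂ} (hz : 0 < z.re) :
    HasDerivAt (fC hs c) (-((∫ w, deriv (kC hs c) z (w, w) ∂mu hs) * fC hs c z +
      ∫ w, ∫ v, deriv (kC hs c) z (w, v) * frD (mu hs) (kC hs c z) v w ∂mu hs ∂mu hs)) z :=
  hasDerivAt_frF (mu hs) (isOpen_lt continuous_const continuous_re)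
    (fun z (hz : 0 < z.re) => (differentiableAt_kC hs c hz).differentiableWithinAt) hz

lemma differentiableOn_fC : DifferentiableOn ℂ (fC hs c) {z | 0 < z.re} := fun _ hz =>
  (hasDerivAt_fC_aux hs c hz).differentiableAt.differentiableWithinAt

lemma hasDerivAt_fC {τ : ℝ} (hτ : 0 < τ) :
    HasDerivAt (fC hs c) (-((c : ℂ) * (τ : ℂ) ^ (2 * s.re : ℂ)) *
      (fC hs c τ * intC (mu hs) (pC hs τ * qC hs τ) +
        intC (mu hs) (pC hs τ * opK (mu hs) (frDC (mu hs) (kC hs c τ)) (qC hs τ)))) τ := by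
  refine (hasDerivAt_fC_aux hs c (z := τ) (by simpa using hτ)).congr_deriv ?_
  rw [(hasDerivAt_kC hs c hτ).deriv]
  simp only [← frDC_apply]
  set l : ℂ := (c : ℂ) * (τ : ℂ) ^ (2 * s.re : ℂ)
  set P := pC hs τ
  set Q := qC hs τ
  set κ := kC hs c τ
  have h1 : ∫ w, kC' hs c τ (w, w) ∂mu hs = l * intC (mu hs) (P * Q) := by
    rw [intC_apply, ← integral_const_mul]
    congr 1
    ext w
    simp only [kC', ContinuousMap.smul_apply, ContinuousMap.add_apply, tens_apply, smul_eq_mul,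
      ContinuousMap.mul_apply, P, Q, l]
    ring
  have hD : ∀ f g : C(I01, ℂ), ∫ w, ∫ v, f w * g v * frDC (mu hs) κ (v, w) ∂mu hs ∂mu hs =
      intC (mu hs) (f * opK (mu hs) (frDC (mu hs) κ) g) := fun f g => by
    rw [intC_apply]
    congr 1
    ext w
    rw [ContinuousMap.mul_apply, opK_apply, ← integral_const_mul]
    congr 1
    ext v
    rw [frDC_apply, frDC_apply, frD_symm (mu hs) κ (kC_symm hs c τ) v w]
    ring
  have hsymm : intC (mu hs) (Q * opK (mu hs) (frDC (mu hs) κ) P) =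
      intC (mu hs) (P * opK (mu hs) (frDC (mu hs) κ) Q) := by
    have hsy : ∀ u v, frDC (mu hs) κ (u, v) = frDC (mu hs) κ (v, u) :=
      fun u v => frD_symm (mu hs) κ (kC_symm hs c τ) u v
    rw [intC_mul_opK (mu hs) hsy, mul_comm]
  have h2 : ∫ w, ∫ v, kC' hs c τ (w, v) * frDC (mu hs) κ (v, w) ∂mu hs ∂mu hs =
      l * intC (mu hs) (P * opK (mu hs) (frDC (mu hs) κ) Q) := by
    have e : ∀ w v : I01, kC' hs c τ (w, v) * frDC (mu hs) κ (v, w) =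
        l / 2 * (P w * Q v * frDC (mu hs) κ (v, w) + Q w * P v * frDC (mu hs) κ (v, w)) := fun w v => by
      simp only [kC', ContinuousMap.smul_apply, ContinuousMap.add_apply, tens_apply, smul_eq_mul]
      ring
    have c1 : ∀ f g : C(I01, ℂ), Continuous fun p : I01 × I01 => f p.1 * g p.2 *
        frDC (mu hs) κ (p.2, p.1) := fun f g => by fun_prop
    simp only [e, integral_const_mul]
    have e2 : ∀ w : I01, ∫ v, (P w * Q v * frDC (mu hs) κ (v, w) + Q w * P v * frDC (mu hs) κ (v, w)) ∂mu hs =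
        (∫ v, P w * Q v * frDC (mu hs) κ (v, w) ∂mu hs) + ∫ v, Q w * P v * frDC (mu hs) κ (v, w) ∂mu hs :=
      fun w => integral_add
        (integrable_of_continuous_compact ((c1 P Q).comp (f := fun v => (w, v)) (by fun_prop)))
        (integrable_of_continuous_compact ((c1 Q P).comp (f := fun v => (w, v)) (by fun_prop)))
    simp only [e2]
    rw [integral_add
      (integrable_of_continuous_compact (continuous_integral_kernel (mu hs)
        (κ := fun w v => P w * Q v * frDC (mu hs) κ (v, w)) (c1 P Q)))
      (integrable_of_continuous_compact (continuous_integral_kernel (mu hs)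
        (κ := fun w v => Q w * P v * frDC (mu hs) κ (v, w)) (c1 Q P))), hD, hD, hsymm]
    ring
  rw [h1, h2]
  ring

lemma mul_deriv_fC {τ : ℝ} (hτ : 0 < τ) (hF : fC hs c τ ≠ 0) :
    HasDerivAt (fC hs c) (-(τ : ℂ)⁻¹ * vF hs c τ * fC hs c τ) τ := by
  have hτ' : (τ : ℂ) ≠ 0 := ofReal_ne_zero.2 hτ.ne'
  refine (hasDerivAt_fC hs c hτ).congr_deriv ?_
  have h := frF_smul_res (mu hs) (kC_symm hs c τ) hF (qC hs τ)
  have h2 := congrArg (fun g => intC (mu hs) (pC hs τ * g)) h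
  simp only [mul_add, map_add, mul_smul_comm, map_smul, smul_eq_mul, res_qC] at h2
  rw [← fC] at h2
  rw [← h2, vF, ← cpow_two_re hτ]
  field_simp

end

lemma hasDerivAt_integral_moving {b : ℝ → ℝ} {b' T : ℝ} (hb : HasDerivAt b b' T)
    {Φ : ℝ → ℝ → ℂ} (hΦ : ∀ t, Continuous (Φ t))
    (hc : ContinuousAt (fun p : ℝ × ℝ => Φ p.1 p.2) (T, b T)) :
    HasDerivAt (fun t => ∫ w in b T..b t, Φ t w) (b' • Φ T (b T)) T := by
  have h1 : HasDerivAt (fun t => (b t - b T) • Φ T (b T)) (b' • Φ T (b T)) T :=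
    (hb.sub_const _).smul_const _
  have hO : (fun t => b t - b T) =O[nhds T] fun t => t - T := hb.isBigO_sub
  have h2 : HasDerivAt (fun t => (∫ w in b T..b t, Φ t w) - (b t - b T) • Φ T (b T)) 0 T := by
    rw [hasDerivAt_iff_isLittleO]
    simp only [intervalIntegral.integral_same, sub_self, zero_smul, sub_zero, smul_zero]
    refine Asymptotics.IsLittleO.trans_isBigO ?_ hO
    rw [Asymptotics.isLittleO_iff]
    intro ε hε
    obtain ⟨δ, hδ, h⟩ := Metric.continuousAt_iff.1 hc ε hε
    have hb1 : ∀ᶠ t in nhds T, dist (b t) (b T) < δ := hb.continuousAt (Metric.ball_mem_nhds _ hδ)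
    have hb2 : ∀ᶠ t in nhds T, dist t T < δ := Metric.ball_mem_nhds _ hδ
    filter_upwards [hb1, hb2] with t ht1 ht2
    have e : (∫ w in b T..b t, Φ t w) - (b t - b T) • Φ T (b T) =
        ∫ w in b T..b t, (Φ t w - Φ T (b T)) := by
      rw [intervalIntegral.integral_sub ((hΦ t).intervalIntegrable _ _) (by simp),
        intervalIntegral.integral_const]
    rw [e, Real.norm_eq_abs]
    refine intervalIntegral.norm_integral_le_of_norm_le_const fun w hw => ?_
    have hw' : dist w (b T) < δ := by
      refine lt_of_le_of_lt ?_ ht1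
      rw [Real.dist_eq, Real.dist_eq]
      exact abs_sub_left_of_mem_uIcc (uIoc_subset_uIcc hw)
    have := h (x := (t, w)) (by rw [Prod.dist_eq]; exact max_lt ht2 hw')
    rw [← dist_eq_norm]
    exact this.le
  refine (h1.add h2).congr_of_eventuallyEq ?_ |>.congr_deriv (add_zero _)
  exact Eventually.of_forall fun t => by simp

lemma eventually_isUnit_one_sub {R α : Type*} [NormedRing R] [HasSummableGeomSeries R]
    [TopologicalSpace α] {f : α → R} {a : α} (hf : ContinuousAt f a) (hu : IsUnit (1 - f a)) :
    ∀ᶠ x in nhds a, IsUnit (1 - f x) :=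
  (continuousAt_const.sub hf).eventually (Units.isOpen.mem_nhds hu)

section
variable {s : ℂ} (hs : -(1 / 2 : ℝ) < s.re) (c : ℝ)

/-- Extension of a solution of the integral equation on `[0, T]` to the whole line. -/
def extS (f : ℝ → ℂ) (T : ℝ) (y : C(I01, ℂ)) (x : ℝ) : ℂ :=
  f x + ((c / Bs s * T ^ Bs s : ℝ) : ℂ) *
    ∫ v : I01, hker s x ((T : ℂ) * ((v : ℝ) : ℂ)) * y v ∂mu hs

/-- The function `v ↦ hker s x (T v)`. -/
def hkC (p : ℝ × ℝ) : C(I01, ℂ) := ⟨fun v => hker s p.1 ((p.2 : ℂ) * ((v : ℝ) : ℂ)),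
  (continuous_hker hs).comp (f := fun v : I01 => ((p.1 : ℂ), (p.2 : ℂ) * ((v : ℝ) : ℂ))) (by fun_prop)⟩

lemma continuous_hkC : Continuous (hkC hs) :=
  ContinuousMap.continuous_of_continuous_uncurry _
    ((continuous_hker hs).comp (f := fun q : (ℝ × ℝ) × I01 =>
      ((q.1.1 : ℂ), (q.1.2 : ℂ) * ((q.2 : ℝ) : ℂ))) (by fun_prop))

lemma extS_eq (f : ℝ → ℂ) (T : ℝ) (y : C(I01, ℂ)) (x : ℝ) : extS hs c f T y x =
    f x + ((c / Bs s * T ^ Bs s : ℝ) : ℂ) * intC (mu hs) (hkC hs (x, T) * y) := rfl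

lemma continuousAt_extS {f : ℝ → ℂ} (hf : Continuous f) {y : ℝ → C(I01, ℂ)} {T x : ℝ}
    (hy : ContinuousAt y T) (hT : 0 < T) :
    ContinuousAt (fun p : ℝ × ℝ => extS hs c f p.1 (y p.1) p.2) (T, x) := by
  simp only [extS_eq]
  have h1 : ContinuousAt (fun p : ℝ × ℝ => f p.2) (T, x) := by fun_prop
  have h2 : ContinuousAt (fun p : ℝ × ℝ => ((c / Bs s * p.1 ^ Bs s : ℝ) : ℂ)) (T, x) := by
    refine continuous_ofReal.continuousAt.comp (f := fun p : ℝ × ℝ => c / Bs s * p.1 ^ Bs s) ?_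
    exact continuousAt_const.mul (continuousAt_fst.rpow_const (Or.inl hT.ne'))
  have h3 : ContinuousAt (fun p : ℝ × ℝ => hkC hs (p.2, p.1)) (T, x) :=
    ((continuous_hkC hs).comp continuous_swap).continuousAt
  have h4 : ContinuousAt (fun p : ℝ × ℝ => y p.1) (T, x) :=
    ContinuousAt.comp (f := Prod.fst) (g := y) hy continuousAt_fst
  exact h1.add (h2.mul ((intC (mu hs)).continuous.continuousAt.comp (h3.mul h4)))

lemma continuous_extS {f : ℝ → ℂ} (hf : Continuous f) (T : ℝ) (y : C(I01, ℂ)) :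
    Continuous (extS hs c f T y) := by
  have : Continuous fun x : ℝ => hkC hs (x, T) := (continuous_hkC hs).comp (by fun_prop)
  have h2 : Continuous fun x : ℝ => intC (mu hs) (hkC hs (x, T) * y) :=
    (intC (mu hs)).continuous.comp (this.mul continuous_const)
  exact hf.add (h2.const_mul _)

lemma extS_mul {f : ℝ → ℂ} {T : ℝ} (hT : 0 < T) {fT y : C(I01, ℂ)} (hfT : ∀ u : I01, fT u = f (T * u))
    (hy : y = fT + opK (mu hs) (kC hs c T) y) (u : I01) : extS hs c f T y (T * u) = y u := by
  nth_rewrite 2 [hy]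
  rw [ContinuousMap.add_apply, hfT, opK_apply, extS, ← integral_const_mul]
  congr 2
  ext v
  rw [kC_apply, ← ofReal_cpow hT.le]
  push_cast
  ring

lemma two_time {f g : ℝ → ℂ} (hf : Continuous f) (hg : Continuous g) {T₁ T₂ : ℝ} (h₁ : 0 < T₁)
    (h₂ : 0 < T₂) {fT gT y₁ y₂ f₂ g₁ : C(I01, ℂ)} (hfT : ∀ u : I01, fT u = f (T₁ * u))
    (hgT : ∀ u : I01, gT u = g (T₂ * u)) (hf₂ : ∀ u : I01, f₂ u = f (T₂ * u))
    (hg₁ : ∀ u : I01, g₁ u = g (T₁ * u)) (hy₁ : y₁ = fT + opK (mu hs) (kC hs c T₁) y₁)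
    (hy₂ : y₂ = gT + opK (mu hs) (kC hs c T₂) y₂) :
    ((T₂ ^ Bs s : ℝ) : ℂ) * intC (mu hs) (f₂ * y₂) - ((T₁ ^ Bs s : ℝ) : ℂ) * intC (mu hs) (y₁ * g₁) =
      ∫ w in T₁ ^ Bs s..T₂ ^ Bs s, extS hs c f T₁ y₁ (w ^ (1 / Bs s)) *
        extS hs c g T₂ y₂ (w ^ (1 / Bs s)) := by
  have hB := Bs_pos hs
  have cF := continuous_extS hs c hf T₁ y₁
  have cG := continuous_extS hs c hg T₂ y₂
  have hrp : Continuous fun w : ℝ => w ^ (1 / Bs s) :=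
    Real.continuous_rpow_const (by positivity)
  have cI : Continuous fun w : ℝ => extS hs c f T₁ y₁ (w ^ (1 / Bs s)) *
        extS hs c g T₂ y₂ (w ^ (1 / Bs s)) := (cF.comp hrp).mul (cG.comp hrp)
  have e := intervalIntegral.integral_interval_sub_left (cI.intervalIntegrable (μ := volume) 0 (T₂ ^ Bs s))
    (cI.intervalIntegrable 0 (T₁ ^ Bs s))
  rw [← e, ← rpow_smul_integral_muI hB (f := fun x => extS hs c f T₁ y₁ x * extS hs c g T₂ y₂ x)
      (cF.mul cG) h₁, ← rpow_smul_integral_muI hB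
      (f := fun x => extS hs c f T₁ y₁ x * extS hs c g T₂ y₂ x) (cF.mul cG) h₂]
  have hF : ∀ u : I01, extS hs c f T₁ y₁ (T₁ * u) = y₁ u := extS_mul hs c h₁ hfT hy₁
  have hG : ∀ u : I01, extS hs c g T₂ y₂ (T₂ * u) = y₂ u := extS_mul hs c h₂ hgT hy₂
  simp only [hF, hG, real_smul]
  have A : intC (mu hs) (f₂ * y₂) = (∫ u : I01, extS hs c f T₁ y₁ (T₂ * u) * y₂ u ∂mu hs) -
      ((c / Bs s * T₁ ^ Bs s : ℝ) : ℂ) * ∫ u : I01, ∫ v : I01,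
        hker s ((T₂ * u : ℝ) : ℂ) ((T₁ : ℂ) * ((v : ℝ) : ℂ)) * y₁ v * y₂ u ∂mu hs ∂mu hs := by
    rw [← integral_const_mul, ← integral_sub]
    · rw [intC_apply]
      congr 1
      ext u
      rw [ContinuousMap.mul_apply, hf₂, extS, integral_mul_const]
      ring
    · exact integrable_of_continuous_compact (by fun_prop)
    · refine integrable_of_continuous_compact (Continuous.const_mul ?_ _)
      refine continuous_integral_kernel (mu hs) (κ := fun u v : I01 =>
        hker s ((T₂ * u : ℝ) : ℂ) ((T₁ : ℂ) * ((v : ℝ) : ℂ)) * y₁ v * y₂ u) ?_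
      have := (continuous_hker hs).comp (f := fun p : I01 × I01 => (((T₂ * p.1 : ℝ) : ℂ),
        (T₁ : ℂ) * ((p.2 : ℝ) : ℂ))) (by fun_prop)
      simp only [Function.comp_def] at this
      fun_prop
  have A' : intC (mu hs) (y₁ * g₁) = (∫ u : I01, y₁ u * extS hs c g T₂ y₂ (T₁ * u) ∂mu hs) -
      ((c / Bs s * T₂ ^ Bs s : ℝ) : ℂ) * ∫ u : I01, ∫ v : I01,
        hker s ((T₁ * u : ℝ) : ℂ) ((T₂ : ℂ) * ((v : ℝ) : ℂ)) * y₂ v * y₁ u ∂mu hs ∂mu hs := by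
    rw [← integral_const_mul, ← integral_sub]
    · rw [intC_apply]
      congr 1
      ext u
      rw [ContinuousMap.mul_apply, hg₁, extS, integral_mul_const]
      ring
    · exact integrable_of_continuous_compact (by fun_prop)
    · refine integrable_of_continuous_compact (Continuous.const_mul ?_ _)
      refine continuous_integral_kernel (mu hs) (κ := fun u v : I01 =>
        hker s ((T₁ * u : ℝ) : ℂ) ((T₂ : ℂ) * ((v : ℝ) : ℂ)) * y₂ v * y₁ u) ?_
      have := (continuous_hker hs).comp (f := fun p : I01 × I01 => (((T₁ * p.1 : ℝ) : ℂ),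
        (T₂ : ℂ) * ((p.2 : ℝ) : ℂ))) (by fun_prop)
      simp only [Function.comp_def] at this
      fun_prop
  have hsw : ∫ u : I01, ∫ v : I01,
        hker s ((T₁ * u : ℝ) : ℂ) ((T₂ : ℂ) * ((v : ℝ) : ℂ)) * y₂ v * y₁ u ∂mu hs ∂mu hs =
      ∫ u : I01, ∫ v : I01,
        hker s ((T₂ * u : ℝ) : ℂ) ((T₁ : ℂ) * ((v : ℝ) : ℂ)) * y₁ v * y₂ u ∂mu hs ∂mu hs := by
    rw [integral_integral_comm (mu hs) (f := fun u v : I01 =>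
        hker s ((T₁ * u : ℝ) : ℂ) ((T₂ : ℂ) * ((v : ℝ) : ℂ)) * y₂ v * y₁ u)]
    · congr 1
      ext u
      congr 1
      ext v
      rw [hker_symm]
      push_cast
      ring
    · have := (continuous_hker hs).comp (f := fun p : I01 × I01 => (((T₁ * p.1 : ℝ) : ℂ),
        (T₂ : ℂ) * ((p.2 : ℝ) : ℂ))) (by fun_prop)
      simp only [Function.comp_def] at this
      fun_prop
  rw [A, A', hsw, show muI (Bs s) = mu hs from rfl]
  push_cast
  ring

variable {τ : ℝ} (hτ : 0 < τ) (hu : IsUnit (1 - opK (mu hs) (kC hs c τ)))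
include hτ hu

lemma eventually_isUnit : ∀ᶠ t : ℝ in nhds τ, IsUnit (1 - opK (mu hs) (kC hs c t)) := by
  have h1 : ContinuousAt (fun t : ℝ => kC hs c t) τ :=
    ContinuousAt.comp (f := fun t : ℝ => (t : ℂ)) (g := kC hs c)
      (hasDerivAt_kC hs c hτ).continuousAt continuous_ofReal.continuousAt
  exact eventually_isUnit_one_sub (R := C(I01, ℂ) →L[ℂ] C(I01, ℂ)) (f := fun t : ℝ => opK (mu hs) (kC hs c t))
    ((opK (mu hs)).continuous.continuousAt.comp h1) hu

lemma hasDerivAt_pairing {f g : ℝ → ℂ} (hf : Continuous f) (hg : Continuous g)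
    {fC gC : ℝ → C(I01, ℂ)} (hfC : ∀ t (u : I01), fC t u = f (t * u))
    (hgC : ∀ t (u : I01), gC t u = g (t * u))
    (hgc : ContinuousAt (fun t : ℝ => res (mu hs) (kC hs c t) (gC t)) τ) :
    HasDerivAt (fun t : ℝ => c * ((t ^ Bs s : ℝ) : ℂ) *
        intC (mu hs) (fC t * res (mu hs) (kC hs c t) (gC t)))
      (c * Bs s * ((τ ^ (2 * s.re) : ℝ) : ℂ) * (res (mu hs) (kC hs c τ) (fC τ) 1 *
        res (mu hs) (kC hs c τ) (gC τ) 1)) τ := by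
  have hB := Bs_pos hs
  have hrp : Continuous fun w : ℝ => w ^ (1 / Bs s) :=
    Real.continuous_rpow_const (by positivity)
  have hb : HasDerivAt (fun t : ℝ => t ^ Bs s) (Bs s * τ ^ (2 * s.re)) τ :=
    (Real.hasDerivAt_rpow_const (Or.inl hτ.ne')).congr_deriv (by congr 2; unfold Bs; ring)
  set F := extS hs c f τ (res (mu hs) (kC hs c τ) (fC τ)) with hF
  set G : ℝ → ℝ → ℂ := fun t => extS hs c g t (res (mu hs) (kC hs c t) (gC t)) with hG
  have e0 : (τ ^ Bs s) ^ (1 / Bs s) = τ := by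
    rw [← Real.rpow_mul hτ.le, mul_one_div_cancel hB.ne', Real.rpow_one]
  have cF : Continuous F := continuous_extS hs c hf _ _
  have h1 := hasDerivAt_integral_moving hb (Φ := fun t w => F (w ^ (1 / Bs s)) * G t (w ^ (1 / Bs s)))
    (fun t => (cF.comp hrp).mul ((continuous_extS hs c hg _ _).comp hrp)) (by
      refine ContinuousAt.mul ((cF.comp (hrp.comp continuous_snd)).continuousAt) ?_
      have := continuousAt_extS hs c hg (x := (τ ^ Bs s) ^ (1 / Bs s)) hgc hτ
      exact ContinuousAt.comp (f := fun p : ℝ × ℝ => (p.1, p.2 ^ (1 / Bs s)))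
        (g := fun p : ℝ × ℝ => G p.1 p.2) this (by fun_prop))
  have h2 := ((h1.const_mul (c : ℂ)).add_const (c * ((τ ^ Bs s : ℝ) : ℂ) *
        intC (mu hs) (res (mu hs) (kC hs c τ) (fC τ) * gC τ)))
  refine (h2.congr_of_eventuallyEq ?_).congr_deriv ?_
  · filter_upwards [eventually_isUnit hs c hτ hu, Ioi_mem_nhds hτ] with t ht ht0
    have := two_time hs c hf hg hτ ht0 (hfC τ) (hgC t) (hfC t) (hgC τ) (res_eq _ hu (fC τ))
      (res_eq _ ht (gC t))
    rw [← this]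
    ring
  · simp only [e0]
    have eF := extS_mul hs c hτ (hfC τ) (res_eq _ hu (fC τ)) 1
    have eG := extS_mul hs c hτ (hgC τ) (res_eq _ hu (gC τ)) 1
    simp only [Icc.coe_one, mul_one] at eF eG
    rw [hF, hG]
    simp only [eF, eG, real_smul]
    push_cast
    ring

end

open Topology

lemma norm_opK_apply_le {X : Type*} [TopologicalSpace X] [CompactSpace X] [T2Space X]
    [SecondCountableTopology X] [MeasurableSpace X] [BorelSpace X] (μ : Measure X)
    [IsProbabilityMeasure μ] (κ : C(X × X, ℂ)) (f : C(X, ℂ)) : ‖opK μ κ f‖ ≤ ‖κ‖ * ‖f‖ := by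
  rw [ContinuousMap.norm_le _ (by positivity)]
  intro u
  have h : ∀ v, ‖κ (u, v) * f v‖ ≤ ‖κ‖ * ‖f‖ := fun v => by
    rw [norm_mul]
    exact mul_le_mul (κ.norm_coe_le_norm _) (f.norm_coe_le_norm _) (norm_nonneg _) (norm_nonneg _)
  refine (norm_integral_le_of_norm_le_const (μ := μ) (Eventually.of_forall h)).trans ?_
  simp

lemma norm_intC_le {X : Type*} [TopologicalSpace X] [CompactSpace X] [T2Space X]
    [SecondCountableTopology X] [MeasurableSpace X] [BorelSpace X] (μ : Measure X)
    [IsProbabilityMeasure μ] (f : C(X, ℂ)) : ‖intC μ f‖ ≤ ‖f‖ := by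
  refine (norm_integral_le_of_norm_le_const (μ := μ)
    (Eventually.of_forall fun x => f.norm_coe_le_norm x)).trans ?_
  simp

lemma eq_zero_of_hasDerivAt_zero_of_tendsto {f : ℝ → ℂ} (hf : ∀ t, 0 < t → HasDerivAt f 0 t)
    (h0 : Tendsto f (𝓝[>] 0) (𝓝 0)) {t : ℝ} (ht : 0 < t) : f t = 0 := by
  have h : ∀ x ∈ Ioi (0 : ℝ), f x = f t := fun x hx =>
    isOpen_Ioi.is_const_of_deriv_eq_zero (isPreconnected_Ioi)
      (fun y hy => (hf y hy).differentiableAt.differentiableWithinAt)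
      (fun y hy => (hf y hy).deriv) hx ht
  have h1 : Tendsto f (𝓝[>] 0) (𝓝 (f t)) :=
    tendsto_const_nhds.congr' (eventually_nhdsWithin_of_forall fun x hx => (h x hx).symm)
  exact tendsto_nhds_unique h1 h0

section
variable {s : ℂ} (hs : -(1 / 2 : ℝ) < s.re) (c : ℝ)

lemma tendsto_kC_zero : Tendsto (fun t : ℝ => kC hs c t) (𝓝[>] 0) (𝓝 0) := by
  have h1 : Tendsto (fun t : ℝ => hC hs t) (𝓝[>] 0) (𝓝 (hC hs (0 : ℝ))) :=
    (((continuous_hC hs).comp continuous_ofReal).tendsto 0).mono_left nhdsWithin_le_nhds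
  have h2 : Tendsto (fun t : ℝ => ((c / Bs s * t ^ Bs s : ℝ) : ℂ)) (𝓝[>] 0) (𝓝 ((0 : ℝ) : ℂ)) := by
    refine (continuous_ofReal.tendsto _).comp ?_
    have : Continuous fun t : ℝ => c / Bs s * t ^ Bs s :=
      (Real.continuous_rpow_const (Bs_pos hs).le).const_mul _
    have h := this.tendsto 0
    rw [Real.zero_rpow (Bs_pos hs).ne', mul_zero] at h
    exact h.mono_left nhdsWithin_le_nhds
  have h3 := h2.smul h1
  have e : ((0 : ℝ) : ℂ) • hC hs ((0 : ℝ) : ℂ) = 0 := by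
    ext p
    simp
  rw [e] at h3
  refine h3.congr' (eventually_nhdsWithin_of_forall fun t (ht : 0 < t) => ?_)
  have e : kC hs c t = (((c / Bs s : ℝ) : ℂ) * (t : ℂ) ^ (Bs s : ℂ)) • hC hs t := rfl
  simp only [e, ofReal_mul, ofReal_cpow ht.le]

lemma tendsto_fC_zero : Tendsto (fun t : ℝ => fC hs c t) (𝓝[>] 0) (𝓝 1) := by
  have h := tendsto_kC_zero hs c
  have hn : Tendsto (fun t : ℝ => ‖kC hs c t‖) (𝓝[>] 0) (𝓝 0) := by
    simpa using h.norm
  have h1 : ∀ᶠ t : ℝ in 𝓝[>] 0, ‖kC hs c t‖ ≤ 1 := hn.eventually (Iic_mem_nhds one_pos)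
  rw [tendsto_iff_norm_sub_tendsto_zero]
  refine squeeze_zero' (Eventually.of_forall fun _ => norm_nonneg _)
    (h1.mono fun t ht => norm_frF_sub_one_le (mu hs) (kC hs c t) le_rfl ht) ?_
  simpa using hn.mul_const (∑' n, gB 1 (n + 1))

variable (hU : ∀ t : ℝ, 0 < t → IsUnit (1 - opK (mu hs) (kC hs c t)))
include hU

lemma eventually_norm_res_le : ∀ᶠ t : ℝ in 𝓝[>] 0, ∀ f : C(I01, ℂ),
    ‖res (mu hs) (kC hs c t) f‖ ≤ 2 * ‖f‖ := by
  have hn : Tendsto (fun t : ℝ => ‖kC hs c t‖) (𝓝[>] 0) (𝓝 0) := by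
    simpa using (tendsto_kC_zero hs c).norm
  have h1 : ∀ᶠ t : ℝ in 𝓝[>] 0, ‖kC hs c t‖ ≤ 1 / 2 := hn.eventually (Iic_mem_nhds (by norm_num))
  filter_upwards [h1, self_mem_nhdsWithin] with t ht ht0 f
  have h2 := res_eq _ (hU t ht0) f
  set y := res (mu hs) (kC hs c t) f
  have h3 : ‖y‖ ≤ ‖f‖ + ‖opK (mu hs) (kC hs c t) y‖ := by
    nth_rewrite 1 [h2]
    exact norm_add_le _ _
  have h4 := norm_opK_apply_le (mu hs) (kC hs c t) y
  have h5 : ‖kC hs c t‖ * ‖y‖ ≤ 1 / 2 * ‖y‖ := by gcongr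
  linarith

omit hU in
lemma isBigO_pC : (fun t : ℝ => pC hs t) =O[𝓝[>] 0] fun _ => (1 : ℝ) :=
  ((((continuous_pC hs).comp continuous_ofReal).tendsto 0).mono_left nhdsWithin_le_nhds).isBigO_one ℝ

omit hU in
lemma isBigO_qC : (fun t : ℝ => qC hs t) =O[𝓝[>] 0] fun _ => (1 : ℝ) :=
  ((((continuous_qC hs).comp continuous_ofReal).tendsto 0).mono_left nhdsWithin_le_nhds).isBigO_one ℝ

omit hU in
lemma isBigO_qC_sub_pC : (fun t : ℝ => qC hs t - pC hs t) =O[𝓝[>] 0] fun t => t := by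
  have h : DifferentiableAt ℂ (fun z : ℂ => qC hs z - pC hs z) ((0 : ℝ) : ℂ) :=
    (differentiable_qC hs _).sub (differentiable_pC hs _)
  have h2 := h.hasDerivAt.isBigO_sub.comp_tendsto (continuous_ofReal.tendsto 0)
  have e : qC hs ((0 : ℝ) : ℂ) - pC hs ((0 : ℝ) : ℂ) = 0 := by
    ext u
    simp [qC, pC, pf_zero hs, pg_zero hs]
  have h3 := h2.mono (nhdsWithin_le_nhds (s := Ioi 0))
  refine (h3.congr_left fun t => ?_).trans
    (Asymptotics.isBigO_of_le (g := fun t : ℝ => t) _ fun t => by simp)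
  simp only [Function.comp_def, e, sub_zero]

lemma isBigO_res {f : ℝ → C(I01, ℂ)} {g : ℝ → ℝ} (hf : f =O[𝓝[>] 0] g) :
    (fun t : ℝ => res (mu hs) (kC hs c t) (f t)) =O[𝓝[>] 0] g :=
  (Asymptotics.IsBigO.of_bound 2 ((eventually_norm_res_le hs c hU).mono fun t ht => ht (f t))).trans hf

omit hU in
lemma isBigO_eval {f : ℝ → C(I01, ℂ)} {g : ℝ → ℝ} (hf : f =O[𝓝[>] 0] g) (u : I01) :
    (fun t : ℝ => f t u) =O[𝓝[>] 0] g :=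
  (Asymptotics.isBigO_of_le _ fun t => (f t).norm_coe_le_norm u).trans hf

omit hU in
lemma isBigO_pairing {f₁ f₂ : ℝ → C(I01, ℂ)} {g₁ g₂ : ℝ → ℝ} (h₁ : f₁ =O[𝓝[>] 0] g₁)
    (h₂ : f₂ =O[𝓝[>] 0] g₂) :
    (fun t : ℝ => c * ((t ^ Bs s : ℝ) : ℂ) * intC (mu hs) (f₁ t * f₂ t)) =O[𝓝[>] 0]
      fun t => t ^ Bs s * (g₁ t * g₂ t) := by
  have h3 : (fun t : ℝ => intC (mu hs) (f₁ t * f₂ t)) =O[𝓝[>] 0] fun t => g₁ t * g₂ t :=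
    (Asymptotics.isBigO_of_le _ fun t => norm_intC_le (mu hs) (f₁ t * f₂ t)).trans (h₁.mul h₂)
  have h4 : (fun t : ℝ => (c : ℂ) * ((t ^ Bs s : ℝ) : ℂ)) =O[𝓝[>] 0] fun t => t ^ Bs s :=
    Asymptotics.IsBigO.const_mul_left (Asymptotics.isBigO_of_le _ fun t => by simp) _
  exact h4.mul h3

lemma isBigO_yC : (fun t : ℝ => yC hs c t) =O[𝓝[>] 0] fun _ => (1 : ℝ) :=
  isBigO_res hs c hU (isBigO_pC hs)

lemma isBigO_zC : (fun t : ℝ => zC hs c t) =O[𝓝[>] 0] fun _ => (1 : ℝ) :=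
  isBigO_res hs c hU (isBigO_qC hs)

lemma isBigO_zC_sub_yC : (fun t : ℝ => zC hs c t - yC hs c t) =O[𝓝[>] 0] fun t => t := by
  simpa only [map_sub, res_pC, res_qC] using isBigO_res hs c hU (isBigO_qC_sub_pC hs)

lemma isBigO_uF : uF hs c =O[𝓝[>] 0] fun t => t ^ Bs s := by
  have h := isBigO_pairing hs c (isBigO_pC hs) (isBigO_yC hs c hU)
  simp only [mul_one] at h
  exact h

lemma isBigO_vF : vF hs c =O[𝓝[>] 0] fun t => t ^ Bs s := by
  have h := isBigO_pairing hs c (isBigO_pC hs) (isBigO_zC hs c hU)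
  simp only [mul_one] at h
  exact h

lemma isBigO_wF : wF hs c =O[𝓝[>] 0] fun t => t ^ Bs s := by
  have h := isBigO_pairing hs c (isBigO_qC hs) (isBigO_zC hs c hU)
  simp only [mul_one] at h
  exact h

lemma isBigO_wF_sub_uF : (fun t => wF hs c t - uF hs c t) =O[𝓝[>] 0] fun t => t ^ Bs s * t := by
  have h1 := isBigO_pairing hs c (isBigO_qC_sub_pC hs) (isBigO_zC hs c hU)
  have h2 := isBigO_pairing hs c (isBigO_pC hs) (isBigO_zC_sub_yC hs c hU)
  simp only [mul_one, one_mul] at h1 h2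
  refine (h1.add h2).congr_left fun t => ?_
  simp only [wF, uF, sub_mul, mul_sub, map_sub]
  ring

end

section
variable {s : ℂ} (hs : -(1 / 2 : ℝ) < s.re) (c : ℝ)

section deriv
variable {τ : ℝ} (hτ : 0 < τ) (hu : IsUnit (1 - opK (mu hs) (kC hs c τ)))
include hτ hu

lemma hasDerivAt_uF : HasDerivAt (uF hs c)
    (c * Bs s * ((τ ^ (2 * s.re) : ℝ) : ℂ) * (yC hs c τ 1 * yC hs c τ 1)) τ :=
  hasDerivAt_pairing hs c hτ hu (f := fun x : ℝ => pf s x) (g := fun x : ℝ => pf s x)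
    ((continuous_pf hs).comp continuous_ofReal) ((continuous_pf hs).comp continuous_ofReal)
    (fC := fun t : ℝ => pC hs t) (gC := fun t : ℝ => pC hs t)
    (fun t u => by simp [pC]) (fun t u => by simp [pC])
    ((hasDerivAt_yC hs c hτ hu).continuousAt.comp continuous_ofReal.continuousAt)

lemma hasDerivAt_vF : HasDerivAt (vF hs c)
    (c * Bs s * ((τ ^ (2 * s.re) : ℝ) : ℂ) * (yC hs c τ 1 * zC hs c τ 1)) τ :=
  hasDerivAt_pairing hs c hτ hu (f := fun x : ℝ => pf s x) (g := fun x : ℝ => pg s x)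
    ((continuous_pf hs).comp continuous_ofReal) ((continuous_pg hs).comp continuous_ofReal)
    (fC := fun t : ℝ => pC hs t) (gC := fun t : ℝ => qC hs t)
    (fun t u => by simp [pC]) (fun t u => by simp [qC])
    ((hasDerivAt_zC hs c hτ hu).continuousAt.comp continuous_ofReal.continuousAt)

lemma hasDerivAt_wF : HasDerivAt (wF hs c)
    (c * Bs s * ((τ ^ (2 * s.re) : ℝ) : ℂ) * (zC hs c τ 1 * zC hs c τ 1)) τ :=
  hasDerivAt_pairing hs c hτ hu (f := fun x : ℝ => pg s x) (g := fun x : ℝ => pg s x)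
    ((continuous_pg hs).comp continuous_ofReal) ((continuous_pg hs).comp continuous_ofReal)
    (fC := fun t : ℝ => qC hs t) (gC := fun t : ℝ => qC hs t)
    (fun t u => by simp [qC]) (fun t u => by simp [qC])
    ((hasDerivAt_zC hs c hτ hu).continuousAt.comp continuous_ofReal.continuousAt)

end deriv

/-- The weight `c B t^{2 Re s}`. -/
def wt (s : ℂ) (c t : ℝ) : ℂ := c * Bs s * ((t ^ (2 * s.re) : ℝ) : ℂ)

/-- The derivative of `-vF`. -/
def th1 (t : ℝ) : ℂ := -(wt s c t * (yC hs c t 1 * zC hs c t 1))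

def sz (t : ℝ) : ℂ := wt s c t * ((s + uF hs c t) * (zC hs c t 1) ^ 2)

def sy (t : ℝ) : ℂ := wt s c t * (((starRingEnd ℂ) s + wF hs c t) * (yC hs c t 1) ^ 2)

/-- The second derivative of `-vF`. -/
def th2 (t : ℝ) : ℂ := -((t : ℂ)⁻¹ * (sz hs c t + sy hs c t))

lemma hasDerivAt_wt {t : ℝ} (ht : 0 < t) :
    HasDerivAt (wt s c) ((t : ℂ)⁻¹ * ((s + (starRingEnd ℂ) s) * wt s c t)) t := by
  have h := ((Real.hasDerivAt_rpow_const (p := 2 * s.re) (Or.inl ht.ne')).ofReal_comp).const_mul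
    ((c : ℂ) * Bs s)
  refine h.congr_deriv ?_
  have ht' : (t : ℂ) ≠ 0 := ofReal_ne_zero.2 ht.ne'
  rw [Real.rpow_sub_one ht.ne', Complex.add_conj, wt]
  push_cast
  field_simp

section integrals
variable {t : ℝ} (ht : 0 < t) (hu : IsUnit (1 - opK (mu hs) (kC hs c t)))
include ht hu

lemma hasDerivAt_neg_vF : HasDerivAt (fun t => -vF hs c t) (th1 hs c t) t :=
  (hasDerivAt_vF hs c ht hu).neg

lemma hasDerivAt_th1 : HasDerivAt (th1 hs c) (th2 hs c t) t := by
  have ht' : (t : ℂ) ≠ 0 := ofReal_ne_zero.2 ht.ne'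
  refine ((hasDerivAt_wt c ht).mul ((hasDerivAt_yC_one hs c ht hu).mul
    (hasDerivAt_zC_one hs c ht hu))).neg.congr_deriv ?_
  simp only [th2, sz, sy, Pi.mul_apply]
  ring

lemma hasDerivAt_sz : HasDerivAt (sz hs c) ((t : ℂ)⁻¹ * (s - (starRingEnd ℂ) s + 2 * I * t) *
    sz hs c t + wt s c t * (wt s c t * (yC hs c t 1 * yC hs c t 1)) * zC hs c t 1 ^ 2 +
    2 * (t : ℂ)⁻¹ * wt s c t * (s + uF hs c t) * ((starRingEnd ℂ) s + wF hs c t) *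
      yC hs c t 1 * zC hs c t 1) t := by
  refine ((hasDerivAt_wt c ht).mul (((hasDerivAt_uF hs c ht hu).const_add s).mul
    ((hasDerivAt_zC_one hs c ht hu).pow 2))).congr_deriv ?_
  simp only [sz, Pi.mul_apply, Pi.pow_apply, wt]
  push_cast
  ring

lemma hasDerivAt_sy : HasDerivAt (sy hs c) (-(t : ℂ)⁻¹ * (s - (starRingEnd ℂ) s + 2 * I * t) *
    sy hs c t + wt s c t * (wt s c t * (yC hs c t 1 * yC hs c t 1)) * zC hs c t 1 ^ 2 +
    2 * (t : ℂ)⁻¹ * wt s c t * (s + uF hs c t) * ((starRingEnd ℂ) s + wF hs c t) *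
      yC hs c t 1 * zC hs c t 1) t := by
  refine ((hasDerivAt_wt c ht).mul (((hasDerivAt_wF hs c ht hu).const_add _).mul
    ((hasDerivAt_yC_one hs c ht hu).pow 2))).congr_deriv ?_
  simp only [sy, Pi.mul_apply, Pi.pow_apply, wt]
  push_cast
  ring

end integrals

variable (hU : ∀ t : ℝ, 0 < t → IsUnit (1 - opK (mu hs) (kC hs c t)))

lemma isBigO_wt_mul : (fun t : ℝ => wt s c t * t) =O[𝓝[>] 0] fun t => t ^ Bs s := by
  refine Asymptotics.IsBigO.of_bound (‖(c : ℂ) * Bs s‖)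
    (eventually_nhdsWithin_of_forall fun t (ht : 0 < t) => ?_)
  have e : wt s c t * t = c * Bs s * ((t ^ (2 * s.re) * t : ℝ) : ℂ) := by
    rw [wt]
    push_cast
    ring
  rw [e, norm_mul, ← Real.rpow_add_one ht.ne', norm_real]
  rfl

include hs in
lemma tendsto_rpow_Bs : Tendsto (fun t : ℝ => t ^ Bs s) (𝓝[>] 0) (𝓝 0) := by
  have h := (Real.continuous_rpow_const (Bs_pos hs).le).tendsto 0
  rw [Real.zero_rpow (Bs_pos hs).ne'] at h
  exact h.mono_left nhdsWithin_le_nhds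

include hU

lemma tendsto_uF : Tendsto (uF hs c) (𝓝[>] 0) (𝓝 0) :=
  (isBigO_uF hs c hU).trans_tendsto (tendsto_rpow_Bs hs)

lemma tendsto_vF : Tendsto (vF hs c) (𝓝[>] 0) (𝓝 0) :=
  (isBigO_vF hs c hU).trans_tendsto (tendsto_rpow_Bs hs)

lemma tendsto_wF : Tendsto (wF hs c) (𝓝[>] 0) (𝓝 0) :=
  (isBigO_wF hs c hU).trans_tendsto (tendsto_rpow_Bs hs)

lemma isBigO_yC_one : (fun t : ℝ => yC hs c t 1) =O[𝓝[>] 0] fun _ => (1 : ℝ) :=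
  isBigO_eval (isBigO_yC hs c hU) 1

lemma isBigO_zC_one : (fun t : ℝ => zC hs c t 1) =O[𝓝[>] 0] fun _ => (1 : ℝ) :=
  isBigO_eval (isBigO_zC hs c hU) 1

lemma isBigO_zC_sub_yC_one :
    (fun t : ℝ => zC hs c t 1 - yC hs c t 1) =O[𝓝[>] 0] fun t => t :=
  isBigO_eval (isBigO_zC_sub_yC hs c hU) 1

lemma tendsto_mul_th1 : Tendsto (fun t : ℝ => t * th1 hs c t) (𝓝[>] 0) (𝓝 0) := by
  have h := (isBigO_wt_mul (s := s) c).mul ((isBigO_yC_one hs c hU).mul (isBigO_zC_one hs c hU))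
  simp only [mul_one] at h
  have h2 := (h.trans_tendsto (tendsto_rpow_Bs hs)).neg
  rw [neg_zero] at h2
  refine h2.congr fun t => ?_
  rw [th1]
  ring

lemma first_integral {t : ℝ} (ht : 0 < t) :
    (s + uF hs c t) * ((starRingEnd ℂ) s + wF hs c t) =
      s * (starRingEnd ℂ) s - t * th1 hs c t - vF hs c t := by
  have h := eq_zero_of_hasDerivAt_zero_of_tendsto (f := fun t : ℝ =>
    (s + uF hs c t) * ((starRingEnd ℂ) s + wF hs c t) -
      (s * (starRingEnd ℂ) s - t * th1 hs c t - vF hs c t)) (fun t ht => ?_) ?_ ht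
  · exact sub_eq_zero.1 h
  · have ht' : (t : ℂ) ≠ 0 := ofReal_ne_zero.2 ht.ne'
    refine ((((hasDerivAt_uF hs c ht (hU t ht)).const_add s).mul
      ((hasDerivAt_wF hs c ht (hU t ht)).const_add _)).sub
      (((((hasDerivAt_id t).ofReal_comp).mul (hasDerivAt_th1 hs c ht (hU t ht))).const_sub _).sub
        (hasDerivAt_vF hs c ht (hU t ht)))).congr_deriv ?_
    simp only [th2, th1, sz, sy, wt, id, ofReal_one]
    field_simp
    ring
  · have h1 := ((((tendsto_uF hs c hU).const_add s).mul
      ((tendsto_wF hs c hU).const_add ((starRingEnd ℂ) s))).sub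
      (((tendsto_mul_th1 hs c hU).const_sub (s * (starRingEnd ℂ) s)).sub (tendsto_vF hs c hU)))
    simpa using h1

lemma second_integral {t : ℝ} (ht : 0 < t) :
    sz hs c t - sy hs c t =
      -((s - (starRingEnd ℂ) s + 2 * I * t) * th1 hs c t + 2 * I * vF hs c t) := by
  have h := eq_zero_of_hasDerivAt_zero_of_tendsto (f := fun t : ℝ =>
    sz hs c t - sy hs c t + ((s - (starRingEnd ℂ) s + 2 * I * t) * th1 hs c t +
      2 * I * vF hs c t)) (fun t ht => ?_) ?_ ht
  · exact eq_neg_of_add_eq_zero_left h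
  · have ht' : (t : ℂ) ≠ 0 := ofReal_ne_zero.2 ht.ne'
    refine (((hasDerivAt_sz hs c ht (hU t ht)).sub (hasDerivAt_sy hs c ht (hU t ht))).add
      ((((((hasDerivAt_id t).ofReal_comp).const_mul (2 * I)).const_add
        (s - (starRingEnd ℂ) s)).mul (hasDerivAt_th1 hs c ht (hU t ht))).add
        ((hasDerivAt_vF hs c ht (hU t ht)).const_mul (2 * I)))).congr_deriv ?_
    simp only [th2, th1, sz, sy, wt, id, ofReal_one]
    field_simp
    ring
  · have h0 := tendsto_rpow_Bs hs
    have bw := isBigO_wt_mul (s := s) c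
    have by1 := isBigO_yC_one hs c hU
    have bz1 := isBigO_zC_one hs c hU
    have bd := isBigO_zC_sub_yC_one hs c hU
    have bid : (fun t : ℝ => t) =O[𝓝[>] 0] fun t : ℝ => (t : ℂ) :=
      Asymptotics.isBigO_of_le _ fun t => by simp
    have one_of : ∀ {f : ℝ → ℂ}, Tendsto f (𝓝[>] 0) (𝓝 0) → f =O[𝓝[>] 0] fun _ => (1 : ℝ) :=
      fun hf => hf.isBigO_one ℝ
    have hdu : (fun t : ℝ => wF hs c t - uF hs c t) =O[𝓝[>] 0] fun t : ℝ => (t : ℂ) := by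
      have h := (isBigO_wF_sub_uF hs c hU).trans
        ((h0.isBigO_one ℝ).mul (Asymptotics.isBigO_refl (fun t : ℝ => t) _))
      simp only [one_mul] at h
      exact h.trans bid
    have bA : (fun t : ℝ => s * zC hs c t 1 + (starRingEnd ℂ) s * yC hs c t 1 +
          uF hs c t * (zC hs c t 1 + yC hs c t 1)) =O[𝓝[>] 0] fun _ => (1 : ℝ) := by
      have h := (one_of (tendsto_uF hs c hU)).mul (bz1.add by1)
      simp only [mul_one] at h
      exact ((bz1.const_mul_left s).add (by1.const_mul_left _)).add h
    have b1 : (fun t : ℝ => wt s c t * (zC hs c t 1 - yC hs c t 1) *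
        (s * zC hs c t 1 + (starRingEnd ℂ) s * yC hs c t 1 +
          uF hs c t * (zC hs c t 1 + yC hs c t 1))) =O[𝓝[>] 0] fun t => t ^ Bs s := by
      have h := ((((Asymptotics.isBigO_refl (wt s c) _).mul (bd.trans bid)).trans bw).mul bA)
      simpa only [mul_one] using h
    have b2 : (fun t : ℝ => wt s c t * (wF hs c t - uF hs c t) * yC hs c t 1 ^ 2)
        =O[𝓝[>] 0] fun t => t ^ Bs s := by
      have h := ((((Asymptotics.isBigO_refl (wt s c) _).mul hdu).trans bw).mul (by1.pow 2))
      simpa only [mul_one, one_pow] using h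
    have h1 := ((b1.trans_tendsto h0).sub (b2.trans_tendsto h0)).add
      (((tendsto_mul_th1 hs c hU).add (tendsto_vF hs c hU)).const_mul (2 * I))
    simp only [add_zero, mul_zero, sub_zero] at h1
    refine h1.congr fun t => ?_
    simp only [th1, sz, sy]
    ring

/-- The sigma form of Painlevé V for `-vF`. -/
lemma sigma_form {t : ℝ} (ht : 0 < t) :
    -(t : ℂ) ^ 2 * th2 hs c t ^ 2 =
      (2 * (t * th1 hs c t + vF hs c t) + th1 hs c t ^ 2 +
        I * ((starRingEnd ℂ) s - s) * th1 hs c t) ^ 2 -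
      th1 hs c t ^ 2 * (th1 hs c t - 2 * I * s) * (th1 hs c t + 2 * I * (starRingEnd ℂ) s) := by
  have ht' : (t : ℂ) ≠ 0 := ofReal_ne_zero.2 ht.ne'
  have h1 := first_integral hs c hU ht
  have h2 := second_integral hs c hU ht
  have h3 : sz hs c t * sy hs c t =
      (s + uF hs c t) * ((starRingEnd ℂ) s + wF hs c t) * th1 hs c t ^ 2 := by
    simp only [sz, sy, th1]
    ring
  have h4 : (t : ℂ) * th2 hs c t = -(sz hs c t + sy hs c t) := by
    rw [th2]
    field_simp
  rw [h1] at h3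
  have h5 : -(t : ℂ) ^ 2 * th2 hs c t ^ 2 = -((sz hs c t - sy hs c t) ^ 2 +
      4 * (sz hs c t * sy hs c t)) := by
    linear_combination (-(t * th2 hs c t) + (sz hs c t + sy hs c t)) * h4
  rw [h5, h2, h3]
  ring_nf
  simp only [I_sq]
  ring

end

lemma oneF1_lower {q : ℂ} (hq : ∀ n : ℕ, q + n ≠ 0) (r z : ℂ) :
    oneF1 r q z = oneF1 r (q + 1) z + z * (r / (q * (q + 1))) * oneF1 (r + 1) (q + 2) z := by
  have hq1 := add_one_ne hq
  have hq2 : ∀ n : ℕ, q + 2 + n ≠ 0 := fun n => by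
    have := add_one_ne hq1 n
    rwa [add_assoc q, one_add_one_eq_two] at this
  have h1 := hasSum_oneF1 hq1 r z
  have h2 := (hasSum_oneF1 hq2 (r + 1) z).mul_left (z * (r / (q * (q + 1))))
  have h3 : HasSum (fun n : ℕ => (kcoef r q n - kcoef r (q + 1) n) * z ^ n)
      (z * (r / (q * (q + 1))) * oneF1 (r + 1) (q + 2) z) := by
    rw [← hasSum_nat_add_iff' 1]
    simp only [Finset.range_one, Finset.sum_singleton, pow_zero, mul_one]
    have e0 : kcoef r q 0 - kcoef r (q + 1) 0 = 0 := by simp [kcoef, poch_zero]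
    rw [e0, sub_zero]
    refine hasSum_of_eq h2 fun n => ?_
    have a0 : q ≠ 0 := by simpa using hq 0
    have a1 : q + 1 ≠ 0 := by simpa using hq 1
    have a2 : q + 1 + n ≠ 0 := hq1 n
    have a3 := poch_ne_zero hq2 n
    have a4 : ((n + 1 : ℕ).factorial : ℂ) ≠ 0 := by exact_mod_cast (n + 1).factorial_ne_zero
    have a5 : (n.factorial : ℂ) ≠ 0 := by exact_mod_cast n.factorial_ne_zero
    have a6 : (n : ℂ) + 1 ≠ 0 := by exact_mod_cast n.succ_ne_zero
    have b1 : poch q (n + 1) * (q + 1 + n) = q * ((q + 1) * poch (q + 2) n) := by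
      have : poch q (n + 2) = poch q (n + 1) * (q + (n + 1 : ℕ)) := poch_succ q (n + 1)
      rw [poch_succ', poch_succ', add_assoc q 1 1, one_add_one_eq_two] at this
      rw [this]
      push_cast
      ring
    have b2 : poch (q + 1) (n + 1) = (q + 1) * poch (q + 2) n := by
      rw [poch_succ', add_assoc q 1 1, one_add_one_eq_two]
    have b3 : poch q (n + 1) = q * ((q + 1) * poch (q + 2) n) / (q + 1 + n) := by
      rw [← b1]
      field_simp
    simp only [kcoef]
    rw [b3, b2, poch_succ' r, Nat.factorial_succ]
    push_cast
    field_simp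
    ring
  refine (hasSum_oneF1 hq r z).unique (hasSum_of_eq (h1.add h3) fun n => ?_)
  ring

lemma Gamma_add_nat {r : ℂ} (hr : 0 < r.re) (n : ℕ) :
    Complex.Gamma (r + n) = poch r n * Complex.Gamma r := by
  induction n with
  | zero => simp [poch_zero]
  | succ n ih =>
    have h : r + n ≠ 0 := fun h => by
      have := congrArg Complex.re h
      simp at this
      have : (0 : ℝ) ≤ n := n.cast_nonneg
      linarith
    rw [Nat.cast_succ, ← add_assoc, Complex.Gamma_add_one _ h, ih, poch_succ]
    ring

lemma add_nat_ne_zero {q : ℂ} (hq : 0 < q.re) (n : ℕ) : q + n ≠ 0 := fun h => by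
  have := congrArg Complex.re h
  simp at this
  have : (0 : ℝ) ≤ n := n.cast_nonneg
  linarith

/-- Euler's integral. -/
lemma oneF1_eq_integral {r q : ℂ} (hr : 0 < r.re) (hq : r.re < q.re) (z : ℂ) :
    Complex.Gamma r * Complex.Gamma (q - r) / Complex.Gamma q * oneF1 r q z =
      ∫ t in Ioc (0 : ℝ) 1, Complex.exp (z * t) * ((t : ℂ) ^ (r - 1) * (1 - (t : ℂ)) ^ (q - r - 1)) := by
  have hqr : 0 < (q - r).re := by simpa using hq
  have hq0 : 0 < q.re := hr.trans hq
  set b : ℝ → ℂ := fun t => (t : ℂ) ^ (r - 1) * (1 - (t : ℂ)) ^ (q - r - 1) with hb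
  have hbi : IntegrableOn b (Ioc 0 1) volume :=
    (intervalIntegrable_iff_integrableOn_Ioc_of_le zero_le_one).1
      (Complex.betaIntegral_convergent hr hqr)
  set F : ℕ → ℝ → ℂ := fun n t => (z * t) ^ n / (n.factorial : ℂ) * b t with hF
  have hFm : ∀ n, Integrable (F n) (volume.restrict (Ioc 0 1)) := fun n => by
    refine (hbi.norm.const_mul (‖z‖ ^ n / n.factorial)).mono ?_ ?_
    · exact (by fun_prop : Continuous fun t : ℝ => (z * t) ^ n / (n.factorial : ℂ)).aestronglyMeasurable.mul
        hbi.aestronglyMeasurable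
    · refine (ae_restrict_mem measurableSet_Ioc).mono fun t ht => ?_
      have h1 : |t| ≤ 1 := abs_le.2 ⟨by linarith [ht.1], ht.2⟩
      have h2 : ‖(z * t) ^ n / (n.factorial : ℂ)‖ ≤ ‖‖z‖ ^ n / (n.factorial : ℝ)‖ := by
        rw [norm_div, norm_pow, norm_mul, norm_div, norm_pow, norm_norm, Complex.norm_natCast,
          norm_real, Real.norm_eq_abs, Real.norm_eq_abs, Nat.abs_cast]
        gcongr
        exact mul_le_of_le_one_right (norm_nonneg _) h1
      calc ‖F n t‖ = ‖(z * t) ^ n / (n.factorial : ℂ)‖ * ‖b t‖ := norm_mul _ _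
        _ ≤ ‖‖z‖ ^ n / (n.factorial : ℝ)‖ * ‖b t‖ := by gcongr
        _ = _ := by rw [norm_mul _ ‖b t‖, norm_norm]
  have hFn : ∀ n, ∫ t in Ioc (0 : ℝ) 1, ‖F n t‖ ≤
      ‖z‖ ^ n / n.factorial * ∫ t in Ioc (0 : ℝ) 1, ‖b t‖ := fun n => by
    rw [← integral_const_mul]
    refine setIntegral_mono_on (hFm n).norm (hbi.norm.const_mul _) measurableSet_Ioc fun t ht => ?_
    have h1 : |t| ≤ 1 := abs_le.2 ⟨by linarith [ht.1], ht.2⟩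
    simp only [hF, norm_mul, norm_div, norm_pow, Complex.norm_natCast, norm_real,
        Real.norm_eq_abs]
    gcongr
    exact mul_le_of_le_one_right (norm_nonneg _) h1
  have hs : Summable fun n => ∫ t in Ioc (0 : ℝ) 1, ‖F n t‖ :=
    Summable.of_nonneg_of_le (fun n => integral_nonneg fun t => norm_nonneg _) hFn
      ((Real.summable_pow_div_factorial ‖z‖).mul_right _)
  have key := hasSum_integral_of_summable_integral_norm hFm hs
  have e1 : ∀ t : ℝ, ∑' n, F n t = Complex.exp (z * t) * b t := fun t => by
    rw [tsum_mul_right, Complex.exp_eq_exp_ℂ, NormedSpace.exp_eq_tsum_div]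
  simp only [e1] at key
  have hGq := Complex.Gamma_ne_zero_of_re_pos hq0
  have e2 : ∀ n, ∫ t in Ioc (0 : ℝ) 1, F n t =
      Complex.Gamma r * Complex.Gamma (q - r) / Complex.Gamma q * (kcoef r q n * z ^ n) := fun n => by
    have hrn : 0 < (r + n).re := by simp; positivity
    have h1 := Complex.Gamma_mul_Gamma_eq_betaIntegral hrn hqr
    rw [show r + n + (q - r) = q + n by ring, Gamma_add_nat hr, Gamma_add_nat hq0] at h1
    have h2 : ∫ t in Ioc (0 : ℝ) 1, F n t = z ^ n / n.factorial * Complex.betaIntegral (r + n) (q - r) := by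
      rw [Complex.betaIntegral, intervalIntegral.integral_of_le zero_le_one, ← integral_const_mul]
      refine setIntegral_congr_fun measurableSet_Ioc fun t ht => ?_
      have ht' : (t : ℂ) ≠ 0 := ofReal_ne_zero.2 ht.1.ne'
      simp only [hF, hb]
      rw [show r + n - 1 = r - 1 + n by ring, Complex.cpow_add _ _ ht', Complex.cpow_natCast, mul_pow]
      ring
    have h3 := poch_ne_zero (add_nat_ne_zero hq0) n
    have h4 : Complex.betaIntegral (r + n) (q - r) =
        poch r n * Complex.Gamma r * Complex.Gamma (q - r) / (poch q n * Complex.Gamma q) := by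
      rw [eq_div_iff (mul_ne_zero h3 hGq), h1]
      ring
    rw [h2, h4, kcoef]
    ring
  rw [show (fun n => ∫ t in Ioc (0 : ℝ) 1, F n t) = _ from funext e2] at key
  exact ((hasSum_oneF1 (add_nat_ne_zero hq0) r z).mul_left _).unique key

lemma integrableOn_exp_mul_rpow {a ρ : ℝ} (ha : 0 < a) (hρ : 0 < ρ) :
    IntegrableOn (fun x : ℝ => Real.exp (-(ρ * x)) * x ^ (a - 1)) (Ioi 0) := by
  have h := integrableOn_rpow_mul_exp_neg_mul_rpow (p := 1) (s := a - 1) (by linarith) one_pos hρ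
  refine h.congr_fun (fun x _ => ?_) measurableSet_Ioi
  simp only [Real.rpow_one]
  rw [mul_comm, neg_mul]

/-- Laplace transform of a power, at a complex frequency. -/
lemma integral_cpow_mul_exp {r : ℂ} (hr : 0 < r.re) {ζ : ℂ} (hζ : 0 < ζ.re) :
    ∫ x in Ioi (0 : ℝ), Complex.exp (-(ζ * x)) * (x : ℂ) ^ (r - 1) =
      ζ ^ (-r) * Complex.Gamma r := by
  have hopen : IsOpen {z : ℂ | 0 < z.re} := isOpen_lt continuous_const continuous_re
  have hconv : Convex ℝ {z : ℂ | 0 < z.re} := convex_halfSpace_re_gt 0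
  have hm : ∀ z : ℂ, AEStronglyMeasurable (fun x : ℝ => Complex.exp (-(z * x)) * (x : ℂ) ^ (r - 1))
      (volume.restrict (Ioi 0)) := fun z => by
    refine Measurable.aestronglyMeasurable ?_
    fun_prop
  have hn : ∀ (z : ℂ) (x : ℝ), 0 < x → ‖Complex.exp (-(z * x)) * (x : ℂ) ^ (r - 1)‖ =
      Real.exp (-(z.re * x)) * x ^ (r.re - 1) := fun z x hx => by
    rw [norm_mul, Complex.norm_exp, norm_cpow_eq_rpow_re_of_pos hx]
    simp
  have hd : DifferentiableOn ℂ (fun z : ℂ => ∫ x in Ioi (0 : ℝ),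
      Complex.exp (-(z * x)) * (x : ℂ) ^ (r - 1)) {z | 0 < z.re} := fun z (hz : 0 < z.re) => by
    have h := hasDerivAt_integral_of_dominated_loc_of_deriv_le (μ := volume.restrict (Ioi (0 : ℝ)))
      (F := fun (z : ℂ) (x : ℝ) => Complex.exp (-(z * x)) * (x : ℂ) ^ (r - 1))
      (F' := fun (z : ℂ) (x : ℝ) => -x * (Complex.exp (-(z * x)) * (x : ℂ) ^ (r - 1)))
      (bound := fun x => Real.exp (-(z.re / 2 * x)) * x ^ (r.re + 1 - 1))
      (x₀ := z) (s := Metric.ball z (z.re / 2)) (Metric.ball_mem_nhds z (by positivity))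
      (Eventually.of_forall hm) ?_ ?_ ?_ (integrableOn_exp_mul_rpow (by linarith) (by positivity)) ?_
    · exact h.2.differentiableAt.differentiableWithinAt
    · refine (integrableOn_exp_mul_rpow hr hz).mono' (hm z)
        ((ae_restrict_mem measurableSet_Ioi).mono fun x hx => (hn z x hx).le)
    · exact (continuous_ofReal.neg).aestronglyMeasurable.mul (hm z)
    · refine (ae_restrict_mem measurableSet_Ioi).mono fun x (hx : 0 < x) w hw => ?_
      have h1 : z.re / 2 ≤ w.re := by
        have h2 := (abs_re_le_norm (w - z)).trans (mem_ball_iff_norm.1 hw).le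
        rw [sub_re] at h2
        linarith [(abs_le.1 h2).1]
      rw [norm_mul, hn w x hx, norm_neg, norm_real, Real.norm_of_nonneg hx.le]
      have h3 : x ^ (r.re + 1 - 1) = x * x ^ (r.re - 1) := by
        rw [add_sub_right_comm, Real.rpow_add_one hx.ne', mul_comm]
      rw [h3, mul_left_comm]
      gcongr
    · refine Eventually.of_forall fun x w _ => ?_
      have h1 : HasDerivAt (fun z : ℂ => -(z * x)) (-(1 * (x : ℂ))) w :=
        ((hasDerivAt_id w).mul_const (x : ℂ)).neg
      refine (h1.cexp.mul_const _).congr_deriv ?_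
      ring
  have hd2 : DifferentiableOn ℂ (fun z : ℂ => z ^ (-r) * Complex.Gamma r) {z | 0 < z.re} :=
    fun z (hz : 0 < z.re) => by
      have h1 : DifferentiableAt ℂ (fun z : ℂ => z ^ (-r)) z :=
        differentiableAt_id.cpow_const (Or.inl hz)
      exact (h1.mul_const _).differentiableWithinAt
  have hre : ∀ x : ℝ, 0 < x → ∫ t in Ioi (0 : ℝ), Complex.exp (-((x : ℂ) * t)) * (t : ℂ) ^ (r - 1) =
      (x : ℂ) ^ (-r) * Complex.Gamma r := fun x hx => by
    have h := Complex.integral_cpow_mul_exp_neg_mul_Ioi hr hx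
    have e : (1 / (x : ℂ)) ^ r = (x : ℂ) ^ (-r) := by
      rw [one_div, inv_cpow _ _ (by rw [arg_ofReal_of_nonneg hx.le]; exact Real.pi_pos.ne),
        cpow_neg]
    rw [← e, ← h]
    simp only [mul_comm]
  refine AnalyticOnNhd.eqOn_of_preconnected_of_frequently_eq (hd.analyticOnNhd hopen)
    (hd2.analyticOnNhd hopen) hconv.isPreconnected (z₀ := 1) (by simp) ?_ hζ
  have h1 : Tendsto (fun n : ℕ => (((1 : ℝ) + 1 / ((n : ℝ) + 1) : ℝ) : ℂ)) atTop (𝓝[≠] 1) := by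
    refine tendsto_nhdsWithin_iff.2 ⟨?_, Eventually.of_forall fun n => ?_⟩
    · have := (continuous_ofReal.tendsto _).comp
        ((tendsto_one_div_add_atTop_nhds_zero_nat (𝕜 := ℝ)).const_add 1)
      rw [add_zero, ofReal_one] at this
      exact this
    · have : (1 : ℝ) / ((n : ℝ) + 1) ≠ 0 := by positivity
      rw [mem_compl_iff, mem_singleton_iff, ofReal_eq_one]
      simpa using this
  exact h1.frequently (Frequently.of_forall fun n => hre _ (by positivity))

/-- The rescaled Euler integrand. -/
def eulerInt (r q ζ : ℂ) (L x : ℝ) : ℂ :=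
  (Ioc 0 L).indicator (fun x => Complex.exp (-(ζ * x)) * ((x : ℂ) ^ (r - 1) *
    (1 - ((x / L : ℝ) : ℂ)) ^ (q - r - 1))) x

lemma cpow_mul_oneF1 {r q : ℂ} (hr : 0 < r.re) (hq : r.re < q.re) (ζ : ℂ) {L : ℝ} (hL : 0 < L) :
    Complex.Gamma r * Complex.Gamma (q - r) / Complex.Gamma q * ((L : ℂ) ^ r * oneF1 r q (-(L * ζ))) =
      ∫ x in Ioi (0 : ℝ), eulerInt r q ζ L x := by
  have hL' : (L : ℂ) ≠ 0 := ofReal_ne_zero.2 hL.ne'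
  have h1 := integral_comp_mul_left_Ioi (eulerInt r q ζ L) 0 hL
  rw [mul_zero] at h1
  have h2 : ∫ x in Ioi (0 : ℝ), eulerInt r q ζ L x =
      L * ∫ x in Ioi (0 : ℝ), eulerInt r q ζ L (L * x) := by
    rw [h1, real_smul, ofReal_inv, mul_inv_cancel_left₀ hL']
  have h3 : ∀ x ∈ Ioi (0 : ℝ), eulerInt r q ζ L (L * x) = (Ioc (0 : ℝ) 1).indicator
      (fun t : ℝ => (L : ℂ) ^ (r - 1) * (Complex.exp (-(L * ζ) * t) * ((t : ℂ) ^ (r - 1) *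
        (1 - (t : ℂ)) ^ (q - r - 1)))) x := fun x (hx : 0 < x) => by
    have e : L * x ∈ Ioc 0 L ↔ x ∈ Ioc (0 : ℝ) 1 := by
      simp [hx, hL, mul_pos hL hx]
    by_cases h : x ∈ Ioc (0 : ℝ) 1
    · rw [eulerInt, indicator_of_mem (e.2 h), indicator_of_mem h, mul_div_cancel_left₀ _ hL.ne',
        ofReal_mul, mul_cpow_ofReal_nonneg hL.le hx.le]
      ring_nf
    · rw [eulerInt, indicator_of_notMem (mt e.1 h), indicator_of_notMem h]
  rw [h2, setIntegral_congr_fun measurableSet_Ioi h3, setIntegral_indicator measurableSet_Ioc,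
    inter_eq_self_of_subset_right Ioc_subset_Ioi_self, integral_const_mul,
    ← oneF1_eq_integral hr hq, ← mul_assoc (L : ℂ)]
  have e : (L : ℂ) * (L : ℂ) ^ (r - 1) = (L : ℂ) ^ r := by
    rw [Complex.cpow_sub _ _ hL', cpow_one]
    field_simp
  rw [e]
  ring

lemma norm_eulerInt_le {r q : ℂ} (hq : r.re + 1 ≤ q.re) (ζ : ℂ) (L : ℝ) {x : ℝ}
    (hx : 0 < x) :
    ‖eulerInt r q ζ L x‖ ≤ Real.exp (-(ζ.re * x)) * x ^ (r.re - 1) := by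
  by_cases h : x ∈ Ioc 0 L
  · rw [eulerInt, indicator_of_mem h, norm_mul, norm_mul, Complex.norm_exp,
      norm_cpow_eq_rpow_re_of_pos hx]
    have h1 : 0 ≤ 1 - x / L := sub_nonneg.2 (div_le_one_of_le₀ h.2 (hx.le.trans h.2))
    have h2 : 1 - x / L ≤ 1 := sub_le_self _ (div_nonneg hx.le (hx.le.trans h.2))
    have h3 : ‖(1 - ((x / L : ℝ) : ℂ)) ^ (q - r - 1)‖ ≤ 1 := by
      rw [← ofReal_one, ← ofReal_sub]
      rcases h1.eq_or_lt with h0 | h0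
      · rw [← h0]
        by_cases hz : q - r - 1 = 0
        · simp [hz]
        · simp [Complex.zero_cpow hz]
      · rw [norm_cpow_eq_rpow_re_of_pos h0]
        exact Real.rpow_le_one h1 h2 (by simp; linarith)
    have e : (-(ζ * (x : ℂ))).re = -(ζ.re * x) := by simp
    rw [e]
    simp only [sub_re, one_re]
    exact mul_le_mul_of_nonneg_left (mul_le_of_le_one_right (by positivity) h3) (by positivity)
  · rw [eulerInt, indicator_of_notMem h, norm_zero]
    positivity

lemma measurable_eulerInt (r q ζ : ℂ) (L : ℝ) : Measurable (eulerInt r q ζ L) := by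
  unfold eulerInt
  refine Measurable.indicator ?_ measurableSet_Ioc
  fun_prop

lemma norm_cpow_mul_oneF1_le {r q : ℂ} (hr : 0 < r.re) (hq : r.re + 1 ≤ q.re) {ζ : ℂ}
    (hζ : 0 < ζ.re) {L : ℝ} (hL : 0 < L) :
    ‖(L : ℂ) ^ r * oneF1 r q (-(L * ζ))‖ ≤
      ‖Complex.Gamma q / (Complex.Gamma r * Complex.Gamma (q - r))‖ *
        ∫ x in Ioi (0 : ℝ), Real.exp (-(ζ.re * x)) * x ^ (r.re - 1) := by
  have h := cpow_mul_oneF1 hr (by linarith) ζ hL (q := q)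
  have g1 := Complex.Gamma_ne_zero_of_re_pos hr
  have g2 := Complex.Gamma_ne_zero_of_re_pos (s := q) (by linarith)
  have g3 := Complex.Gamma_ne_zero_of_re_pos (s := q - r) (by simp; linarith)
  have h2 : (L : ℂ) ^ r * oneF1 r q (-(L * ζ)) =
      Complex.Gamma q / (Complex.Gamma r * Complex.Gamma (q - r)) *
        ∫ x in Ioi (0 : ℝ), eulerInt r q ζ L x := by
    rw [← h]
    field_simp
  rw [h2, norm_mul]
  gcongr
  exact norm_integral_le_of_norm_le (integrableOn_exp_mul_rpow hr hζ)
    ((ae_restrict_mem measurableSet_Ioi).mono fun x hx => norm_eulerInt_le hq ζ L hx)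

lemma tendsto_cpow_mul_oneF1 {r q : ℂ} (hr : 0 < r.re) (hq : r.re + 1 ≤ q.re) {ζ : ℂ}
    (hζ : 0 < ζ.re) :
    Tendsto (fun L : ℝ => (L : ℂ) ^ r * oneF1 r q (-(L * ζ))) atTop
      (𝓝 (Complex.Gamma q / Complex.Gamma (q - r) * ζ ^ (-r))) := by
  have g1 := Complex.Gamma_ne_zero_of_re_pos hr
  have g2 := Complex.Gamma_ne_zero_of_re_pos (s := q) (by linarith)
  have g3 := Complex.Gamma_ne_zero_of_re_pos (s := q - r) (by simp; linarith)
  have h := tendsto_integral_filter_of_dominated_convergence (μ := volume.restrict (Ioi (0 : ℝ)))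
    (l := atTop) (F := fun L => eulerInt r q ζ L)
    (f := fun x : ℝ => Complex.exp (-(ζ * x)) * (x : ℂ) ^ (r - 1))
    _ (Eventually.of_forall fun L => (measurable_eulerInt r q ζ L).aestronglyMeasurable)
    (Eventually.of_forall fun L => (ae_restrict_mem measurableSet_Ioi).mono
      fun x hx => norm_eulerInt_le hq ζ L hx) (integrableOn_exp_mul_rpow hr hζ)
    ((ae_restrict_mem measurableSet_Ioi).mono fun x (hx : 0 < x) => ?_)
  · rw [integral_cpow_mul_exp hr hζ] at h
    have h2 := h.const_mul (Complex.Gamma q / (Complex.Gamma r * Complex.Gamma (q - r)))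
    rw [show Complex.Gamma q / (Complex.Gamma r * Complex.Gamma (q - r)) *
      (ζ ^ (-r) * Complex.Gamma r) = Complex.Gamma q / Complex.Gamma (q - r) * ζ ^ (-r) by
        field_simp] at h2
    refine h2.congr' ((eventually_gt_atTop 0).mono fun L hL => ?_)
    rw [← cpow_mul_oneF1 hr (by linarith) ζ hL]
    field_simp
  · have h1 : Tendsto (fun L : ℝ => (1 : ℂ) - ((x / L : ℝ) : ℂ)) atTop (𝓝 1) := by
      have := ((continuous_ofReal.tendsto 0).comp
        (tendsto_const_nhds.div_atTop tendsto_id : Tendsto (fun L : ℝ => x / L) atTop (𝓝 0)))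
      simpa using this.const_sub 1
    have h2 := (h1.cpow (tendsto_const_nhds (x := q - r - 1)) (by simp)).const_mul
      (Complex.exp (-(ζ * x)) * (x : ℂ) ^ (r - 1))
    rw [one_cpow, mul_one] at h2
    refine h2.congr' ((eventually_ge_atTop x).mono fun L hL => ?_)
    simp only [eulerInt]
    rw [indicator_of_mem (show x ∈ Ioc 0 L from ⟨hx, hL⟩)]
    push_cast
    ring

lemma cpow_mul_oneF1_lower {q : ℂ} (hq : 0 < q.re) (r ζ : ℂ) {L : ℝ} (hL : 0 < L) :
    (L : ℂ) ^ r * oneF1 r q (-(L * ζ)) = (L : ℂ) ^ r * oneF1 r (q + 1) (-(L * ζ)) -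
      ζ * (r / (q * (q + 1))) * ((L : ℂ) ^ (r + 1) * oneF1 (r + 1) (q + 2) (-(L * ζ))) := by
  rw [oneF1_lower (add_nat_ne_zero hq) r, cpow_add _ _ (ofReal_ne_zero.2 hL.ne'), cpow_one]
  ring

lemma exists_norm_cpow_mul_oneF1_le {r q : ℂ} (hr : 0 < r.re) (hq : r.re < q.re) {δ : ℝ}
    (hδ : 0 < δ) (R : ℝ) : ∃ C, ∀ ζ : ℂ, ζ.re = δ → ‖ζ‖ ≤ R → ∀ L : ℝ, 0 < L →
      ‖(L : ℂ) ^ r * oneF1 r q (-(L * ζ))‖ ≤ C := by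
  refine ⟨‖Complex.Gamma (q + 1) / (Complex.Gamma r * Complex.Gamma (q + 1 - r))‖ *
      (∫ x in Ioi (0 : ℝ), Real.exp (-(δ * x)) * x ^ (r.re - 1)) +
    R * ‖r / (q * (q + 1))‖ *
      (‖Complex.Gamma (q + 2) / (Complex.Gamma (r + 1) * Complex.Gamma (q + 2 - (r + 1)))‖ *
      ∫ x in Ioi (0 : ℝ), Real.exp (-(δ * x)) * x ^ ((r + 1).re - 1)), fun ζ h1 h2 L hL => ?_⟩
  rw [cpow_mul_oneF1_lower (hr.trans hq) r ζ hL]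
  refine (norm_sub_le _ _).trans ?_
  rw [norm_mul (ζ * _), norm_mul ζ]
  have b1 := norm_cpow_mul_oneF1_le (q := q + 1) hr (by simpa using hq.le) (h1 ▸ hδ) hL
  have b2 := norm_cpow_mul_oneF1_le (r := r + 1) (q := q + 2) (by simp; linarith)
    (by simp; linarith) (h1 ▸ hδ) hL
  rw [h1] at b1 b2
  exact add_le_add b1 (mul_le_mul (mul_le_mul_of_nonneg_right h2 (norm_nonneg _)) b2
    (norm_nonneg _) (mul_nonneg ((norm_nonneg _).trans h2) (norm_nonneg _)))

lemma tendsto_cpow_mul_oneF1_of_lt {r q : ℂ} (hr : 0 < r.re) (hq : r.re < q.re) {ζ : ℂ}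
    (hζ : 0 < ζ.re) :
    Tendsto (fun L : ℝ => (L : ℂ) ^ r * oneF1 r q (-(L * ζ))) atTop
      (𝓝 (Complex.Gamma q / Complex.Gamma (q - r) * ζ ^ (-r))) := by
  have h1 := tendsto_cpow_mul_oneF1 (q := q + 1) hr (by simpa using hq.le) hζ
  have h2 := tendsto_cpow_mul_oneF1 (r := r + 1) (q := q + 2) (by simp; linarith)
      (by simp; linarith) hζ
  have h3 := h1.sub (h2.const_mul (ζ * (r / (q * (q + 1)))))
  have hq0 : 0 < q.re := hr.trans hq
  have a0 : q ≠ 0 := by simpa using add_nat_ne_zero hq0 0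
  have a1 : q + 1 ≠ 0 := by simpa using add_nat_ne_zero hq0 1
  have hqr : q - r ≠ 0 := fun h => by
    have := congrArg re h
    simp at this
    linarith
  have hζ0 : ζ ≠ 0 := fun h => by simp [h] at hζ
  have gq : Complex.Gamma (q + 2) = (q + 1) * (q * Complex.Gamma q) := by
    rw [← Complex.Gamma_add_one _ a0, ← Complex.Gamma_add_one _ a1, add_assoc, one_add_one_eq_two]
  have g3 := Complex.Gamma_ne_zero_of_re_pos (s := q - r) (by simp; linarith)
  have e : Complex.Gamma (q + 1) / Complex.Gamma (q + 1 - r) * ζ ^ (-r) -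
      ζ * (r / (q * (q + 1))) * (Complex.Gamma (q + 2) / Complex.Gamma (q + 2 - (r + 1)) *
        ζ ^ (-(r + 1))) = Complex.Gamma q / Complex.Gamma (q - r) * ζ ^ (-r) := by
    rw [show q + 2 - (r + 1) = q - r + 1 by ring, show q + 1 - r = q - r + 1 by ring,
      Complex.Gamma_add_one _ hqr, gq, Complex.Gamma_add_one _ a0, neg_add, cpow_add _ _ hζ0,
      cpow_neg_one]
    field_simp
  rw [e] at h3
  exact h3.congr' ((eventually_gt_atTop 0).mono fun L hL =>
    (cpow_mul_oneF1_lower hq0 r ζ hL).symm)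

section

variable {s : ℂ} (hs : -(1 / 2 : ℝ) < s.re)
include hs

lemma cpow_mul_oneF1_Bs (ζ : ℂ) {L : ℝ} (hL : 0 < L) :
    (L : ℂ) ^ s * oneF1 s (Bs s) (-(L * ζ)) =
      (L : ℂ)⁻¹ * ((L : ℂ) ^ (s + 1) * oneF1 (s + 1) (Bs s) (-(L * ζ))) +
        ζ / Bs s * ((L : ℂ) ^ (s + 1) * oneF1 (s + 1) (Bs s + 1) (-(L * ζ))) := by
  have h := oneF1_succ_sub (q := (Bs s : ℂ)) (Bs_ne hs) s (-(L * ζ))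
  have hL' : (L : ℂ) ≠ 0 := ofReal_ne_zero.2 hL.ne'
  rw [show oneF1 s (Bs s) (-(L * ζ)) = oneF1 (s + 1) (Bs s) (-(L * ζ)) -
    -(L * ζ) / Bs s * oneF1 (s + 1) (Bs s + 1) (-(L * ζ)) by rw [← h]; ring,
    cpow_add _ _ hL', cpow_one]
  field_simp
  ring

lemma exists_norm_succ_le {δ : ℝ} (hδ : 0 < δ) (R : ℝ) : ∃ C, ∀ ζ : ℂ, ζ.re = δ → ‖ζ‖ ≤ R →
    ∀ L : ℝ, 0 < L → ‖(L : ℂ) ^ (s + 1) * oneF1 (s + 1) (Bs s) (-(L * ζ))‖ ≤ C := by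
  obtain ⟨C1, h1⟩ := exists_norm_cpow_mul_oneF1_le (r := s + 1) (q := Bs s + 1)
    (by simp; linarith) (by simp [Bs]; linarith) hδ R
  obtain ⟨C2, h2⟩ := exists_norm_cpow_mul_oneF1_le (r := s + 1 + 1) (q := Bs s + 2)
    (by simp; linarith) (by simp [Bs]; linarith) hδ R
  refine ⟨C1 + R * ‖(s + 1) / (Bs s * (Bs s + 1))‖ * C2, fun ζ e1 e2 L hL => ?_⟩
  rw [cpow_mul_oneF1_lower (by simpa using Bs_pos hs) (s + 1) ζ hL]
  refine (norm_sub_le _ _).trans ?_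
  rw [norm_mul (ζ * _), norm_mul ζ]
  exact add_le_add (h1 ζ e1 e2 L hL) (mul_le_mul (mul_le_mul_of_nonneg_right e2 (norm_nonneg _))
    (h2 ζ e1 e2 L hL) (norm_nonneg _) (mul_nonneg ((norm_nonneg _).trans e2) (norm_nonneg _)))

lemma exists_norm_Bs_le {δ : ℝ} (hδ : 0 < δ) (R : ℝ) : ∃ C, ∀ ζ : ℂ, ζ.re = δ → ‖ζ‖ ≤ R →
    ∀ L : ℝ, 1 ≤ L → ‖(L : ℂ) ^ s * oneF1 s (Bs s) (-(L * ζ))‖ ≤ C := by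
  obtain ⟨C1, h1⟩ := exists_norm_cpow_mul_oneF1_le (r := s + 1) (q := Bs s + 1)
    (by simp; linarith) (by simp [Bs]; linarith) hδ R
  obtain ⟨C2, h2⟩ := exists_norm_succ_le hs hδ R
  refine ⟨1 * C2 + R / ‖(Bs s : ℂ)‖ * C1, fun ζ e1 e2 L hL => ?_⟩
  rw [cpow_mul_oneF1_Bs hs ζ (zero_lt_one.trans_le hL)]
  refine (norm_add_le _ _).trans ?_
  rw [norm_mul (L : ℂ)⁻¹, norm_mul (ζ / _), norm_div]
  have hL1 : ‖(L : ℂ)⁻¹‖ ≤ 1 := by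
    rw [norm_inv, norm_real, Real.norm_of_nonneg (by linarith)]
    exact inv_le_one_of_one_le₀ hL
  exact add_le_add (mul_le_mul hL1 (h2 ζ e1 e2 L (by linarith)) (norm_nonneg _) zero_le_one)
    (mul_le_mul (by gcongr) (h1 ζ e1 e2 L (by linarith)) (norm_nonneg _)
      (div_nonneg ((norm_nonneg _).trans e2) (norm_nonneg _)))

lemma tendsto_inv_mul_succ {ζ : ℂ} (hζ : 0 < ζ.re) :
    Tendsto (fun L : ℝ => (L : ℂ)⁻¹ * ((L : ℂ) ^ (s + 1) * oneF1 (s + 1) (Bs s) (-(L * ζ))))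
      atTop (𝓝 0) := by
  obtain ⟨C, h⟩ := exists_norm_succ_le hs hζ ‖ζ‖
  have h1 : Tendsto (fun L : ℝ => L⁻¹ * C) atTop (𝓝 0) := by
    simpa using tendsto_inv_atTop_zero.mul_const C
  refine squeeze_zero_norm' ((eventually_gt_atTop 0).mono fun L hL => ?_) h1
  rw [norm_mul, norm_inv, norm_real, Real.norm_of_nonneg hL.le]
  exact mul_le_mul_of_nonneg_left (h ζ rfl le_rfl L hL) (by positivity)

lemma tendsto_Bs {ζ : ℂ} (hζ : 0 < ζ.re) :
    Tendsto (fun L : ℝ => (L : ℂ) ^ s * oneF1 s (Bs s) (-(L * ζ))) atTop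
      (𝓝 (Complex.Gamma (Bs s) / Complex.Gamma ((starRingEnd ℂ) s + 1) * ζ ^ (-s))) := by
  have h1 := tendsto_cpow_mul_oneF1_of_lt (r := s + 1) (q := Bs s + 1)
    (by simp; linarith) (by simp [Bs]; linarith) hζ
  have h2 := (tendsto_inv_mul_succ hs hζ).add (h1.const_mul (ζ / Bs s))
  have hζ0 : ζ ≠ 0 := fun h => by simp [h] at hζ
  have hB : (Bs s : ℂ) ≠ 0 := ofReal_ne_zero.2 (Bs_pos hs).ne'
  have e : (0 : ℂ) + ζ / Bs s * (Complex.Gamma (Bs s + 1) / Complex.Gamma (Bs s + 1 - (s + 1)) *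
      ζ ^ (-(s + 1))) = Complex.Gamma (Bs s) / Complex.Gamma ((starRingEnd ℂ) s + 1) * ζ ^ (-s) := by
    rw [show (Bs s : ℂ) + 1 - (s + 1) = (starRingEnd ℂ) s + 1 by rw [Bs_coe]; ring,
      Complex.Gamma_add_one _ hB, neg_add, cpow_add _ _ hζ0, cpow_neg_one]
    field_simp
    ring
  rw [e] at h2
  exact h2.congr' ((eventually_gt_atTop 0).mono fun L hL => (cpow_mul_oneF1_Bs hs ζ hL).symm)

end

section

set_option linter.unusedSectionVars false

section

variable {X : Type*} [TopologicalSpace X] [CompactSpace X] [T2Space X]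
  [SecondCountableTopology X] [MeasurableSpace X] [BorelSpace X] (μ : Measure X)
  [IsProbabilityMeasure μ]

/-- The Hermitian form attached to a kernel. -/
def quadK (N : X × X → ℂ) (g : X → ℂ) : ℂ :=
  ∫ p, (starRingEnd ℂ) (g p.1) * N p * g p.2 ∂(μ.prod μ)

lemma quadK_rankOne (w : ℂ) (ψ g : X → ℂ) :
    quadK μ (fun p => w * (ψ p.1 * (starRingEnd ℂ) (ψ p.2))) g =
      w * ((‖∫ u, ψ u * (starRingEnd ℂ) (g u) ∂μ‖ ^ 2 : ℝ) : ℂ) := by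
  have h : ∀ p : X × X, (starRingEnd ℂ) (g p.1) * (w * (ψ p.1 * (starRingEnd ℂ) (ψ p.2))) * g p.2 =
      w * ((ψ p.1 * (starRingEnd ℂ) (g p.1)) * (starRingEnd ℂ) (ψ p.2 * (starRingEnd ℂ) (g p.2))) :=
    fun p => by rw [map_mul, conj_conj]; ring
  rw [quadK]
  simp only [h]
  rw [integral_const_mul, integral_prod_mul (fun u => ψ u * (starRingEnd ℂ) (g u))
    (fun u => (starRingEnd ℂ) (ψ u * (starRingEnd ℂ) (g u))), integral_conj, mul_conj,
    normSq_eq_norm_sq]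

lemma hasDerivAt_quadK {N : ℝ → X × X → ℂ} {w : ℝ → ℝ} {ψ : ℝ × X → ℂ}
    (hN : ∀ t, 0 < t → Continuous (N t)) (hw : ContinuousOn w (Ioi 0)) (hψ : Continuous ψ)
    (hd : ∀ t, 0 < t → ∀ p : X × X, HasDerivAt (fun t => N t p)
      (w t * (ψ (t, p.1) * (starRingEnd ℂ) (ψ (t, p.2)))) t)
    {g : X → ℂ} (hg : Continuous g) {t : ℝ} (ht : 0 < t) :
    HasDerivAt (fun t => quadK μ (N t) g)
      (w t * ((‖∫ u, ψ (t, u) * (starRingEnd ℂ) (g u) ∂μ‖ ^ 2 : ℝ) : ℂ)) t := by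
  rw [← quadK_rankOne]
  set G : ℝ × (X × X) → ℂ := fun q => (starRingEnd ℂ) (g q.2.1) *
    (w q.1 * (ψ (q.1, q.2.1) * (starRingEnd ℂ) (ψ (q.1, q.2.2)))) * g q.2.2 with hG
  set K : Set ℝ := Icc (t / 2) (t + 1) with hK
  have hKn : K ∈ 𝓝 t := Icc_mem_nhds (by linarith) (by linarith)
  have hKp : ∀ x ∈ K, 0 < x := fun x hx => lt_of_lt_of_le (by positivity) hx.1
  have hGc : ContinuousOn G (K ×ˢ univ) := by
    have h1 : ContinuousOn (fun q : ℝ × (X × X) => w q.1) (K ×ˢ univ) :=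
      hw.comp continuousOn_fst fun q hq => hKp _ hq.1
    have h2 : Continuous fun q : ℝ × (X × X) => ψ (q.1, q.2.1) := by fun_prop
    have h3 : Continuous fun q : ℝ × (X × X) => ψ (q.1, q.2.2) := by fun_prop
    have h4 : Continuous fun q : ℝ × (X × X) => g q.2.1 := by fun_prop
    have h5 : Continuous fun q : ℝ × (X × X) => g q.2.2 := by fun_prop
    exact (((continuous_conj.comp h4).continuousOn.mul ((continuous_ofReal.comp_continuousOn h1).mul
      (h2.mul (continuous_conj.comp h3)).continuousOn))).mul h5.continuousOn
  obtain ⟨C, hC⟩ := (isCompact_Icc.prod isCompact_univ).exists_bound_of_continuousOn hGc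
  have hcont : ∀ x, 0 < x → Continuous fun p : X × X =>
      (starRingEnd ℂ) (g p.1) * N x p * g p.2 := fun x hx => by
    have := hN x hx
    have h4 : Continuous fun q : X × X => (starRingEnd ℂ) (g q.1) :=
      continuous_conj.comp (by fun_prop)
    fun_prop
  have hG1 : Continuous fun p => G (t, p) :=
    continuousOn_univ.1 (hGc.comp (by fun_prop) fun p _ => ⟨mem_of_mem_nhds hKn, trivial⟩)
  refine (hasDerivAt_integral_of_dominated_loc_of_deriv_le (μ := μ.prod μ) (s := K)
    (F := fun t p => (starRingEnd ℂ) (g p.1) * N t p * g p.2) (F' := fun t p => G (t, p))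
    (bound := fun _ => C) hKn ?_ ?_ ?_ ?_ ?_ ?_).2
  · filter_upwards [hKn] with x hx
    exact (hcont x (hKp x hx)).aestronglyMeasurable
  · exact integrable_of_continuous_compact (hcont t ht)
  · exact hG1.aestronglyMeasurable
  · exact Eventually.of_forall fun p x hx => hC (x, p) ⟨hx, trivial⟩
  · exact integrable_const _
  · exact Eventually.of_forall fun p x hx => ((hd x (hKp x hx) p).const_mul _).mul_const _

lemma quadK_le_of_tendsto {N : ℝ → X × X → ℂ} {Ninf : X × X → ℂ} {w : ℝ → ℝ} {ψ : ℝ × X → ℂ}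
    (hN : ∀ t, 0 < t → Continuous (N t)) (hw : ContinuousOn w (Ioi 0)) (hw0 : ∀ t, 0 < t → 0 ≤ w t)
    (hψ : Continuous ψ)
    (hd : ∀ t, 0 < t → ∀ p : X × X, HasDerivAt (fun t => N t p)
      (w t * (ψ (t, p.1) * (starRingEnd ℂ) (ψ (t, p.2)))) t)
    {C : ℝ} (hC : ∀ t, 1 ≤ t → ∀ p, ‖N t p‖ ≤ C)
    (hlim : ∀ p, Tendsto (fun t => N t p) atTop (𝓝 (Ninf p)))
    {g : X → ℂ} (hg : Continuous g) {t : ℝ} (ht : 0 < t) :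
    (quadK μ (N t) g).re ≤ (quadK μ Ninf g).re := by
  have hcont : ∀ x, 0 < x → Continuous fun p : X × X =>
      (starRingEnd ℂ) (g p.1) * N x p * g p.2 := fun x hx => by
    have := hN x hx
    have h4 : Continuous fun q : X × X => (starRingEnd ℂ) (g q.1) :=
      continuous_conj.comp (by fun_prop)
    fun_prop
  have hder : ∀ x, 0 < x → HasDerivAt (fun t => (quadK μ (N t) g).re)
      (w x * ‖∫ u, ψ (x, u) * (starRingEnd ℂ) (g u) ∂μ‖ ^ 2) x := fun x hx => by
    have := Complex.reCLM.hasFDerivAt.comp_hasDerivAt x (hasDerivAt_quadK μ hN hw hψ hd hg hx)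
    refine this.congr_deriv ?_
    rw [← ofReal_mul]
    exact ofReal_re _
  have hmono : MonotoneOn (fun t => (quadK μ (N t) g).re) (Ioi 0) := by
    refine monotoneOn_of_deriv_nonneg (convex_Ioi 0)
      (fun x hx => (hder x hx).continuousAt.continuousWithinAt) ?_ ?_
    · rw [interior_Ioi]
      exact fun x hx => (hder x hx).differentiableAt.differentiableWithinAt
    · rw [interior_Ioi]
      intro x hx
      rw [(hder x hx).deriv]
      exact mul_nonneg (hw0 x hx) (by positivity)
  have h4 : Continuous fun q : X × X => (starRingEnd ℂ) (g q.1) :=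
    continuous_conj.comp (by fun_prop)
  have h5 : Continuous fun q : X × X => g q.2 := by fun_prop
  have hT : Tendsto (fun t => quadK μ (N t) g) atTop (𝓝 (quadK μ Ninf g)) := by
    refine tendsto_integral_filter_of_dominated_convergence
      (fun p => ‖(starRingEnd ℂ) (g p.1)‖ * C * ‖g p.2‖) ?_ ?_ ?_ ?_
    · filter_upwards [eventually_gt_atTop 0] with x hx
      exact (hcont x hx).aestronglyMeasurable
    · filter_upwards [eventually_ge_atTop 1] with x hx
      refine Eventually.of_forall fun p => ?_
      rw [norm_mul, norm_mul]
      gcongr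
      exact hC x hx p
    · exact integrable_of_continuous_compact (by fun_prop)
    · exact Eventually.of_forall fun p => ((hlim p).const_mul _).mul_const _
  refine ge_of_tendsto ((continuous_re.tendsto _).comp hT) ?_
  filter_upwards [eventually_ge_atTop t] with x hx
  exact hmono ht (ht.trans_le hx) hx

end

end

/-- The Cauchy kernel `i / (u - v + 2 i ε)` on the unit square. -/
def cauchyK (ε : ℝ) (p : I01 × I01) : ℂ := I / (((p.1 : ℝ) : ℂ) - ((p.2 : ℝ) : ℂ) + 2 * I * ε)

lemma cauchyK_den_ne {ε : ℝ} (hε : 0 < ε) (x y : ℝ) : (x : ℂ) - (y : ℂ) + 2 * I * ε ≠ 0 := fun h => by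
  have := congrArg im h
  simp at this
  exact hε.ne' this

lemma continuous_cauchyK {ε : ℝ} (hε : 0 < ε) : Continuous (cauchyK ε) :=
  Continuous.div continuous_const (by fun_prop) fun p => cauchyK_den_ne hε _ _

lemma quadK_cauchyK_nonneg {ε : ℝ} (hε : 0 < ε) {g : I01 → ℂ} (hg : Continuous g) :
    0 ≤ (quadK volume (cauchyK ε) g).re := by
  have hne := cauchyK_den_ne hε
  have hlin : Continuous fun p : I01 × I01 => I * (((p.1 : ℝ) : ℂ) - ((p.2 : ℝ) : ℂ) + 2 * I * ε) := by
    fun_prop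
  set N : ℝ → I01 × I01 → ℂ := fun t p => (1 - exp (((t - 1 : ℝ) : ℂ) *
    (I * (((p.1 : ℝ) : ℂ) - ((p.2 : ℝ) : ℂ) + 2 * I * ε)))) * cauchyK ε p with hN
  have hre : ∀ p : I01 × I01, (I * (((p.1 : ℝ) : ℂ) - ((p.2 : ℝ) : ℂ) + 2 * I * ε)).re = -(2 * ε) :=
    fun p => by simp
  have hnorm : ∀ (t : ℝ) (p : I01 × I01), ‖exp (((t - 1 : ℝ) : ℂ) *
      (I * (((p.1 : ℝ) : ℂ) - ((p.2 : ℝ) : ℂ) + 2 * I * ε)))‖ = Real.exp ((t - 1) * -(2 * ε)) :=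
    fun t p => by rw [Complex.norm_exp, re_ofReal_mul, hre]
  have hcc := continuous_cauchyK hε
  obtain ⟨M, hM⟩ := (isCompact_range hcc).isBounded.exists_norm_le
  have hM' : ∀ p, ‖cauchyK ε p‖ ≤ M := fun p => hM _ (mem_range_self p)
  have key := quadK_le_of_tendsto (X := I01) volume (N := N) (Ninf := cauchyK ε)
    (w := fun t => Real.exp ((t - 1) * -(2 * ε)))
    (ψ := fun q => exp (((q.1 - 1 : ℝ) : ℂ) * (I * ((q.2 : ℝ) : ℂ)))) (C := 2 * M)
    (fun t _ => by simp only [hN]; fun_prop) (by fun_prop) (fun t _ => (Real.exp_pos _).le)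
    (by fun_prop) ?_ ?_ ?_ hg one_pos
  · have h0 : N 1 = fun _ => 0 := by
      funext p
      simp [hN]
    rw [h0] at key
    simpa [quadK] using key
  · intro t _ p
    have h1 : HasDerivAt (fun t : ℝ => (((t - 1 : ℝ) : ℂ) *
        (I * (((p.1 : ℝ) : ℂ) - ((p.2 : ℝ) : ℂ) + 2 * I * ε))))
        (1 * (I * (((p.1 : ℝ) : ℂ) - ((p.2 : ℝ) : ℂ) + 2 * I * ε))) t := by
      have := (((hasDerivAt_id t).sub_const 1).ofReal_comp).mul_const
        (I * (((p.1 : ℝ) : ℂ) - ((p.2 : ℝ) : ℂ) + 2 * I * ε))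
      simpa using this
    refine ((h1.cexp.const_sub 1).mul_const (cauchyK ε p)).congr_deriv ?_
    have h2 := hne p.1 p.2
    rw [ofReal_exp, ← exp_conj, ← exp_add, ← exp_add, cauchyK]
    rw [show ((t - 1 : ℝ) : ℂ) * (I * (((p.1 : ℝ) : ℂ) - ((p.2 : ℝ) : ℂ) + 2 * I * ε)) =
      (((t - 1) * -(2 * ε) : ℝ) : ℂ) + (((t - 1 : ℝ) : ℂ) * (I * ((p.1 : ℝ) : ℂ)) +
        (starRingEnd ℂ) (((t - 1 : ℝ) : ℂ) * (I * ((p.2 : ℝ) : ℂ)))) by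
      simp only [map_mul, conj_ofReal, conj_I]
      push_cast
      linear_combination (2 * (t - 1) * ε : ℂ) * I_sq]
    generalize exp _ = E
    generalize ((p.1 : ℝ) : ℂ) - ((p.2 : ℝ) : ℂ) + 2 * I * ε = d at h2 ⊢
    field_simp
    linear_combination (-E) * I_sq
  · intro t ht p
    simp only [hN]
    rw [norm_mul]
    refine mul_le_mul ((norm_sub_le _ _).trans ?_) (hM' p) (norm_nonneg _) zero_le_two
    rw [hnorm, norm_one]
    have : Real.exp ((t - 1) * -(2 * ε)) ≤ 1 := Real.exp_le_one_iff.2 (by nlinarith)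
    linarith
  · intro p
    have h1 : Tendsto (fun t : ℝ => exp (((t - 1 : ℝ) : ℂ) *
        (I * (((p.1 : ℝ) : ℂ) - ((p.2 : ℝ) : ℂ) + 2 * I * ε)))) atTop (𝓝 0) := by
      refine tendsto_zero_iff_norm_tendsto_zero.2 ?_
      simp only [hnorm]
      refine Real.tendsto_exp_atBot.comp ?_
      have : Tendsto (fun t : ℝ => t - 1) atTop atTop := tendsto_atTop_add_const_right _ _ tendsto_id
      exact this.atTop_mul_const_of_neg (by linarith)
    simpa [hN] using (h1.const_sub 1).mul_const (cauchyK ε p)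

lemma integral_poisson_le {ε : ℝ} (hε : 0 < ε) (x : ℝ) :
    ∫ v : I01, 4 * ε / ((x - v) ^ 2 + (2 * ε) ^ 2) ≤ 2 * Real.pi := by
  have e : ∀ y : ℝ, 4 * ε / ((x - y) ^ 2 + (2 * ε) ^ 2) =
      (fun z => ε⁻¹ * (1 + z ^ 2)⁻¹) ((2 * ε)⁻¹ * (x - y)) := fun y => by
    field_simp
    ring
  rw [unitInterval.volume_def, integral_subtype_comap measurableSet_Icc
    (fun v => 4 * ε / ((x - v) ^ 2 + (2 * ε) ^ 2))]
  have h1 : Integrable fun z : ℝ => ε⁻¹ * (1 + z ^ 2)⁻¹ := integrable_inv_one_add_sq.const_mul _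
  have h2 : Integrable fun y : ℝ => 4 * ε / ((x - y) ^ 2 + (2 * ε) ^ 2) := by
    simp only [e]
    exact (h1.comp_mul_left' (by positivity)).comp_sub_left x
  refine (setIntegral_le_integral h2 (Eventually.of_forall fun y => by positivity)).trans ?_
  simp only [e]
  rw [integral_sub_left_eq_self (fun y => ε⁻¹ * (1 + ((2 * ε)⁻¹ * y) ^ 2)⁻¹) volume x,
    Measure.integral_comp_mul_left (fun z => ε⁻¹ * (1 + z ^ 2)⁻¹), integral_const_mul,
    integral_univ_inv_one_add_sq, smul_eq_mul, inv_inv, abs_of_pos (by positivity)]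
  apply le_of_eq
  field_simp

lemma cauchyK_add_conj {ε : ℝ} (hε : 0 < ε) (p : I01 × I01) :
    cauchyK ε p + cauchyK ε p.swap =
      ((4 * ε / (((p.1 : ℝ) - p.2) ^ 2 + (2 * ε) ^ 2) : ℝ) : ℂ) := by
  have h1 := cauchyK_den_ne hε p.1 p.2
  have h2 := cauchyK_den_ne hε p.2 p.1
  have h3 : ((((p.1 : ℝ) : ℂ) - ((p.2 : ℝ) : ℂ)) ^ 2 + (2 * (ε : ℂ)) ^ 2) ≠ 0 := by
    have : (((p.1 : ℝ) - p.2) ^ 2 + (2 * ε) ^ 2) ≠ 0 := by positivity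
    exact_mod_cast this
  simp only [cauchyK, Prod.fst_swap, Prod.snd_swap]
  push_cast
  rw [div_add_div _ _ h1 h2, div_eq_div_iff (mul_ne_zero h1 h2) h3]
  generalize ((p.1 : ℝ) : ℂ) = x
  generalize ((p.2 : ℝ) : ℂ) = y
  ring_nf
  simp only [I_sq]
  ring

/-- The Cauchy kernel is bounded by `2 π`. -/
lemma quadK_cauchyK_le {ε : ℝ} (hε : 0 < ε) {g : I01 → ℂ} (hg : Continuous g) :
    (quadK volume (cauchyK ε) g).re ≤ 2 * Real.pi * ∫ u : I01, ‖g u‖ ^ 2 := by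
  have hcc := continuous_cauchyK hε
  have hgc : Continuous fun u => (starRingEnd ℂ) (g u) := continuous_conj.comp hg
  have hpos := quadK_cauchyK_nonneg hε hgc
  have hsw : quadK volume (cauchyK ε) (fun u => (starRingEnd ℂ) (g u)) =
      ∫ p : I01 × I01, (starRingEnd ℂ) (g p.1) * cauchyK ε p.swap * g p.2 := by
    rw [quadK, ← integral_prod_swap, Measure.volume_eq_prod]
    simp only [Prod.fst_swap, Prod.snd_swap, conj_conj]
    congr 1
    funext p
    ring
  set P : I01 × I01 → ℝ := fun p => 4 * ε / (((p.1 : ℝ) - p.2) ^ 2 + (2 * ε) ^ 2) with hP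
  have hPc : Continuous P := Continuous.div (by fun_prop) (by fun_prop) fun p => by positivity
  have hP0 : ∀ p, 0 ≤ P p := fun p => by positivity
  have hc1 : Continuous fun p : I01 × I01 => (starRingEnd ℂ) (g p.1) * cauchyK ε p * g p.2 := by
    have : Continuous fun p : I01 × I01 => (starRingEnd ℂ) (g p.1) := hgc.comp continuous_fst
    fun_prop
  have hc2 : Continuous fun p : I01 × I01 => (starRingEnd ℂ) (g p.1) * cauchyK ε p.swap * g p.2 := by
    have : Continuous fun p : I01 × I01 => (starRingEnd ℂ) (g p.1) := hgc.comp continuous_fst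
    have h2 : Continuous fun p : I01 × I01 => cauchyK ε p.swap := hcc.comp continuous_swap
    fun_prop
  have hsum : quadK volume (cauchyK ε) g + quadK volume (cauchyK ε) (fun u => (starRingEnd ℂ) (g u)) =
      ∫ p : I01 × I01, (starRingEnd ℂ) (g p.1) * (P p : ℂ) * g p.2 := by
    rw [hsw, quadK, ← Measure.volume_eq_prod, ← integral_add (integrable_of_continuous_compact hc1)
      (integrable_of_continuous_compact hc2)]
    congr 1
    funext p
    rw [hP, ← cauchyK_add_conj hε]
    ring
  have hb : ‖∫ p : I01 × I01, (starRingEnd ℂ) (g p.1) * (P p : ℂ) * g p.2‖ ≤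
      ∫ p : I01 × I01, P p * ((‖g p.1‖ ^ 2 + ‖g p.2‖ ^ 2) / 2) := by
    refine norm_integral_le_of_norm_le (integrable_of_continuous_compact (by fun_prop))
      (Eventually.of_forall fun p => ?_)
    rw [norm_mul, norm_mul, norm_real, Real.norm_of_nonneg (hP0 p), RCLike.norm_conj]
    nlinarith [hP0 p, mul_nonneg (hP0 p) (sq_nonneg (‖g p.1‖ - ‖g p.2‖))]
  have hf : ∫ p : I01 × I01, P p * ‖g p.1‖ ^ 2 ≤ 2 * Real.pi * ∫ u : I01, ‖g u‖ ^ 2 := by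
    rw [Measure.volume_eq_prod, integral_prod _ (integrable_of_continuous_compact (by fun_prop)),
      ← integral_const_mul]
    refine integral_mono (integrable_of_continuous_compact ?_)
      (integrable_of_continuous_compact (by fun_prop)) fun u => ?_
    · exact continuous_parametric_integral_of_continuous (μ := (volume : Measure I01))
        (f := fun u v => P (u, v) * ‖g u‖ ^ 2) (by fun_prop) isCompact_univ |>.congr fun u => by simp
    · simp only
      rw [integral_mul_const]
      exact mul_le_mul_of_nonneg_right (integral_poisson_le hε u) (by positivity)
  have hf2 : ∫ p : I01 × I01, P p * ‖g p.2‖ ^ 2 = ∫ p : I01 × I01, P p * ‖g p.1‖ ^ 2 := by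
    rw [Measure.volume_eq_prod, ← integral_prod_swap]
    congr 1
    funext p
    simp only [hP, Prod.fst_swap, Prod.snd_swap]
    ring
  have hs : ∫ p : I01 × I01, P p * ((‖g p.1‖ ^ 2 + ‖g p.2‖ ^ 2) / 2) =
      ∫ p : I01 × I01, P p * ‖g p.1‖ ^ 2 := by
    have : ∫ p : I01 × I01, P p * ((‖g p.1‖ ^ 2 + ‖g p.2‖ ^ 2) / 2) =
        2⁻¹ * (∫ p : I01 × I01, P p * ‖g p.1‖ ^ 2) + 2⁻¹ * ∫ p : I01 × I01, P p * ‖g p.2‖ ^ 2 := by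
      rw [← integral_const_mul, ← integral_const_mul, ← integral_add
        (integrable_of_continuous_compact (by fun_prop)) (integrable_of_continuous_compact (by fun_prop))]
      congr 1
      funext p
      ring
    rw [this, hf2]
    ring
  have hre := congrArg re hsum
  rw [add_re] at hre
  have hle := (re_le_norm (∫ p : I01 × I01, (starRingEnd ℂ) (g p.1) * (P p : ℂ) * g p.2)).trans hb
  rw [hs] at hle
  linarith

section
variable {E : Type*} [NormedAddCommGroup E] [NormedSpace ℝ E]

/-- The power measure has density `B u ^ (B - 1)` with respect to Lebesgue measure. -/
lemma integral_muI_eq_volume {B : ℝ} (hB : 0 < B) {f : I01 → E} (hf : Continuous f) :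
    ∫ u, f u ∂(muI B) = ∫ u : I01, (B * (u : ℝ) ^ (B - 1)) • f u := by
  set F : ℝ → E := fun x => f (projIcc 0 1 zero_le_one x) with hF
  have hFc : Continuous F := hf.comp continuous_projIcc
  have hFf : ∀ u : I01, F u = f u := fun u => by simp [hF]
  have h1 := integral_muI_coe hB hFc
  simp only [hFf] at h1
  have h2 := integral_comp_rpow_Ioi (indicator (Ioc 0 1) fun y => F (y ^ (1 / B))) hB.ne'
  have h3 : ∫ u : I01, (B * (u : ℝ) ^ (B - 1)) • f u =
      ∫ x in Icc (0 : ℝ) 1, (B * x ^ (B - 1)) • F x := by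
    rw [← integral_subtype_comap measurableSet_Icc fun x => (B * x ^ (B - 1)) • F x]
    rw [unitInterval.volume_def]
    simp only [← hFf]
  rw [h1, h3, intervalIntegral.integral_of_le zero_le_one, integral_Icc_eq_integral_Ioc]
  have h4 : ∫ y in Ioi (0 : ℝ), indicator (Ioc 0 1) (fun y => F (y ^ (1 / B))) y =
      ∫ y in Ioc (0 : ℝ) 1, F (y ^ (1 / B)) := by
    rw [setIntegral_indicator measurableSet_Ioc, inter_eq_right.2 Ioc_subset_Ioi_self]
  have h5 : ∫ x in Ioi (0 : ℝ), (|B| * x ^ (B - 1)) •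
      indicator (Ioc 0 1) (fun y => F (y ^ (1 / B))) (x ^ B) =
      ∫ x in Ioc (0 : ℝ) 1, (B * x ^ (B - 1)) • F x := by
    have : ∀ x ∈ Ioi (0 : ℝ), (|B| * x ^ (B - 1)) •
        indicator (Ioc 0 1) (fun y => F (y ^ (1 / B))) (x ^ B) =
        indicator (Ioc 0 1) (fun x => (B * x ^ (B - 1)) • F x) x := by
      intro x hx
      have hx0 : (0 : ℝ) < x := hx
      have hm : x ^ B ∈ Ioc (0 : ℝ) 1 ↔ x ∈ Ioc (0 : ℝ) 1 := by
        constructor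
        · rintro ⟨_, h⟩
          refine ⟨hx, ?_⟩
          by_contra hc
          exact absurd h (not_le.2 (Real.one_lt_rpow (not_le.1 hc) hB))
        · rintro ⟨_, h⟩
          exact ⟨Real.rpow_pos_of_pos hx0 _, Real.rpow_le_one hx0.le h hB.le⟩
      by_cases h : x ∈ Ioc (0 : ℝ) 1
      · rw [indicator_of_mem h, indicator_of_mem (hm.2 h), abs_of_pos hB, ← Real.rpow_mul hx0.le,
          mul_one_div_cancel hB.ne', Real.rpow_one]
      · rw [indicator_of_notMem h, indicator_of_notMem (fun hc => h (hm.1 hc)), smul_zero]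
    rw [setIntegral_congr_fun measurableSet_Ioi this, setIntegral_indicator measurableSet_Ioc,
      inter_eq_right.2 Ioc_subset_Ioi_self]
  rw [← h4, ← h2, h5]

end

/-- The point `max u η + i ε` above the unit interval. -/
def zShift (η ε : ℝ) (u : I01) : ℂ := ((max (u : ℝ) η : ℝ) : ℂ) + I * ε

/-- The point `-2 i (max u η + i ε)`. -/
def zetaShift (η ε : ℝ) (u : I01) : ℂ := -(2 * I * zShift η ε u)

lemma continuous_zShift (η ε : ℝ) : Continuous (zShift η ε) := by unfold zShift; fun_prop

lemma zetaShift_eq (η ε : ℝ) (u : I01) :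
    zetaShift η ε u = ((2 * ε : ℝ) : ℂ) + ((-2 * max (u : ℝ) η : ℝ) : ℂ) * I := by
  rw [zetaShift, zShift]
  push_cast
  linear_combination (-2 * ε : ℂ) * I_sq

lemma zetaShift_re (η ε : ℝ) (u : I01) : (zetaShift η ε u).re = 2 * ε := by
  rw [zetaShift_eq]; simp

lemma norm_zetaShift_le {η ε : ℝ} (hη : 0 < η) (hε : 0 < ε) (u : I01) :
    ‖zetaShift η ε u‖ ≤ 2 * ε + 2 * (1 + η) := by
  rw [zetaShift_eq]
  refine (norm_add_le _ _).trans ?_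
  rw [norm_mul, norm_I, mul_one, norm_real, norm_real, Real.norm_of_nonneg (by positivity),
    Real.norm_eq_abs, neg_mul, abs_neg, abs_of_nonneg (by positivity)]
  have : max (u : ℝ) η ≤ 1 + η := max_le (by linarith [u.2.2]) (by linarith)
  linarith

lemma zShift_sub_conj_ne {η ε : ℝ} (hε : 0 < ε) (u v : I01) :
    zShift η ε u - (starRingEnd ℂ) (zShift η ε v) ≠ 0 := fun h => by
  have := congrArg im h
  simp [zShift] at this
  linarith

lemma norm_I_div_le {η ε : ℝ} (hε : 0 < ε) (u v : I01) :
    ‖I / (zShift η ε u - (starRingEnd ℂ) (zShift η ε v))‖ ≤ 1 / (2 * ε) := by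
  rw [norm_div, norm_I]
  gcongr
  have h := abs_im_le_norm (zShift η ε u - (starRingEnd ℂ) (zShift η ε v))
  have e : (zShift η ε u - (starRingEnd ℂ) (zShift η ε v)).im = 2 * ε := by
    simp [zShift]; ring
  rw [e] at h
  exact (le_abs_self _).trans h

section

variable {s : ℂ} (hs : -(1 / 2 : ℝ) < s.re)

/-- The shifted and rescaled kernel. -/
def nK (s : ℂ) (η ε t : ℝ) (p : I01 × I01) : ℂ :=
  cexp (t * (I * (zShift η ε p.1 - (starRingEnd ℂ) (zShift η ε p.2)))) * (((t ^ Bs s : ℝ) : ℂ) *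
    hker s (t * zShift η ε p.1) (t * (starRingEnd ℂ) (zShift η ε p.2)))

/-- The limit of `nK` as the scale tends to infinity. -/
def nKinf (s : ℂ) (η ε : ℝ) (p : I01 × I01) : ℂ :=
  (Bs s / 2 : ℂ) * (I / (zShift η ε p.1 - (starRingEnd ℂ) (zShift η ε p.2))) *
    ((Complex.Gamma (Bs s) / Complex.Gamma ((starRingEnd ℂ) s + 1) * zetaShift η ε p.1 ^ (-s)) *
      (starRingEnd ℂ) (Complex.Gamma (Bs s) / Complex.Gamma ((starRingEnd ℂ) s + 1) *
        zetaShift η ε p.2 ^ (-s)))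

include hs

lemma continuous_nK_uncurry (η : ℝ) {t : ℝ} :
    Continuous fun q : ℝ × (I01 × I01) => nK s η q.1 t q.2 := by
  have h := continuous_hker hs
  have h1 : Continuous fun q : ℝ × (I01 × I01) => zShift η q.1 q.2.1 := by unfold zShift; fun_prop
  have h2 : Continuous fun q : ℝ × (I01 × I01) => (starRingEnd ℂ) (zShift η q.1 q.2.2) :=
    continuous_conj.comp (by unfold zShift; fun_prop)
  have h3 : Continuous fun q : ℝ × (I01 × I01) => hker s (t * zShift η q.1 q.2.1)
      (t * (starRingEnd ℂ) (zShift η q.1 q.2.2)) :=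
    h.comp (f := fun q : ℝ × (I01 × I01) => ((t : ℂ) * zShift η q.1 q.2.1,
      (t : ℂ) * (starRingEnd ℂ) (zShift η q.1 q.2.2))) (by fun_prop)
  unfold nK
  fun_prop

lemma continuous_nK (η ε t : ℝ) : Continuous (nK s η ε t) :=
  (continuous_nK_uncurry hs η (t := t)).comp (f := fun p : I01 × I01 => (ε, p)) (by fun_prop)

omit hs in
lemma cexp_mul_pf (z : ℂ) : cexp (I * z) * pf s z = oneF1 s (Bs s) (2 * I * z) := by
  rw [pf, ← mul_assoc, ← exp_add, add_neg_cancel, exp_zero, one_mul]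

omit hs in
lemma cexp_mul_pg (z : ℂ) : cexp (I * z) * pg s z = oneF1 (s + 1) (Bs s) (2 * I * z) := by
  rw [pg, ← mul_assoc, ← exp_add, add_neg_cancel, exp_zero, one_mul]

lemma conj_oneF1_shift (z : ℂ) : (starRingEnd ℂ) (oneF1 (s + 1) (Bs s) (2 * I * z)) =
    cexp (-(I * (starRingEnd ℂ) z)) * pf s ((starRingEnd ℂ) z) := by
  rw [← cexp_mul_pg, map_mul, ← exp_conj, conj_pg hs, map_mul, conj_I, neg_mul]

lemma conj_oneF1_shift' (z : ℂ) : (starRingEnd ℂ) (oneF1 s (Bs s) (2 * I * z)) =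
    cexp (-(I * (starRingEnd ℂ) z)) * pg s ((starRingEnd ℂ) z) := by
  rw [← cexp_mul_pf, map_mul, ← exp_conj, conj_pf hs, map_mul, conj_I, neg_mul]

lemma hasDerivAt_nK (η ε : ℝ) {t : ℝ} (ht : 0 < t) (p : I01 × I01) :
    HasDerivAt (fun t => nK s η ε t p) (((Bs s * t ^ (2 * s.re) : ℝ) : ℂ) *
      (oneF1 (s + 1) (Bs s) (2 * I * (t * zShift η ε p.1)) *
        (starRingEnd ℂ) (oneF1 (s + 1) (Bs s) (2 * I * (t * zShift η ε p.2))))) t := by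
  set α := zShift η ε p.1
  set β := (starRingEnd ℂ) (zShift η ε p.2) with hβ
  have h1 := hasDerivAt_rpow_mul_hker hs ht α β
  have h2 : HasDerivAt (fun t : ℝ => (t : ℂ) * (I * (α - β))) (1 * (I * (α - β))) t :=
    (hasDerivAt_id t).ofReal_comp.mul_const _
  refine (h2.cexp.mul h1).congr_deriv ?_
  rw [conj_oneF1_shift hs, ← cexp_mul_pg, map_mul, conj_ofReal, ← hβ]
  have h3 := sub_mul_hker hs (t * α) (t * β)
  have e1 : cexp ((t : ℂ) * (I * (α - β))) = cexp (I * (t * α)) * cexp (-(I * (t * β))) := by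
    rw [← exp_add]; congr 1; ring
  have e2 : t ^ Bs s = t ^ (2 * s.re) * t := by
    rw [Bs, Real.rpow_add ht, Real.rpow_one]
  rw [e1, e2]
  generalize cexp (I * (t * α)) = E1
  generalize cexp (-(I * (t * β))) = E2
  generalize pf s (t * α) = a1 at h3 ⊢
  generalize pf s (t * β) = a2 at h3 ⊢
  generalize pg s (t * α) = b1 at h3 ⊢
  generalize pg s (t * β) = b2 at h3 ⊢
  generalize hker s (t * α) (t * β) = k at h3 ⊢
  push_cast
  generalize (((t ^ (2 * s.re) : ℝ)) : ℂ) = T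
  linear_combination (E1 * E2 * I * T) * h3 + (E1 * E2 * T * Bs s / 2 * (a1 * b2 - b1 * a2)) * I_sq

lemma nK_eq {η ε : ℝ} (hε : 0 < ε) {t : ℝ} (ht : 0 < t) (p : I01 × I01) :
    nK s η ε t p = (Bs s / 2 : ℂ) *
      (I / (zShift η ε p.1 - (starRingEnd ℂ) (zShift η ε p.2))) *
      (((t : ℂ) ^ s * oneF1 s (Bs s) (-(t * zetaShift η ε p.1))) *
        (starRingEnd ℂ) ((t : ℂ) ^ s * oneF1 s (Bs s) (-(t * zetaShift η ε p.2))) -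
      ((t : ℂ)⁻¹ * ((t : ℂ) ^ (s + 1) * oneF1 (s + 1) (Bs s) (-(t * zetaShift η ε p.1)))) *
        (starRingEnd ℂ) ((t : ℂ)⁻¹ * ((t : ℂ) ^ (s + 1) *
          oneF1 (s + 1) (Bs s) (-(t * zetaShift η ε p.2))))) := by
  have hne := zShift_sub_conj_ne (η := η) hε p.1 p.2
  have ht' : (t : ℂ) ≠ 0 := ofReal_ne_zero.2 ht.ne'
  have ez : ∀ u, -((t : ℂ) * zetaShift η ε u) = 2 * I * (t * zShift η ε u) := fun u => by
    rw [zetaShift]; ring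
  have es : (t : ℂ)⁻¹ * (t : ℂ) ^ (s + 1) = (t : ℂ) ^ s := by
    rw [cpow_add _ _ ht', cpow_one]; field_simp
  have ec : (t : ℂ) ^ s * (starRingEnd ℂ) ((t : ℂ) ^ s) = ((t ^ (2 * s.re) : ℝ) : ℂ) := by
    rw [mul_conj, normSq_eq_norm_sq, norm_cpow_eq_rpow_re_of_pos ht, ← Real.rpow_natCast,
      ← Real.rpow_mul ht.le]
    push_cast
    rw [mul_comm]
  simp only [← mul_assoc (t : ℂ)⁻¹, es, ez]
  simp only [map_mul (starRingEnd ℂ) ((t : ℂ) ^ s)]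
  rw [conj_oneF1_shift hs, conj_oneF1_shift' hs, ← cexp_mul_pg, ← cexp_mul_pf, nK]
  simp only [map_mul (starRingEnd ℂ) (t : ℂ), conj_ofReal]
  set α := zShift η ε p.1
  set β := (starRingEnd ℂ) (zShift η ε p.2) with hβ
  have h3 := sub_mul_hker hs (t * α) (t * β)
  have e1 : cexp ((t : ℂ) * (I * (α - β))) = cexp (I * (t * α)) * cexp (-(I * (t * β))) := by
    rw [← exp_add]; congr 1; ring
  have e2 : t ^ Bs s = t ^ (2 * s.re) * t := by
    rw [Bs, Real.rpow_add ht, Real.rpow_one]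
  rw [e1, e2]
  generalize cexp (I * (t * α)) = E1
  generalize cexp (-(I * (t * β))) = E2
  generalize pf s (t * α) = a1 at h3 ⊢
  generalize pf s (t * β) = a2 at h3 ⊢
  generalize pg s (t * α) = b1 at h3 ⊢
  generalize pg s (t * β) = b2 at h3 ⊢
  generalize hker s (t * α) (t * β) = k at h3 ⊢
  push_cast
  rw [← mul_right_inj' hne]
  generalize (starRingEnd ℂ) ((t : ℂ) ^ s) = T2 at ec ⊢
  generalize (t : ℂ) ^ s = T1 at ec ⊢
  generalize (((t ^ (2 * s.re) : ℝ)) : ℂ) = T at ec ⊢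
  subst ec
  field_simp
  linear_combination (2 * E1 * E2 * T1 * T2) * h3

lemma norm_nK_le {η ε : ℝ} (hη : 0 < η) (hε : 0 < ε) :
    ∃ C, ∀ t, 1 ≤ t → ∀ p, ‖nK s η ε t p‖ ≤ C := by
  obtain ⟨C1, h1⟩ := exists_norm_Bs_le hs (δ := 2 * ε) (by positivity) (2 * ε + 2 * (1 + η))
  obtain ⟨C2, h2⟩ := exists_norm_succ_le hs (δ := 2 * ε) (by positivity) (2 * ε + 2 * (1 + η))
  have hB := Bs_pos hs
  refine ⟨Bs s / 2 * (1 / (2 * ε)) * (C1 * C1 + C2 * C2), fun t ht p => ?_⟩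
  have ht0 : 0 < t := zero_lt_one.trans_le ht
  have b1 : ∀ u, ‖(t : ℂ) ^ s * oneF1 s (Bs s) (-(t * zetaShift η ε u))‖ ≤ C1 := fun u =>
    h1 _ (zetaShift_re η ε u) (norm_zetaShift_le hη hε u) t ht
  have b2 : ∀ u, ‖(t : ℂ)⁻¹ * ((t : ℂ) ^ (s + 1) *
      oneF1 (s + 1) (Bs s) (-(t * zetaShift η ε u)))‖ ≤ C2 := fun u => by
    rw [norm_mul, norm_inv, norm_real, Real.norm_of_nonneg ht0.le]
    exact (mul_le_of_le_one_left (norm_nonneg _) (inv_le_one_of_one_le₀ ht)).trans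
      (h2 _ (zetaShift_re η ε u) (norm_zetaShift_le hη hε u) t ht0)
  have p1 : 0 ≤ C1 := (norm_nonneg _).trans (b1 p.1)
  have p2 : 0 ≤ C2 := (norm_nonneg _).trans (b2 p.1)
  rw [nK_eq hs hε ht0]
  have eB : ‖(Bs s / 2 : ℂ)‖ = Bs s / 2 := by
    rw [norm_div, norm_real, Real.norm_of_nonneg hB.le, RCLike.norm_ofNat]
  rw [norm_mul, norm_mul, eB]
  refine mul_le_mul (mul_le_mul_of_nonneg_left (norm_I_div_le hε _ _) (by positivity)) ?_
    (norm_nonneg _) (by positivity)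
  refine (norm_sub_le _ _).trans (add_le_add ?_ ?_)
  · rw [norm_mul, RCLike.norm_conj]
    exact mul_le_mul (b1 p.1) (b1 p.2) (norm_nonneg _) p1
  · rw [norm_mul, RCLike.norm_conj]
    exact mul_le_mul (b2 p.1) (b2 p.2) (norm_nonneg _) p2

lemma tendsto_nK {η ε : ℝ} (hε : 0 < ε) (p : I01 × I01) :
    Tendsto (fun t => nK s η ε t p) atTop (𝓝 (nKinf s η ε p)) := by
  have a : ∀ u, 0 < (zetaShift η ε u).re := fun u => by rw [zetaShift_re]; positivity
  have h1 := tendsto_Bs hs (a p.1)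
  have h2 := (continuous_conj.tendsto _).comp (tendsto_Bs hs (a p.2))
  have h3 := tendsto_inv_mul_succ hs (a p.1)
  have h4 := (continuous_conj.tendsto _).comp (tendsto_inv_mul_succ hs (a p.2))
  have h := ((h1.mul h2).sub (h3.mul h4)).const_mul
    ((Bs s / 2 : ℂ) * (I / (zShift η ε p.1 - (starRingEnd ℂ) (zShift η ε p.2))))
  rw [zero_mul, sub_zero] at h
  refine h.congr' ((eventually_gt_atTop 0).mono fun t ht => ?_)
  exact (nK_eq hs hε ht p).symm

lemma quadK_nK_le {η ε : ℝ} (hη : 0 < η) (hε : 0 < ε) {g : I01 → ℂ} (hg : Continuous g) {t : ℝ}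
    (ht : 0 < t) :
    haveI := isProbabilityMeasure_muI (Bs_pos hs)
    (quadK (muI (Bs s)) (nK s η ε t) g).re ≤ (quadK (muI (Bs s)) (nKinf s η ε) g).re := by
  have := isProbabilityMeasure_muI (Bs_pos hs)
  obtain ⟨C, hC⟩ := norm_nK_le hs hη hε
  have hz := continuous_zShift η ε
  refine quadK_le_of_tendsto (muI (Bs s)) (w := fun t => Bs s * t ^ (2 * s.re))
    (ψ := fun q => oneF1 (s + 1) (Bs s) (2 * I * (q.1 * zShift η ε q.2)))
    (fun t _ => continuous_nK hs η ε t) ?_ ?_ ?_ (fun t ht p => hasDerivAt_nK hs η ε ht p) hC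
    (tendsto_nK hs hε) hg ht
  · exact continuousOn_const.mul (continuousOn_id.rpow_const fun x hx => Or.inl (ne_of_gt hx))
  · exact fun t ht => mul_nonneg (Bs_pos hs).le (Real.rpow_nonneg ht.le _)
  · exact (continuous_oneF1 (Bs_ne hs) (s + 1)).comp (by fun_prop)

end

lemma continuous_max_rpow {η : ℝ} (hη : 0 < η) (b : ℝ) :
    Continuous fun u : I01 => (max (u : ℝ) η) ^ b :=
  Continuous.rpow_const (by fun_prop) fun u => Or.inl (lt_max_of_lt_right hη).ne'

lemma quadK_eq_iterated (μ : Measure I01) [IsProbabilityMeasure μ] {N : I01 × I01 → ℂ}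
    (hN : Continuous N) {g : I01 → ℂ} (hg : Continuous g) :
    quadK μ N g = ∫ u, ∫ v, (starRingEnd ℂ) (g u) * N (u, v) * g v ∂μ ∂μ := by
  have hgc : Continuous fun u => (starRingEnd ℂ) (g u) := continuous_conj.comp hg
  rw [quadK, integral_prod _ (integrable_of_continuous_compact (by fun_prop))]

/-- A Hermitian form for the power measure, on functions supported away from the origin, written
with respect to Lebesgue measure. -/
lemma quadK_muI_eq {B : ℝ} (hB : 0 < B) {N : I01 × I01 → ℂ} (hN : Continuous N) {g : I01 → ℂ}
    (hg : Continuous g) {η : ℝ} (hη : 0 < η) (hg0 : ∀ u : I01, (u : ℝ) ≤ η → g u = 0) :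
    haveI := isProbabilityMeasure_muI hB
    quadK (muI B) N g =
      quadK volume N fun u => ((B * (max (u : ℝ) η) ^ (B - 1) : ℝ) : ℂ) * g u := by
  have := isProbabilityMeasure_muI hB
  have hW := continuous_max_rpow hη (B - 1)
  have hgc : Continuous fun u => (starRingEnd ℂ) (g u) := continuous_conj.comp hg
  have e : ∀ u : I01, (((B * (u : ℝ) ^ (B - 1) : ℝ) : ℂ)) * g u =
      ((B * (max (u : ℝ) η) ^ (B - 1) : ℝ) : ℂ) * g u := fun u => by
    rcases le_or_gt (u : ℝ) η with h | h
    · rw [hg0 u h, mul_zero, mul_zero]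
    · rw [max_eq_left h.le]
  have ec : ∀ u : I01, (((B * (u : ℝ) ^ (B - 1) : ℝ) : ℂ)) * (starRingEnd ℂ) (g u) =
      ((B * (max (u : ℝ) η) ^ (B - 1) : ℝ) : ℂ) * (starRingEnd ℂ) (g u) := fun u => by
    have := congrArg (starRingEnd ℂ) (e u)
    simpa only [map_mul, conj_ofReal] using this
  have hin : ∀ u, Continuous fun v => (starRingEnd ℂ) (g u) * N (u, v) * g v := fun u => by fun_prop
  have hin' : Continuous fun u => ∫ v, (starRingEnd ℂ) (g u) * N (u, v) * g v ∂(muI B) := by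
    refine continuous_parametric_integral_of_continuous (s := univ) (μ := muI B)
      (f := fun u v => (starRingEnd ℂ) (g u) * N (u, v) * g v) ?_ isCompact_univ |>.congr ?_
    · unfold Function.uncurry; fun_prop
    · intro u; rw [Measure.restrict_univ]
  have hGc : Continuous fun u : I01 => ((B * (max (u : ℝ) η) ^ (B - 1) : ℝ) : ℂ) * g u :=
    (continuous_ofReal.comp (continuous_const.mul hW)).mul hg
  rw [quadK_eq_iterated _ hN hg, quadK_eq_iterated _ hN hGc, integral_muI_eq_volume hB hin']
  refine integral_congr_ae (.of_forall fun u => ?_)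
  beta_reduce
  rw [integral_muI_eq_volume hB (hin u), ← integral_smul]
  refine integral_congr_ae (.of_forall fun v => ?_)
  beta_reduce
  rw [real_smul, real_smul, map_mul, conj_ofReal]
  linear_combination ((((B * (u : ℝ) ^ (B - 1) : ℝ) : ℂ)) * (starRingEnd ℂ) (g u) * N (u, v)) * e v
    + (N (u, v) * (((B * (max (v : ℝ) η) ^ (B - 1) : ℝ) : ℂ) * g v)) * ec u

section

variable {s : ℂ} (hs : -(1 / 2 : ℝ) < s.re)

lemma zetaShift_mem {η : ℝ} (hη : 0 < η) (ε : ℝ) (u : I01) : zetaShift η ε u ∈ slitPlane := by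
  refine Or.inr ?_
  rw [zetaShift_eq]
  simp only [add_im, ofReal_im, mul_im, ofReal_re, I_im, I_re, mul_one, mul_zero, add_zero, zero_add]
  have : 0 < max (u : ℝ) η := lt_max_of_lt_right hη
  linarith

lemma continuous_zetaShift_cpow {η : ℝ} (hη : 0 < η) (w : ℂ) :
    Continuous fun q : ℝ × I01 => zetaShift η q.1 q.2 ^ w := by
  refine Continuous.cpow ?_ continuous_const fun q => zetaShift_mem hη _ _
  unfold zetaShift zShift
  fun_prop

lemma norm_zetaShift_zero_cpow {η : ℝ} (hη : 0 < η) (u : I01) :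
    ‖zetaShift η 0 u ^ (-s)‖ ^ 2 =
      4 ^ (-s.re) * Real.exp (-(Real.pi * s.im)) * (max (u : ℝ) η) ^ (-(2 * s.re)) := by
  have hm : 0 < max (u : ℝ) η := lt_max_of_lt_right hη
  have e : zetaShift η 0 u = ((2 * max (u : ℝ) η : ℝ) : ℂ) * (-I) := by
    rw [zetaShift_eq]; push_cast; ring
  have hne : zetaShift η 0 u ≠ 0 := slitPlane_ne_zero (zetaShift_mem hη 0 u)
  rw [norm_cpow_of_ne_zero hne, e, arg_real_mul _ (by positivity), arg_neg_I, norm_mul, norm_neg,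
    norm_I, mul_one, norm_real, Real.norm_of_nonneg (by positivity), div_pow, ← Real.exp_nat_mul,
    ← Real.rpow_natCast, ← Real.rpow_mul (by positivity), neg_re, neg_im,
    Real.mul_rpow (by norm_num) hm.le, div_eq_mul_inv, ← Real.exp_neg]
  have e4 : (4 : ℝ) ^ (-s.re) = 2 ^ (-s.re * ((2 : ℕ) : ℝ)) := by
    rw [show (4 : ℝ) = 2 ^ (2 : ℝ) by norm_num, ← Real.rpow_mul (by norm_num)]
    congr 1; push_cast; ring
  rw [e4]
  have e5 : -(2 * s.re) = -s.re * ((2 : ℕ) : ℝ) := by push_cast; ring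
  have e6 : -(((2 : ℕ) : ℝ) * (-(Real.pi / 2) * -s.im)) = -(Real.pi * s.im) := by push_cast; ring
  rw [e5, e6]
  ring

/-- The Gamma factor in `nKinf`. -/
def gamQ (s : ℂ) : ℂ := Complex.Gamma (Bs s) / Complex.Gamma ((starRingEnd ℂ) s + 1)

include hs

lemma quadK_nKinf_le {η ε : ℝ} (hη : 0 < η) (hε : 0 < ε) {g : I01 → ℂ} (hg : Continuous g)
    (hg0 : ∀ u : I01, (u : ℝ) ≤ η → g u = 0) :
    (quadK volume (nKinf s η ε) g).re ≤
      Real.pi * Bs s * ∫ u : I01, ‖g u‖ ^ 2 * ‖gamQ s * zetaShift η ε u ^ (-s)‖ ^ 2 := by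
  have hB := Bs_pos hs
  have hζ : Continuous fun u : I01 => zetaShift η ε u ^ (-s) :=
    (continuous_zetaShift_cpow hη (-s)).comp (f := fun u : I01 => (ε, u)) (by fun_prop)
  set h : I01 → ℂ := fun u => g u * (starRingEnd ℂ) (gamQ s * zetaShift η ε u ^ (-s)) with hh
  have hc : Continuous h := hg.mul (continuous_conj.comp (by fun_prop))
  have e : quadK volume (nKinf s η ε) g = ((Bs s / 2 : ℝ) : ℂ) * quadK volume (cauchyK ε) h := by
    rw [quadK, quadK, ← integral_const_mul]
    refine integral_congr_ae (.of_forall fun p => ?_)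
    beta_reduce
    rcases le_or_gt (p.1 : ℝ) η with h1 | h1
    · simp [hh, hg0 _ h1]
    rcases le_or_gt (p.2 : ℝ) η with h2 | h2
    · simp [hh, hg0 _ h2]
    have ez : zShift η ε p.1 - (starRingEnd ℂ) (zShift η ε p.2) =
        ((p.1 : ℝ) : ℂ) - ((p.2 : ℝ) : ℂ) + 2 * I * ε := by
      simp only [zShift, max_eq_left h1.le, max_eq_left h2.le, map_add, map_mul, conj_ofReal, conj_I]
      ring
    rw [nKinf, ez, cauchyK, hh]
    simp only [map_mul, conj_conj, gamQ]
    push_cast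
    ring
  rw [e, re_ofReal_mul]
  have hle := mul_le_mul_of_nonneg_left (quadK_cauchyK_le hε hc) (by positivity : 0 ≤ Bs s / 2)
  refine hle.trans (le_of_eq ?_)
  simp only [hh, norm_mul _ ((starRingEnd ℂ) _), RCLike.norm_conj, mul_pow ‖g _‖]
  ring

lemma continuous_quadK_nK (η t : ℝ) {g : I01 → ℂ} (hg : Continuous g) :
    haveI := isProbabilityMeasure_muI (Bs_pos hs)
    Continuous fun ε => quadK (muI (Bs s)) (nK s η ε t) g := by
  have := isProbabilityMeasure_muI (Bs_pos hs)
  have hgc : Continuous fun u => (starRingEnd ℂ) (g u) := continuous_conj.comp hg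
  have hN := continuous_nK_uncurry hs η (t := t)
  refine continuous_parametric_integral_of_continuous (s := univ)
    (μ := (muI (Bs s)).prod (muI (Bs s)))
    (f := fun ε p => (starRingEnd ℂ) (g p.1) * nK s η ε t p * g p.2) ?_ isCompact_univ |>.congr ?_
  · unfold Function.uncurry; fun_prop
  · intro u; rw [Measure.restrict_univ]; rfl

lemma quadK_nK_zero_le {η : ℝ} (hη : 0 < η) {g : I01 → ℂ} (hg : Continuous g)
    (hg0 : ∀ u : I01, (u : ℝ) ≤ η → g u = 0) {t : ℝ} (ht : 0 < t) :
    haveI := isProbabilityMeasure_muI (Bs_pos hs)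
    (quadK (muI (Bs s)) (nK s η 0 t) g).re ≤
      Real.pi * Bs s * ‖gamQ s‖ ^ 2 * (4 ^ (-s.re) * Real.exp (-(Real.pi * s.im))) * Bs s *
        ∫ u, ‖g u‖ ^ 2 ∂(muI (Bs s)) := by
  have := isProbabilityMeasure_muI (Bs_pos hs)
  have hB := Bs_pos hs
  have hW := continuous_max_rpow hη (Bs s - 1)
  set G : I01 → ℂ := fun u => ((Bs s * (max (u : ℝ) η) ^ (Bs s - 1) : ℝ) : ℂ) * g u with hG
  have hGc : Continuous G := by fun_prop
  have hG0 : ∀ u : I01, (u : ℝ) ≤ η → G u = 0 := fun u h => by rw [hG]; simp [hg0 u h]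
  have hζ := continuous_zetaShift_cpow hη (-s)
  have hR : Continuous fun ε => Real.pi * Bs s *
      ∫ u : I01, ‖G u‖ ^ 2 * ‖gamQ s * zetaShift η ε u ^ (-s)‖ ^ 2 := by
    refine continuous_const.mul ((continuous_parametric_integral_of_continuous (s := univ)
      (μ := (volume : Measure I01))
      (f := fun ε u => ‖G u‖ ^ 2 * ‖gamQ s * zetaShift η ε u ^ (-s)‖ ^ 2) ?_ isCompact_univ).congr ?_)
    · unfold Function.uncurry; fun_prop
    · intro u; rw [Measure.restrict_univ]
  have hL := continuous_re.comp (continuous_quadK_nK hs η t hg)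
  have key := le_of_tendsto_of_tendsto (hL.continuousWithinAt (s := Ioi 0) (x := 0)).tendsto
    (hR.continuousWithinAt (s := Ioi 0) (x := 0)).tendsto (by
      filter_upwards [self_mem_nhdsWithin] with ε hε
      refine (quadK_nK_le hs hη hε hg ht).trans ?_
      have hc : Continuous (nKinf s η ε) := by
        have hz := continuous_zShift η ε
        have h1 : Continuous fun u : I01 => zetaShift η ε u ^ (-s) :=
          hζ.comp (f := fun u : I01 => (ε, u)) (by fun_prop)
        have h2 : Continuous fun p : I01 × I01 => (starRingEnd ℂ) (zShift η ε p.2) :=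
          continuous_conj.comp (by fun_prop)
        have h3 : Continuous fun p : I01 × I01 =>
            (starRingEnd ℂ) (Complex.Gamma (Bs s) / Complex.Gamma ((starRingEnd ℂ) s + 1) *
              zetaShift η ε p.2 ^ (-s)) := continuous_conj.comp
              (continuous_const.mul (h1.comp continuous_snd))
        have h4 : Continuous fun p : I01 × I01 =>
            I / (zShift η ε p.1 - (starRingEnd ℂ) (zShift η ε p.2)) :=
          Continuous.div continuous_const (by fun_prop) fun p => zShift_sub_conj_ne hε _ _
        exact (continuous_const.mul h4).mul
          ((continuous_const.mul (h1.comp continuous_fst)).mul h3)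
      rw [quadK_muI_eq hB hc hg hη hg0]
      exact quadK_nKinf_le hs hη hε hGc hG0)
  refine key.trans (le_of_eq ?_)
  rw [integral_muI_eq_volume hB (f := fun u => ‖g u‖ ^ 2) (by fun_prop), mul_assoc _ _ (∫ u, _),
    mul_assoc _ _ (_ * _), mul_assoc _ _ (_ * _), ← integral_const_mul, ← integral_const_mul,
    ← integral_const_mul]
  refine integral_congr_ae (.of_forall fun u => ?_)
  beta_reduce
  rcases le_or_gt (u : ℝ) η with h1 | h1
  · simp [hG, hg0 _ h1]
  rw [norm_mul (gamQ s), mul_pow, norm_zetaShift_zero_cpow hη, hG]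
  beta_reduce
  rw [max_eq_left h1.le, norm_mul, norm_real, mul_pow, Real.norm_eq_abs, sq_abs, smul_eq_mul]
  have hu : (0 : ℝ) < u := hη.trans h1
  have e1 : Bs s - 1 = 2 * s.re := by rw [Bs]; ring
  have e2 : (u : ℝ) ^ (2 * s.re) * (u : ℝ) ^ (-(2 * s.re)) = 1 := by
    rw [← Real.rpow_add hu, add_neg_cancel, Real.rpow_zero]
  rw [e1]
  linear_combination (Bs s ^ 2 * (u : ℝ) ^ (2 * s.re) * ‖g u‖ ^ 2 * ‖gamQ s‖ ^ 2 *
    (4 ^ (-s.re) * Real.exp (-(Real.pi * s.im))) * (Real.pi * Bs s)) * e2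

end

section

variable {s : ℂ} (hs : -(1 / 2 : ℝ) < s.re)

/-- The normalization constant of the limiting kernel. -/
def c0 (s : ℂ) : ℝ := Real.exp (Real.pi * s.im) * 4 ^ s.re * ‖Complex.Gamma (s + 1)‖ ^ 2 /
  (Real.pi * Bs s * ‖Complex.Gamma (Bs s)‖ ^ 2)

include hs

lemma Gamma_succ_ne : Complex.Gamma (s + 1) ≠ 0 := by
  refine Complex.Gamma_ne_zero_of_re_pos ?_
  simp
  linarith

lemma Gamma_Bs_ne : Complex.Gamma (Bs s) ≠ 0 := by
  refine Complex.Gamma_ne_zero_of_re_pos ?_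
  simpa using Bs_pos hs

lemma c0_pos : 0 < c0 s := by
  have h1 := norm_pos_iff.2 (Gamma_succ_ne hs)
  have h2 := norm_pos_iff.2 (Gamma_Bs_ne hs)
  have h3 := Bs_pos hs
  have := Real.pi_pos
  unfold c0
  positivity

lemma c0_mul : c0 s / Bs s * (Real.pi * Bs s * ‖gamQ s‖ ^ 2 *
    (4 ^ (-s.re) * Real.exp (-(Real.pi * s.im))) * Bs s) = 1 := by
  have h1 := norm_pos_iff.2 (Gamma_succ_ne hs)
  have h2 := norm_pos_iff.2 (Gamma_Bs_ne hs)
  have h3 := Bs_pos hs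
  have e : Complex.Gamma ((starRingEnd ℂ) s + 1) = (starRingEnd ℂ) (Complex.Gamma (s + 1)) := by
    rw [← Complex.Gamma_conj, map_add, map_one]
  have := Real.pi_pos
  have h4 : (0 : ℝ) < 4 ^ s.re := by positivity
  rw [gamQ, e, norm_div, RCLike.norm_conj, c0, Real.exp_neg, Real.rpow_neg (by norm_num)]
  have h5 := Real.exp_pos (Real.pi * s.im)
  generalize Real.exp (Real.pi * s.im) = E at *
  generalize (4 : ℝ) ^ s.re = F at *
  field_simp

lemma quadK_kC_le_of_vanish {η : ℝ} (hη : 0 < η) {g : I01 → ℂ} (hg : Continuous g)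
    (hg0 : ∀ u : I01, (u : ℝ) ≤ η → g u = 0) {t : ℝ} (ht : 0 < t) :
    (quadK (mu hs) (kC hs (c0 s) t) g).re ≤ ∫ u, ‖g u‖ ^ 2 ∂(mu hs) := by
  have := isProbabilityMeasure_muI (Bs_pos hs)
  set G : I01 → ℂ := fun u => cexp (I * t * u) * g u with hG
  have hGc : Continuous G := by fun_prop
  have hG0 : ∀ u : I01, (u : ℝ) ≤ η → G u = 0 := fun u h => by rw [hG]; simp [hg0 u h]
  have key := quadK_nK_zero_le hs hη hGc hG0 ht
  have hn : ∀ u, ‖G u‖ = ‖g u‖ := fun u => by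
    rw [hG]
    beta_reduce
    rw [norm_mul, show I * (t : ℂ) * ((u : ℝ) : ℂ) = ((t * u : ℝ) : ℂ) * I by push_cast; ring,
      norm_exp_ofReal_mul_I, one_mul]
  simp only [hn] at key
  have e : quadK (mu hs) (kC hs (c0 s) t) g =
      ((c0 s / Bs s : ℝ) : ℂ) * quadK (muI (Bs s)) (nK s η 0 t) G := by
    rw [quadK, quadK, ← integral_const_mul]
    refine integral_congr_ae (.of_forall fun p => ?_)
    beta_reduce
    rcases le_or_gt (p.1 : ℝ) η with h1 | h1
    · simp [hG, hg0 _ h1]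
    rcases le_or_gt (p.2 : ℝ) η with h2 | h2
    · simp [hG, hg0 _ h2]
    have ek : kC hs (c0 s) t p = ((c0 s / Bs s : ℝ) : ℂ) * (t : ℂ) ^ ((Bs s : ℝ) : ℂ) *
      hker s (t * ((p.1 : ℝ) : ℂ)) (t * ((p.2 : ℝ) : ℂ)) := rfl
    rw [ek, nK, zShift, zShift, max_eq_left h1.le, max_eq_left h2.le, ← ofReal_cpow ht.le]
    simp only [hG, map_mul, conj_ofReal, conj_I, ← exp_conj, ofReal_zero, mul_zero,
      add_zero]
    have e2 : cexp (-I * t * ((p.1 : ℝ) : ℂ)) * cexp (t * (I * (((p.1 : ℝ) : ℂ) - ((p.2 : ℝ) : ℂ)))) *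
        cexp (I * t * ((p.2 : ℝ) : ℂ)) = 1 := by
      rw [← exp_add, ← exp_add, ← exp_zero]
      congr 1
      ring
    generalize hker s _ _ = k
    linear_combination (-((starRingEnd ℂ) (g p.1) * (((c0 s / Bs s : ℝ) : ℂ) *
      ((t ^ Bs s : ℝ) : ℂ) * k) * g p.2)) * e2
  rw [e, re_ofReal_mul]
  have h := mul_le_mul_of_nonneg_left key (div_pos (c0_pos hs) (Bs_pos hs)).le
  rw [← mul_assoc, c0_mul hs, one_mul] at h
  exact h

lemma ae_mu_pos : ∀ᵐ u : I01 ∂(mu hs), 0 < (u : ℝ) := by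
  rw [mu, muI, ae_map_iff (continuous_powI (Bs_pos hs)).aemeasurable
    (measurableSet_lt measurable_const measurable_subtype_coe)]
  filter_upwards [ae_restrict_mem measurableSet_Ioo] with y hy
  rw [coe_powI (Bs_pos hs) hy.1.le hy.2.le]
  exact Real.rpow_pos_of_pos hy.1 _

omit hs in
/-- A continuous cutoff vanishing near the origin. -/
def cutoff (n : ℕ) (u : I01) : ℝ := min 1 (max 0 ((n + 1) * (u : ℝ) - 1))

omit hs in
lemma tendsto_cutoff {u : I01} (hu : 0 < (u : ℝ)) : Tendsto (fun n => cutoff n u) atTop (𝓝 1) := by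
  refine tendsto_const_nhds.congr' ?_
  obtain ⟨N, hN⟩ := exists_nat_ge (2 / (u : ℝ))
  filter_upwards [eventually_ge_atTop N] with n hn
  have h1 : (2 / (u : ℝ)) ≤ n := hN.trans (by exact_mod_cast hn)
  rw [div_le_iff₀ hu] at h1
  rw [cutoff, min_eq_left]
  exact le_max_of_le_right (by nlinarith)

omit hs in
lemma abs_cutoff_le (n : ℕ) (u : I01) : |cutoff n u| ≤ 1 := by
  have : 0 ≤ cutoff n u := le_min zero_le_one (le_max_left _ _)
  rw [abs_of_nonneg this]
  exact min_le_left _ _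

lemma quadK_kC_le {g : I01 → ℂ} (hg : Continuous g) {t : ℝ} (ht : 0 < t) :
    (quadK (mu hs) (kC hs (c0 s) t) g).re ≤ ∫ u, ‖g u‖ ^ 2 ∂(mu hs) := by
  set G : ℕ → I01 → ℂ := fun n u => (cutoff n u : ℂ) * g u with hG
  have hχ : ∀ n, Continuous (cutoff n) := fun n => by unfold cutoff; fun_prop
  have hGc : ∀ n, Continuous (G n) := fun n => by have := hχ n; fun_prop
  have hGn : ∀ n u, ‖G n u‖ ≤ ‖g u‖ := fun n u => by
    rw [hG]
    beta_reduce
    rw [norm_mul, norm_real]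
    exact mul_le_of_le_one_left (norm_nonneg _) (abs_cutoff_le n u)
  have hG0 : ∀ (n : ℕ) (u : I01), (u : ℝ) ≤ 1 / ((n : ℝ) + 1) → G n u = 0 := fun n u h => by
    rw [le_div_iff₀ (by positivity)] at h
    have : cutoff n u = 0 := by
      rw [cutoff, max_eq_left (by linarith), min_eq_right zero_le_one]
    rw [hG]
    simp [this]
  have hGt : ∀ u : I01, 0 < (u : ℝ) → Tendsto (fun n => G n u) atTop (𝓝 (g u)) := fun u hu => by
    have := ((continuous_ofReal.tendsto 1).comp (tendsto_cutoff hu)).mul_const (g u)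
    simpa using this
  have hK := (kC hs (c0 s) t).continuous
  have hgc : Continuous fun u => (starRingEnd ℂ) (g u) := continuous_conj.comp hg
  have h1 : Tendsto (fun n => quadK (mu hs) (kC hs (c0 s) t) (G n)) atTop
      (𝓝 (quadK (mu hs) (kC hs (c0 s) t) g)) := by
    refine tendsto_integral_of_dominated_convergence
      (fun p : I01 × I01 => ‖g p.1‖ * ‖kC hs (c0 s) t p‖ * ‖g p.2‖) (fun n => ?_)
      (integrable_of_continuous_compact (by fun_prop)) (fun n => .of_forall fun p => ?_) ?_
    · have := hGc n
      have h2 : Continuous fun u => (starRingEnd ℂ) (G n u) := continuous_conj.comp this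
      exact Continuous.aestronglyMeasurable (by fun_prop)
    · rw [norm_mul, norm_mul, RCLike.norm_conj]
      gcongr
      · exact hGn n _
      · exact hGn n _
    · filter_upwards [Measure.quasiMeasurePreserving_fst.ae (ae_mu_pos hs),
        Measure.quasiMeasurePreserving_snd.ae (ae_mu_pos hs)] with p hp1 hp2
      exact (((continuous_conj.tendsto _).comp (hGt _ hp1)).mul_const _).mul (hGt _ hp2)
  have h2 : Tendsto (fun n => ∫ u, ‖G n u‖ ^ 2 ∂(mu hs)) atTop (𝓝 (∫ u, ‖g u‖ ^ 2 ∂(mu hs))) := by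
    refine tendsto_integral_of_dominated_convergence (fun u => ‖g u‖ ^ 2) (fun n => ?_)
      (integrable_of_continuous_compact (by fun_prop)) (fun n => .of_forall fun p => ?_) ?_
    · have := hGc n
      exact Continuous.aestronglyMeasurable (by fun_prop)
    · rw [Real.norm_of_nonneg (by positivity)]
      have := hGn n p
      gcongr
    · filter_upwards [ae_mu_pos hs] with u hu
      exact (hGt _ hu).norm.pow 2
  refine le_of_tendsto_of_tendsto' ((continuous_re.tendsto _).comp h1) h2 fun n => ?_
  exact quadK_kC_le_of_vanish hs (by positivity : (0 : ℝ) < 1 / ((n : ℝ) + 1)) (hGc n) (hG0 n) ht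

end

section
variable {X : Type*} [TopologicalSpace X] [CompactSpace X] [T2Space X]
  [SecondCountableTopology X] [MeasurableSpace X] [BorelSpace X] (μ : Measure X)
  [IsProbabilityMeasure μ]

omit [CompactSpace X] [T2Space X] [SecondCountableTopology X] [BorelSpace X] [IsProbabilityMeasure μ] in
lemma conj_frF {κ : C(X × X, ℂ)} (hr : ∀ u v, (starRingEnd ℂ) (κ (u, v)) = κ (u, v)) :
    (starRingEnd ℂ) (frF μ κ) = frF μ κ := by
  have h : ∀ n, (starRingEnd ℂ) (frd μ κ n) = frd μ κ n := fun n => by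
    rw [frd, ← integral_conj]
    refine integral_congr_ae (.of_forall fun x => ?_)
    beta_reduce
    rw [RingHom.map_det]
    congr 1
    ext i j
    exact hr _ _
  rw [frF, conj_tsum]
  refine tsum_congr fun n => ?_
  rw [map_mul, h, map_div₀, map_pow, map_neg, map_one, map_natCast]

lemma frF_mul_nonneg {κ : C(X × X, ℂ)} (hr : ∀ u v, (starRingEnd ℂ) (κ (u, v)) = κ (u, v))
    (hκ : ∀ u v, κ (u, v) = κ (v, u))
    (hle : ∀ g : X → ℂ, Continuous g → (quadK μ κ g).re ≤ ∫ u, ‖g u‖ ^ 2 ∂μ)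
    {P Q : C(X, ℂ)} (hPQ : ∀ u, P u = (starRingEnd ℂ) (Q u)) :
    0 ≤ (frF μ κ * (frF μ κ * intC μ (P * Q) + intC μ (P * opK μ (frDC μ κ) Q))).re := by
  rcases eq_or_ne (frF μ κ) 0 with hF | hF
  · simp [hF]
  obtain ⟨F, hFr⟩ := conj_eq_iff_real.1 (conj_frF μ hr)
  have hu := isUnit_one_sub_opK μ hκ hF
  set g := res μ κ Q with hg
  have e1 : frF μ κ * intC μ (P * Q) + intC μ (P * opK μ (frDC μ κ) Q) =
      frF μ κ * intC μ (P * g) := by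
    have h := frF_smul_res μ hκ hF Q
    have h2 : intC μ (P * (frF μ κ • g)) = intC μ (P * (frF μ κ • Q + opK μ (frDC μ κ) Q)) := by
      rw [h]
    rw [mul_add, map_add, mul_smul_comm, mul_smul_comm, map_smul, map_smul, smul_eq_mul,
      smul_eq_mul] at h2
    exact h2.symm
  have hres := res_eq μ hu Q
  have hQ : ∀ u, Q u = g u - ∫ v, κ (u, v) * g v ∂μ := fun u => by
    have := congrArg (fun f : C(X, ℂ) => f u) hres
    simp only [ContinuousMap.add_apply, opK_apply] at this
    rw [← hg] at this
    rw [this, add_sub_cancel_right]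
  have hgc := g.continuous
  have hgcc : Continuous fun u => (starRingEnd ℂ) (g u) := continuous_conj.comp hgc
  have hκc := κ.continuous
  have e2 : intC μ (P * g) = (∫ u, ((‖g u‖ ^ 2 : ℝ) : ℂ) ∂μ) - quadK μ κ g := by
    rw [intC_apply, quadK, ← integral_prod_swap, integral_prod _
      (integrable_of_continuous_compact (by simp only [Prod.swap]; fun_prop)), ← integral_sub]
    · refine integral_congr_ae (.of_forall fun u => ?_)
      beta_reduce
      rw [ContinuousMap.mul_apply, hPQ, hQ, map_sub, ← integral_conj, sub_mul, ← normSq_eq_norm_sq,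
        normSq_eq_conj_mul_self, ← integral_mul_const]
      congr 1
      refine integral_congr_ae (.of_forall fun v => ?_)
      beta_reduce
      rw [map_mul, hr, Prod.swap_prod_mk, hκ v u]
      ring
    · exact integrable_of_continuous_compact (by fun_prop)
    · refine (Integrable.integral_prod_left (μ := μ) (ν := μ)
        (f := fun p => (starRingEnd ℂ) (g p.2) * κ p.swap * g p.1)
        (integrable_of_continuous_compact (by simp only [Prod.swap]; fun_prop)))
  rw [e1, ← mul_assoc, e2, hFr, ← ofReal_mul, re_ofReal_mul, sub_re, integral_complex_ofReal, ofReal_re]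
  exact mul_nonneg (mul_self_nonneg F) (sub_nonneg.2 (hle g hgc))

end

section

variable {s : ℂ} (hs : -(1 / 2 : ℝ) < s.re)

lemma conj_fC (c : ℝ) {t : ℝ} (ht : 0 < t) : (starRingEnd ℂ) (fC hs c t) = fC hs c t :=
  conj_frF _ (conj_kC hs c ht)

lemma fC_eq_re (c : ℝ) {t : ℝ} (ht : 0 < t) : fC hs c t = ((fC hs c t).re : ℂ) :=
  (conj_eq_iff_re.1 (conj_fC hs c ht)).symm

lemma hasDerivAt_re_fC (c : ℝ) {t : ℝ} (ht : 0 < t) :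
    HasDerivAt (fun t : ℝ => (fC hs c t).re) (deriv (fC hs c) t).re t := by
  have h := ((differentiableOn_fC hs c).differentiableAt
    ((isOpen_lt continuous_const continuous_re).mem_nhds (x := (t : ℂ)) (by simpa using ht))).hasDerivAt
  exact Complex.reCLM.hasFDerivAt.comp_hasDerivAt t h.comp_ofReal

lemma deriv_mul_fC_nonpos {t : ℝ} (ht : 0 < t) :
    (fC hs (c0 s) t).re * (deriv (fC hs (c0 s)) t).re ≤ 0 := by
  have h := frF_mul_nonneg (mu hs) (conj_kC hs (c0 s) ht) (kC_symm hs (c0 s) t)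
    (fun g hg => quadK_kC_le hs hg ht) (P := pC hs t) (Q := qC hs t) (fun u => by
      have := conj_pg hs (t * ((u : ℝ) : ℂ))
      rw [map_mul, conj_ofReal, conj_ofReal] at this
      exact this.symm)
  have e : ((c0 s : ℂ) * (t : ℂ) ^ (2 * s.re : ℂ)) = ((c0 s * t ^ (2 * s.re) : ℝ) : ℂ) := by
    rw [ofReal_mul, ofReal_cpow ht.le]
    push_cast
    rfl
  have e2 : (fC hs (c0 s) t).re * (deriv (fC hs (c0 s)) t).re =
      (fC hs (c0 s) t * deriv (fC hs (c0 s)) t).re := by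
    conv_rhs => rw [fC_eq_re hs (c0 s) ht, re_ofReal_mul]
  rw [e2, (hasDerivAt_fC hs (c0 s) ht).deriv, e]
  have hc : 0 ≤ c0 s * t ^ (2 * s.re) := by
    have := c0_pos hs
    positivity
  have e3 : ∀ F A : ℂ, F * (-((c0 s * t ^ (2 * s.re) : ℝ) : ℂ) * A) =
      -(((c0 s * t ^ (2 * s.re) : ℝ) : ℂ) * (F * A)) := fun F A => by ring
  rw [e3, neg_re, re_ofReal_mul]
  exact neg_nonpos.2 (mul_nonneg hc h)

lemma fC_ne_zero {t : ℝ} (ht : 0 < t) : fC hs (c0 s) t ≠ 0 := by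
  intro h0
  set f : ℝ → ℝ := fun t => (fC hs (c0 s) t).re with hf
  have hd : ∀ x, 0 < x → HasDerivAt (fun t => f t ^ 2) (2 * (f x * (deriv (fC hs (c0 s)) x).re)) x :=
    fun x hx => by
      refine ((hasDerivAt_re_fC hs (c0 s) hx).pow 2).congr_deriv ?_
      simp only [hf]
      push_cast
      ring
  have hanti : AntitoneOn (fun t => f t ^ 2) (Ioi 0) := by
    refine antitoneOn_of_deriv_nonpos (convex_Ioi 0) (fun x hx => (hd x hx).continuousAt.continuousWithinAt)
      (fun x hx => ?_) (fun x hx => ?_)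
    · rw [interior_Ioi] at hx
      exact (hd x hx).differentiableAt.differentiableWithinAt
    · rw [interior_Ioi] at hx
      rw [(hd x hx).deriv]
      have := deriv_mul_fC_nonpos hs (t := x) hx
      linarith
  have hz : ∀ x : ℝ, t ≤ x → fC hs (c0 s) x = 0 := fun x hx => by
    have h1 := hanti (mem_Ioi.2 ht) (mem_Ioi.2 (ht.trans_le hx)) hx
    simp only [hf, h0, zero_re] at h1
    have h2 : (fC hs (c0 s) x).re = 0 := by nlinarith
    rw [fC_eq_re hs (c0 s) (ht.trans_le hx), h2, ofReal_zero]
  have hU : IsOpen {z : ℂ | 0 < z.re} := isOpen_lt continuous_const continuous_re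
  have han := (differentiableOn_fC hs (c0 s)).analyticOnNhd hU
  have hEq := han.eqOn_of_preconnected_of_frequently_eq (analyticOnNhd_const (v := (0 : ℂ)))
    (convex_halfSpace_re_gt 0).isPreconnected (z₀ := ((t + 1 : ℝ) : ℂ))
    (by simp only [mem_ofPred_eq, ofReal_re]; linarith) (by
      have hcont : Tendsto (fun x : ℝ => (x : ℂ)) (𝓝[≠] (t + 1)) (𝓝[≠] ((t + 1 : ℝ) : ℂ)) := by
        refine tendsto_nhdsWithin_iff.2 ⟨(continuous_ofReal.tendsto _).mono_left nhdsWithin_le_nhds, ?_⟩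
        filter_upwards [self_mem_nhdsWithin] with x hx
        simpa using fun h => hx (by exact_mod_cast h)
      refine hcont.frequently ?_
      refine Eventually.frequently ?_
      filter_upwards [nhdsWithin_le_nhds (Ioi_mem_nhds (show t < t + 1 by linarith))] with x hx
      exact hz x (le_of_lt hx))
  have hlim := tendsto_fC_zero hs (c0 s)
  have hlim0 : Tendsto (fun t : ℝ => fC hs (c0 s) t) (𝓝[>] 0) (𝓝 0) := by
    refine tendsto_const_nhds.congr' ?_
    filter_upwards [self_mem_nhdsWithin] with x hx
    exact (hEq (by simpa using hx)).symm
  exact one_ne_zero (tendsto_nhds_unique hlim hlim0)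

lemma isUnit_kC {t : ℝ} (ht : 0 < t) : IsUnit (1 - opK (mu hs) (kC hs (c0 s) t)) :=
  isUnit_one_sub_opK (mu hs) (kC_symm hs (c0 s) t) (fC_ne_zero hs ht)

end

section

variable {s : ℂ} (hs : -(1 / 2 : ℝ) < s.re)

/-- The common real factor of `Ptilde` and `Qfun` on the positive half-line. -/
def amp (s : ℂ) (x : ℝ) : ℝ := (2 / x) ^ s.re * Real.exp (Real.pi * s.im / 2)

lemma prefac_eq {x : ℝ} (hx : 0 < x) :
    prefac s x = (amp s x : ℂ) * cexp (-(I * ((x⁻¹ : ℝ) : ℂ))) := by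
  rw [prefac, Real.sign_of_pos hx, abs_of_pos (by positivity), amp, exp_add, ofReal_mul, ofReal_exp,
    mul_one, ofReal_inv, neg_div, div_eq_mul_inv I]
  ring

lemma Ptilde_eq {x : ℝ} (hx : 0 < x) : Ptilde s x = (amp s x : ℂ) * pf s ((x⁻¹ : ℝ) : ℂ) := by
  rw [Ptilde, prefac_eq hx, pf, Bs, ofReal_inv, div_eq_mul_inv, mul_assoc]

include hs

lemma Qfun_eq {x : ℝ} (hx : 0 < x) : Qfun s x = (amp s x : ℂ) *
    (-(Bs s * I) * (pg s ((x⁻¹ : ℝ) : ℂ) - pf s ((x⁻¹ : ℝ) : ℂ))) := by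
  have h := oneF1_succ_sub (Bs_ne hs) s (2 * I * ((x⁻¹ : ℝ) : ℂ))
  have hB : (Bs s : ℂ) ≠ 0 := ofReal_ne_zero.2 (Bs_pos hs).ne'
  have e : ((2 * s.re + 2 : ℝ) : ℂ) = (Bs s : ℂ) + 1 := by rw [Bs]; push_cast; ring
  rw [Qfun, prefac_eq hx, pf, pg, e, div_eq_mul_inv (2 * I), ← ofReal_inv, ← mul_sub, h,
    div_eq_mul_inv 2 (x : ℂ), ← ofReal_inv]
  generalize cexp _ = E
  generalize oneF1 _ _ _ = F
  generalize ((x⁻¹ : ℝ) : ℂ) = X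
  field_simp
  linear_combination (X * E * F * amp s x) * I_sq

lemma Ptilde_mul_Qfun_sub {x y : ℝ} (hx : 0 < x) (hy : 0 < y) :
    Ptilde s x * Qfun s y - Qfun s x * Ptilde s y =
      (x - y) * (2 * (amp s x * amp s y * (x⁻¹ * y⁻¹) : ℝ) *
        hker s ((x⁻¹ : ℝ) : ℂ) ((y⁻¹ : ℝ) : ℂ)) := by
  have h := sub_mul_hker hs ((x⁻¹ : ℝ) : ℂ) ((y⁻¹ : ℝ) : ℂ)
  have e : ((x⁻¹ : ℝ) : ℂ) - ((y⁻¹ : ℝ) : ℂ) = -(x - y) * ((x⁻¹ : ℝ) * (y⁻¹ : ℝ)) := by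
    have : (x : ℂ) ≠ 0 := ofReal_ne_zero.2 hx.ne'
    have : (y : ℂ) ≠ 0 := ofReal_ne_zero.2 hy.ne'
    push_cast
    field_simp
    ring
  rw [e] at h
  rw [Ptilde_eq hx, Ptilde_eq hy, Qfun_eq hs hx, Qfun_eq hs hy]
  push_cast at h ⊢
  linear_combination (2 * amp s x * amp s y) * h

omit hs in
lemma differentiableAt_amp {x : ℝ} (hx : 0 < x) : DifferentiableAt ℝ (amp s) x := by
  unfold amp
  refine DifferentiableAt.mul_const (DifferentiableAt.rpow_const ?_ (Or.inl (by positivity))) _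
  exact (differentiableAt_const _).div differentiableAt_id hx.ne'

omit hs in
lemma differentiableAt_comp_inv {f : ℂ → ℂ} (hf : Differentiable ℂ f) {x : ℝ} (hx : 0 < x) :
    DifferentiableAt ℝ (fun x : ℝ => f ((x⁻¹ : ℝ) : ℂ)) x := by
  have h1 : DifferentiableAt ℝ (fun y : ℝ => f y) x⁻¹ :=
    ((hf _).hasDerivAt.comp_ofReal).differentiableAt
  exact h1.comp x (differentiableAt_inv hx.ne')

lemma differentiableAt_Ptilde {x : ℝ} (hx : 0 < x) : DifferentiableAt ℝ (Ptilde s) x := by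
  have h : DifferentiableAt ℝ (fun x => (amp s x : ℂ) * pf s ((x⁻¹ : ℝ) : ℂ)) x :=
    (differentiableAt_amp hx).hasDerivAt.ofReal_comp.differentiableAt.mul
      (differentiableAt_comp_inv (differentiable_pf hs) hx)
  refine h.congr_of_eventuallyEq ?_
  filter_upwards [Ioi_mem_nhds hx] with y hy using Ptilde_eq hy

lemma differentiableAt_Qfun {x : ℝ} (hx : 0 < x) : DifferentiableAt ℝ (Qfun s) x := by
  have h : DifferentiableAt ℝ (fun x => (amp s x : ℂ) *
      (-(Bs s * I) * (pg s ((x⁻¹ : ℝ) : ℂ) - pf s ((x⁻¹ : ℝ) : ℂ)))) x :=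
    (differentiableAt_amp hx).hasDerivAt.ofReal_comp.differentiableAt.mul
      (((differentiableAt_comp_inv (differentiable_pg hs) hx).sub
        (differentiableAt_comp_inv (differentiable_pf hs) hx)).const_mul _)
  refine h.congr_of_eventuallyEq ?_
  filter_upwards [Ioi_mem_nhds hx] with y hy using Qfun_eq hs hy

lemma deriv_Ptilde_mul_sub {x : ℝ} (hx : 0 < x) :
    deriv (Ptilde s) x * Qfun s x - deriv (Qfun s) x * Ptilde s x =
      2 * (amp s x * amp s x * (x⁻¹ * x⁻¹) : ℝ) * hker s ((x⁻¹ : ℝ) : ℂ) ((x⁻¹ : ℝ) : ℂ) := by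
  set R : ℝ → ℂ := fun y => 2 * (amp s y * amp s x * (y⁻¹ * x⁻¹) : ℝ) *
    hker s ((y⁻¹ : ℝ) : ℂ) ((x⁻¹ : ℝ) : ℂ) with hR
  have hinv : ContinuousAt (fun y : ℝ => y⁻¹) x := continuousAt_inv₀ hx.ne'
  have hRc : ContinuousAt R x := by
    refine ContinuousAt.mul (continuousAt_const.mul (continuous_ofReal.continuousAt.comp ?_)) ?_
    · exact ((differentiableAt_amp hx).continuousAt.mul continuousAt_const).mul
        (hinv.mul continuousAt_const)
    · exact ContinuousAt.comp (g := fun q : ℂ × ℂ => hker s q.1 q.2)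
        (f := fun y : ℝ => (((y⁻¹ : ℝ) : ℂ), ((x⁻¹ : ℝ) : ℂ)))
        (continuous_hker hs).continuousAt
        ((continuous_ofReal.continuousAt.comp hinv).prodMk continuousAt_const)
  have h1 : HasDerivAt (fun y => Ptilde s y * Qfun s x - Qfun s y * Ptilde s x)
      (deriv (Ptilde s) x * Qfun s x - deriv (Qfun s) x * Ptilde s x) x :=
    ((differentiableAt_Ptilde hs hx).hasDerivAt.mul_const _).sub
      ((differentiableAt_Qfun hs hx).hasDerivAt.mul_const _)
  have h2 : HasDerivAt (fun y => Ptilde s y * Qfun s x - Qfun s y * Ptilde s x) (R x) x := by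
    rw [hasDerivAt_iff_tendsto_slope]
    refine (hRc.tendsto.mono_left nhdsWithin_le_nhds).congr' ?_
    filter_upwards [self_mem_nhdsWithin, nhdsWithin_le_nhds (Ioi_mem_nhds hx)] with y hne hy
    have hsub : y - x ≠ 0 := sub_ne_zero.2 hne
    rw [slope_def_module, Ptilde_mul_Qfun_sub hs hy hx, mul_comm (Ptilde s x), sub_self, sub_zero,
      real_smul, ← ofReal_sub, ← mul_assoc, ← ofReal_mul, inv_mul_cancel₀ hsub, ofReal_one, one_mul]
  exact h1.unique h2

lemma KinfC_eq {x y : ℝ} (hx : 0 < x) (hy : 0 < y) : KinfC s x y =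
    cinf s * (2 * (amp s x * amp s y * (x⁻¹ * y⁻¹) : ℝ) *
      hker s ((x⁻¹ : ℝ) : ℂ) ((y⁻¹ : ℝ) : ℂ)) := by
  rw [KinfC]
  split_ifs with h
  · subst h
    rw [deriv_Ptilde_mul_sub hs hx]
  · have : (x : ℂ) - y ≠ 0 := sub_ne_zero.2 (by exact_mod_cast h)
    rw [Ptilde_mul_Qfun_sub hs hx hy]
    field_simp

lemma cinf_eq : cinf s * (2 * (4 ^ s.re * Real.exp (Real.pi * s.im) : ℝ)) = c0 s := by
  have h2 := norm_pos_iff.2 (Gamma_Bs_ne hs)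
  have hB := Bs_pos hs
  have e : Complex.Gamma ((starRingEnd ℂ) s + 1) = (starRingEnd ℂ) (Complex.Gamma (s + 1)) := by
    rw [← Complex.Gamma_conj, map_add, map_one]
  have e2 : Complex.Gamma ((2 * s.re + 2 : ℝ) : ℂ) = Bs s * Complex.Gamma (Bs s) := by
    rw [← Complex.Gamma_add_one _ (ofReal_ne_zero.2 hB.ne'), Bs]
    congr 1
    push_cast
    ring
  have e3 : ((2 * s.re + 1 : ℝ) : ℂ) = Bs s := by rw [Bs]
  have e4 : Complex.Gamma (Bs s) * Complex.Gamma (Bs s) = ((‖Complex.Gamma (Bs s)‖ ^ 2 : ℝ) : ℂ) := by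
    rw [← normSq_eq_norm_sq, normSq_eq_conj_mul_self, ← Complex.Gamma_conj, conj_ofReal]
  have e5 : Complex.Gamma (Bs s) * (Bs s * Complex.Gamma (Bs s)) =
      ((Bs s * ‖Complex.Gamma (Bs s)‖ ^ 2 : ℝ) : ℂ) := by
    rw [ofReal_mul, ← e4]
    ring
  rw [cinf, e, mul_conj, normSq_eq_norm_sq, e2, e3, e5, c0]
  have hp : (Real.pi : ℂ) ≠ 0 := ofReal_ne_zero.2 Real.pi_ne_zero
  have h6 : ((Bs s * ‖Complex.Gamma (Bs s)‖ ^ 2 : ℝ) : ℂ) ≠ 0 := ofReal_ne_zero.2 (by positivity)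
  push_cast at h6 ⊢
  have h7 := left_ne_zero_of_mul h6
  have h8 := right_ne_zero_of_mul h6
  field_simp

omit hs in
lemma amp_mul {x y : ℝ} (hx : 0 < x) (hy : 0 < y) : amp s x * amp s y * (x⁻¹ * y⁻¹) =
    4 ^ s.re * Real.exp (Real.pi * s.im) * (x⁻¹ ^ (s.re + 1) * y⁻¹ ^ (s.re + 1)) := by
  have h2 : (4 : ℝ) ^ s.re = 2 ^ s.re * 2 ^ s.re := by
    rw [← Real.mul_rpow (by norm_num) (by norm_num)]; norm_num
  have h3 : Real.exp (Real.pi * s.im) = Real.exp (Real.pi * s.im / 2) * Real.exp (Real.pi * s.im / 2) := by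
    rw [← Real.exp_add, add_halves]
  rw [amp, amp, div_eq_mul_inv 2 x, div_eq_mul_inv 2 y, Real.mul_rpow (by norm_num) (by positivity),
    Real.mul_rpow (by norm_num) (by positivity), h2, h3, Real.rpow_add (by positivity),
    Real.rpow_add (by positivity), Real.rpow_one, Real.rpow_one]
  ring

lemma KinfC_eq_hker {x y : ℝ} (hx : 0 < x) (hy : 0 < y) : KinfC s x y =
    ((c0 s * (x⁻¹ ^ (s.re + 1) * y⁻¹ ^ (s.re + 1)) : ℝ) : ℂ) *
      hker s ((x⁻¹ : ℝ) : ℂ) ((y⁻¹ : ℝ) : ℂ) := by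
  rw [KinfC_eq hs hx hy, amp_mul hx hy, ofReal_mul (c0 s), ← cinf_eq hs]
  push_cast
  ring

lemma Kinf_coe {x y : ℝ} (hx : 0 < x) (hy : 0 < y) : (Kinf s x y : ℂ) = KinfC s x y := by
  rw [Kinf]
  refine conj_eq_iff_re.1 ?_
  rw [KinfC_eq_hker hs hx hy, map_mul, conj_ofReal, conj_hker hs, conj_ofReal, conj_ofReal]

end

section

lemma prod_mul_det_of_mul {n : Type*} [Fintype n] [DecidableEq n] {R : Type*} [CommRing R]
    {d w : n → R} {c C : R} (h : n → n → R) (hC : ∀ i, d i * (c * (w i * w i)) = C) :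
    (∏ i, d i) * (Matrix.of fun i j => c * (w i * w j) * h i j).det =
      (Matrix.of fun i j => C * h i j).det := by
  have e1 : (Matrix.of fun i j => c * (w i * w j) * h i j) =
      Matrix.of fun i j => (c * w i) * (Matrix.of fun i j => w j * (Matrix.of h) i j) i j := by
    ext i j
    simp only [Matrix.of_apply]
    ring
  have e2 : (Matrix.of fun i j => C * h i j) =
      Matrix.of fun i j => (d i * (c * (w i * w i))) * (Matrix.of h) i j := by
    ext i j
    simp only [Matrix.of_apply, hC]
  rw [e1, e2, Matrix.det_mul_column, Matrix.det_mul_column, Matrix.det_mul_row]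
  simp only [Finset.prod_mul_distrib]
  ring

/-- The change of variables carrying the unit interval to the half-line `(τ⁻¹, ∞)`. -/
def halfLineMap (B τ y : ℝ) : ℝ := (τ * y ^ (1 / B))⁻¹

variable {B τ : ℝ} (hB : 0 < B) (hτ : 0 < τ)
include hB hτ

lemma halfLineMap_image : halfLineMap B τ '' Ioo 0 1 = Ioi τ⁻¹ := by
  ext x
  constructor
  · rintro ⟨y, ⟨h0, h1⟩, rfl⟩
    have := Real.rpow_lt_one h0.le h1 (z := 1 / B) (by positivity)
    have := Real.rpow_pos_of_pos h0 (1 / B)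
    exact (inv_lt_inv₀ hτ (mul_pos hτ this)).2 (by nlinarith)
  · intro (hx : τ⁻¹ < x)
    have hx0 : 0 < x := (inv_pos.2 hτ).trans hx
    have h1 : 1 < τ * x := by
      have := mul_lt_mul_of_pos_left hx hτ
      rwa [mul_inv_cancel₀ hτ.ne'] at this
    refine ⟨((τ * x)⁻¹) ^ B, ⟨by positivity, Real.rpow_lt_one (by positivity) (inv_lt_one_of_one_lt₀ h1)
      hB⟩, ?_⟩
    rw [halfLineMap, ← Real.rpow_mul (by positivity), mul_one_div_cancel hB.ne', Real.rpow_one]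
    field_simp

lemma halfLineMap_injOn : InjOn (halfLineMap B τ) (Ioo 0 1) := by
  intro x hx y hy h
  have h1 := mul_left_cancel₀ hτ.ne' (inv_injective h)
  exact (Real.rpow_left_inj hx.1.le hy.1.le (by positivity)).1 h1

lemma hasDerivAt_halfLineMap {y : ℝ} (hy : 0 < y) :
    HasDerivAt (halfLineMap B τ) (-(B * τ * y ^ (1 / B) * y)⁻¹) y := by
  have h := ((Real.hasDerivAt_rpow_const (p := 1 / B) (Or.inl hy.ne')).const_mul τ).inv
    (by positivity)
  refine HasDerivAt.congr_deriv (f := halfLineMap B τ) h ?_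
  rw [Real.rpow_sub_one hy.ne']
  have : 0 < y ^ (1 / B) := by positivity
  generalize y ^ (1 / B) = u at *
  field_simp

lemma integral_pi_Ioi {E : Type*} [NormedAddCommGroup E] [NormedSpace ℝ E] {ι : Type*} [Fintype ι]
    (g : (ι → ℝ) → E) :
    ∫ x in univ.pi fun _ : ι => Ioi τ⁻¹, g x = ∫ y in univ.pi fun _ : ι => Ioo (0 : ℝ) 1,
      (∏ i, (B * τ * y i ^ (1 / B) * y i)⁻¹) • g fun i => halfLineMap B τ (y i) := by
  have him : (fun (y : ι → ℝ) i => halfLineMap B τ (y i)) '' (univ.pi fun _ => Ioo (0 : ℝ) 1) =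
      univ.pi fun _ => Ioi τ⁻¹ := by
    have := Set.piMap_image_univ_pi (fun _ : ι => halfLineMap B τ) (fun _ => Ioo (0 : ℝ) 1)
    rw [halfLineMap_image hB hτ] at this
    exact this
  rw [← him, integral_image_eq_integral_abs_det_fderiv_smul volume
    (f' := fun y => ContinuousLinearMap.pi fun i =>
      (ContinuousLinearMap.toSpanSingleton ℝ (-(B * τ * y i ^ (1 / B) * y i)⁻¹)).comp
        (ContinuousLinearMap.proj (R := ℝ) (φ := fun _ : ι => ℝ) i))
    (MeasurableSet.univ_pi fun _ => measurableSet_Ioo)]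
  · refine setIntegral_congr_fun (MeasurableSet.univ_pi fun _ => measurableSet_Ioo) fun y hy => ?_
    rw [ContinuousLinearMap.det_pi, Finset.abs_prod]
    congr 1
    refine Finset.prod_congr rfl fun i _ => ?_
    have := (hy i (mem_univ i)).1
    rw [ContinuousLinearMap.det_toSpanSingleton, abs_neg, abs_of_pos (by positivity)]
  · intro y hy
    refine HasFDerivAt.hasFDerivWithinAt (hasFDerivAt_pi.2 fun i => ?_)
    exact HasFDerivAt.comp (g := halfLineMap B τ) y
      (hasDerivAt_halfLineMap hB hτ (hy i (mem_univ i)).1).hasFDerivAt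
      (ContinuousLinearMap.proj (R := ℝ) (φ := fun _ : ι => ℝ) i).hasFDerivAt
  · intro x hx y hy h
    funext i
    exact halfLineMap_injOn hB hτ (hx i (mem_univ i)) (hy i (mem_univ i)) (congrFun h i)

end

section
variable {s : ℂ} (hs : -(1 / 2 : ℝ) < s.re)

lemma integral_pi_mu {E : Type*} [NormedAddCommGroup E] [NormedSpace ℝ E] {ι : Type*} [Fintype ι]
    {f : (ι → I01) → E} (hf : Continuous f) :
    ∫ x, f x ∂(Measure.pi fun _ => mu hs) =
      ∫ y in univ.pi fun _ : ι => Ioo (0 : ℝ) 1, f fun i => powI (Bs s) (y i) := by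
  have h := measurePreserving_pi (fun _ : ι => volume.restrict (Ioo (0 : ℝ) 1)) (fun _ => mu hs)
    (f := fun _ => powI (Bs s))
    fun _ => ⟨(continuous_powI (Bs_pos hs)).measurable, rfl⟩
  rw [← h.map_eq, integral_map h.measurable.aemeasurable hf.aestronglyMeasurable, volume_pi,
    Measure.restrict_pi_pi]

lemma integral_rhoK {τ : ℝ} (hτ : 0 < τ) (n : ℕ) :
    ((∫ x : Fin n → ℝ in univ.pi fun _ => Ioi τ⁻¹, rhoK (Kinf s) n x : ℝ) : ℂ) =
      frd (mu hs) (kC hs (c0 s) τ) n := by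
  have hB := Bs_pos hs
  rw [← integral_complex_ofReal, integral_pi_Ioi hB hτ, frd, integral_pi_mu hs (by fun_prop)]
  refine setIntegral_congr_fun (MeasurableSet.univ_pi fun _ => measurableSet_Ioo) fun y hy => ?_
  have hy0 : ∀ i, 0 < y i := fun i => (hy i (mem_univ i)).1
  have hy1 : ∀ i, y i < 1 := fun i => (hy i (mem_univ i)).2
  have hu : ∀ i, 0 < y i ^ (1 / Bs s) := fun i => Real.rpow_pos_of_pos (hy0 i) _
  have hx : ∀ i, 0 < halfLineMap (Bs s) τ (y i) := fun i => inv_pos.2 (mul_pos hτ (hu i))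
  have hC : ∀ i, (Bs s * τ * y i ^ (1 / Bs s) * y i)⁻¹ * (c0 s *
      ((halfLineMap (Bs s) τ (y i))⁻¹ ^ (s.re + 1) * (halfLineMap (Bs s) τ (y i))⁻¹ ^ (s.re + 1))) =
        c0 s / Bs s * τ ^ Bs s := fun i => by
    have e : s.re + 1 + (s.re + 1) = Bs s + 1 := by rw [Bs]; ring
    have e2 : (y i ^ (1 / Bs s)) ^ Bs s = y i := by
      rw [← Real.rpow_mul (hy0 i).le, one_div_mul_cancel hB.ne', Real.rpow_one]
    have hu := hu i
    have hy0 := hy0 i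
    have hp : 0 < τ * y i ^ (1 / Bs s) := mul_pos hτ hu
    rw [halfLineMap, inv_inv, ← Real.rpow_add hp, e, Real.rpow_add_one hp.ne',
      Real.mul_rpow hτ.le hu.le, e2]
    generalize y i ^ (1 / Bs s) = u at *
    generalize τ ^ Bs s = T
    field_simp
  have key := prod_mul_det_of_mul (R := ℂ) (n := Fin n)
    (d := fun i => ((Bs s * τ * y i ^ (1 / Bs s) * y i)⁻¹ : ℝ))
    (w := fun i => ((halfLineMap (Bs s) τ (y i))⁻¹ ^ (s.re + 1) : ℝ)) (c := (c0 s : ℂ))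
    (C := ((c0 s / Bs s * τ ^ Bs s : ℝ) : ℂ))
    (fun i j => hker s (τ * ((powI (Bs s) (y i) : ℝ) : ℂ)) (τ * ((powI (Bs s) (y j) : ℝ) : ℂ)))
    (fun i => by rw [← hC i]; push_cast; rfl)
  have e1 : ((rhoK (Kinf s) n fun i => halfLineMap (Bs s) τ (y i) : ℝ) : ℂ) =
      (Matrix.of fun i j => (c0 s : ℂ) *
        ((((halfLineMap (Bs s) τ (y i))⁻¹ ^ (s.re + 1) : ℝ) : ℂ) *
          (((halfLineMap (Bs s) τ (y j))⁻¹ ^ (s.re + 1) : ℝ) : ℂ)) *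
        hker s (τ * ((powI (Bs s) (y i) : ℝ) : ℂ)) (τ * ((powI (Bs s) (y j) : ℝ) : ℂ))).det := by
    rw [rhoK]
    refine (RingHom.map_det ofRealHom _).trans (congrArg Matrix.det ?_)
    ext i j
    change ((Kinf s _ _ : ℝ) : ℂ) = _
    rw [Kinf_coe hs (hx i) (hx j), KinfC_eq_hker hs (hx i) (hx j), Matrix.of_apply,
      coe_powI hB (hy0 i).le (hy1 i).le, coe_powI hB (hy0 j).le (hy1 j).le]
    simp only [halfLineMap, inv_inv, ofReal_mul]
  have e2 : (Matrix.of fun i j => kC hs (c0 s) τ (powI (Bs s) (y i), powI (Bs s) (y j))) =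
      Matrix.of fun i j => ((c0 s / Bs s * τ ^ Bs s : ℝ) : ℂ) *
        hker s (τ * ((powI (Bs s) (y i) : ℝ) : ℂ)) (τ * ((powI (Bs s) (y j) : ℝ) : ℂ)) := by
    ext i j
    simp only [Matrix.of_apply, kC_apply, ofReal_mul, ofReal_cpow hτ.le]
  dsimp only
  rw [e1, e2, ← key, real_smul, ofReal_prod]

lemma fredholmDet_Kinf_inv {τ : ℝ} (hτ : 0 < τ) :
    ((fredholmDet (Kinf s) τ⁻¹ : ℝ) : ℂ) = fC hs (c0 s) τ := by
  rw [fC, frF, (summable_frF_terms (mu hs) (kC hs (c0 s) τ)).tsum_eq_zero_add, frd_zero,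
    fredholmDet, ofReal_add, ofReal_tsum]
  simp only [pow_zero, Nat.factorial_zero, Nat.cast_one, div_one, mul_one, ofReal_one,
    ← integral_rhoK hs hτ]
  push_cast
  rfl

end

section
variable {s : ℂ} (hs : -(1 / 2 : ℝ) < s.re)

lemma fredholmDet_Kinf_inv_eq_re {τ : ℝ} (hτ : 0 < τ) :
    fredholmDet (Kinf s) τ⁻¹ = (fC hs (c0 s) τ).re := by
  rw [← fredholmDet_Kinf_inv hs hτ, ofReal_re]

lemma re_fC_ne_zero {τ : ℝ} (hτ : 0 < τ) : (fC hs (c0 s) τ).re ≠ 0 := fun h =>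
  fC_ne_zero hs hτ (by rw [fC_eq_re hs _ hτ, h, ofReal_zero])

lemma contDiffOn_re_fC (c : ℝ) {n : WithTop ℕ∞} :
    ContDiffOn ℝ n (fun t : ℝ => (fC hs c t).re) (Ioi 0) := fun t (ht : 0 < t) => by
  have h1 : AnalyticAt ℂ (fC hs c) t := (differentiableOn_fC hs c).analyticAt
    ((isOpen_lt continuous_const continuous_re).mem_nhds (by simpa using ht))
  have h2 : ContDiffAt ℝ n (fC hs c) (t : ℂ) := h1.contDiffAt.restrict_scalars ℝ
  exact (reCLM.contDiff.contDiffAt.comp t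
    (h2.comp t ofRealCLM.contDiff.contDiffAt)).contDiffWithinAt

include hs in
lemma thetaInf_eq {τ : ℝ} (hτ : 0 < τ) :
    thetaInf s τ = τ * deriv (fun t : ℝ => Real.log (fC hs (c0 s) t).re) τ := by
  rw [thetaInf, thetaOf]
  congr 1
  refine EventuallyEq.deriv_eq ?_
  filter_upwards [Ioi_mem_nhds hτ] with t ht
  rw [fredholmDet_Kinf_inv_eq_re hs ht]

lemma coe_thetaInf {τ : ℝ} (hτ : 0 < τ) : (thetaInf s τ : ℂ) = -vF hs (c0 s) τ := by
  have h1 := (hasDerivAt_re_fC hs (c0 s) hτ).log (re_fC_ne_zero hs hτ)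
  have h0 := fC_ne_zero hs hτ
  have h2 := (mul_deriv_fC hs (c0 s) hτ h0).deriv
  have hr := fC_eq_re hs (c0 s) hτ
  have h3 : ((deriv (fC hs (c0 s)) τ).re : ℂ) = deriv (fC hs (c0 s)) τ := by
    have h4 := HasDerivAt.comp_ofReal (mul_deriv_fC hs (c0 s) hτ h0)
    have h5 := (hasDerivAt_re_fC hs (c0 s) hτ).ofReal_comp
    rw [h2]
    rw [h2] at h5
    refine h5.unique (h4.congr_of_eventuallyEq ?_)
    filter_upwards [Ioi_mem_nhds hτ] with t ht
    exact (fC_eq_re hs (c0 s) ht).symm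
  rw [thetaInf_eq hs hτ, h1.deriv, ofReal_mul, ofReal_div, h3, ← hr, h2]
  have : (τ : ℂ) ≠ 0 := ofReal_ne_zero.2 hτ.ne'
  field_simp

lemma hasDerivAt_of_ofReal_eq {f : ℝ → ℝ} {g : ℝ → ℂ} {g' : ℂ} {U : Set ℝ} (hU : IsOpen U)
    (h : ∀ t ∈ U, (f t : ℂ) = g t) {t : ℝ} (ht : t ∈ U) (hg : HasDerivAt g g' t) :
    ((deriv f t : ℝ) : ℂ) = g' := by
  have he : (fun t => (f t : ℂ)) =ᶠ[𝓝 t] g := by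
    filter_upwards [hU.mem_nhds ht] with x hx using h x hx
  have h1 := hg.congr_of_eventuallyEq he
  have h2 : HasDerivAt f g'.re t := reCLM.hasFDerivAt.comp_hasDerivAt t h1
  rw [h2.deriv]
  exact h2.ofReal_comp.unique h1

lemma contDiffOn_fredholmDet_Kinf (hs : -(1 / 2 : ℝ) < s.re) {n : WithTop ℕ∞} :
    ContDiffOn ℝ n (fredholmDet (Kinf s)) (Ioi 0) := by
  refine ((contDiffOn_re_fC hs (c0 s)).comp (g := fun t : ℝ => (fC hs (c0 s) t).re)
    (f := fun t : ℝ => t⁻¹) (contDiffOn_id.inv fun t ht => (ne_of_gt ht))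
    fun t (ht : 0 < t) => mem_Ioi.2 (inv_pos.2 ht)).congr fun t ht => ?_
  have h := fredholmDet_Kinf_inv_eq_re hs (inv_pos.2 ht)
  rwa [inv_inv] at h

lemma contDiffOn_thetaInf (hs : -(1 / 2 : ℝ) < s.re) {n : ℕ} :
    ContDiffOn ℝ n (thetaInf s) (Ioi 0) := by
  have h1 : ContDiffOn ℝ (n + 1) (fun t : ℝ => Real.log (fC hs (c0 s) t).re) (Ioi 0) :=
    (contDiffOn_re_fC hs (c0 s)).log fun t ht => re_fC_ne_zero hs ht
  exact (contDiffOn_id.mul (h1.deriv_of_isOpen isOpen_Ioi le_rfl)).congr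
    fun t ht => thetaInf_eq hs ht

end

/-- For `Re(s) > −1/2`, the Fredholm determinant `F_∞` of the limiting
kernel `K_∞` is `C³` and nonvanishing on `(0,∞)`, so `θ_∞(τ) = τ (d/dτ) log F_∞(τ⁻¹)` is
well defined and `C²` on `(0,∞)`, and `θ_∞` solves the σ-form of the Painlevé-V equation
`−τ²(θ″)² = [2(τθ′ − θ) + (θ′)² + i(s̄−s)θ′]² − (θ′)²(θ′ − 2is)(θ′ + 2is̄)` in `ℂ`. -/
theorem thetaInf_solves_PainleveV (s : ℂ) (hs : -(1 / 2 : ℝ) < s.re) :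
    ContDiffOn ℝ 3 (fredholmDet (Kinf s)) (Set.Ioi 0) ∧
    (∀ t : ℝ, 0 < t → fredholmDet (Kinf s) t ≠ 0) ∧
    ContDiffOn ℝ 2 (thetaInf s) (Set.Ioi 0) ∧
    ∀ τ : ℝ, 0 < τ →
      -(τ : ℂ) ^ 2 * ((deriv (deriv (thetaInf s)) τ : ℝ) : ℂ) ^ 2 =
        (2 * ((τ : ℂ) * ((deriv (thetaInf s) τ : ℝ) : ℂ) - ((thetaInf s τ : ℝ) : ℂ)) +
            ((deriv (thetaInf s) τ : ℝ) : ℂ) ^ 2 +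
            Complex.I * ((starRingEnd ℂ) s - s) * ((deriv (thetaInf s) τ : ℝ) : ℂ)) ^ 2 -
          ((deriv (thetaInf s) τ : ℝ) : ℂ) ^ 2 *
            (((deriv (thetaInf s) τ : ℝ) : ℂ) - 2 * Complex.I * s) *
            (((deriv (thetaInf s) τ : ℝ) : ℂ) + 2 * Complex.I * (starRingEnd ℂ) s) := by
  have hU : ∀ t : ℝ, 0 < t → IsUnit (1 - opK (mu hs) (kC hs (c0 s) t)) := fun t ht =>
    isUnit_kC hs ht
  refine ⟨contDiffOn_fredholmDet_Kinf hs, fun t ht => ?_, contDiffOn_thetaInf hs, fun τ hτ => ?_⟩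
  · rw [← inv_inv t, fredholmDet_Kinf_inv_eq_re hs (inv_pos.2 ht)]
    exact re_fC_ne_zero hs (inv_pos.2 ht)
  · have d1 : ∀ t ∈ Ioi (0 : ℝ), ((deriv (thetaInf s) t : ℝ) : ℂ) = th1 hs (c0 s) t :=
      fun t (ht : 0 < t) => hasDerivAt_of_ofReal_eq isOpen_Ioi
        (fun x hx => coe_thetaInf hs hx) ht (hasDerivAt_neg_vF hs (c0 s) ht (hU t ht))
    have d2 : ((deriv (deriv (thetaInf s)) τ : ℝ) : ℂ) = th2 hs (c0 s) τ :=
      hasDerivAt_of_ofReal_eq isOpen_Ioi d1 hτ (hasDerivAt_th1 hs (c0 s) hτ (hU τ hτ))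
    have h := sigma_form hs (c0 s) hU hτ
    rw [d2, d1 τ hτ, coe_thetaInf hs hτ, sub_neg_eq_add]
    exact h
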